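/- Spectral error estimate for the Hermite–Galerkin approximation of the semiclassical equation (Theorem 2.2): let p ≥ 1 and let V : ℝ → ℝ be of class C^{2p+2} with ‖V⁽ⁿ⁾‖_∞ < ∞ for n = 2,…,2p+2. There exist constants K_p > 0 and C_p > 0 depending only on p such that the following holds. Let 𝒮 be a strong solution of the semiclassical equation, let N ∈ ℕ, and let (R_k)_{k=0}^N be a strong solution of the semiclassical Hermite–Galerkin system with initial data R_k(0,x) = ∫_ℝ 𝒮(0,x,y) Φ_k(y) dy. Then for all t ≥ 0, ‖𝒮(t,·,·) − Σ_{k=0}^N R_k(t,·) Φ_k‖_{L²(ℝ²)} ≤ K_p e^{C_{2p}[V]t} (2N+3)^{−p} 𝒩_{2p}(0) + √(C_p max(1,|V'(0)|,‖V''‖_∞)) (2N+3)^{−(p−1/2)} ((e^{C_{2p+1}[V]t} − 1)/C_{2p+1}[V]) 𝒩_{2p+1}(0), where 𝒩_m is applied to 𝒮 and C_m[V] = m² + 2m + m‖V''‖_∞ + m|V'(0)| + 2^m (1+m) m max_{2 ≤ n ≤ m+1} ‖V⁽ⁿ⁾‖_∞. -/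

import Mathlib

open MeasureTheory

noncomputable section

/-- Mixed partial derivative `∂_x^b ∂_y^β` of a function `f(x,y)`. -/
def pd2 (b β : ℕ) (f : ℝ → ℝ → ℂ) (x y : ℝ) : ℂ :=
  iteratedDeriv b (fun x' => iteratedDeriv β (fun y' => f x' y') y) x

/-- Weighted derivative `x^a ∂_x^b y^α ∂_y^β` of `f(x,y)`. -/
def wD (a b α β : ℕ) (f : ℝ → ℝ → ℂ) (x y : ℝ) : ℂ :=
  (x : ℂ) ^ a * (y : ℂ) ^ α * pd2 b β f x y

/-- Uncurried version of a two-variable function. -/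
def unc (f : ℝ → ℝ → ℂ) : ℝ × ℝ → ℂ := fun p => f p.1 p.2

/-- L² norm over ℝ². -/
def L2 (f : ℝ → ℝ → ℂ) : ℝ := (eLpNorm (unc f) 2 (volume : Measure (ℝ × ℝ))).toReal

/-- L² norm over ℝ. -/
def L2one (f : ℝ → ℂ) : ℝ := (eLpNorm f 2 (volume : Measure ℝ)).toReal

/-- Schwartz-class predicate for smooth functions of two real variables. -/
def IsSchwartz2 (f : ℝ → ℝ → ℂ) : Prop :=
  ContDiff ℝ (⊤ : ℕ∞) (unc f) ∧
    ∀ k n : ℕ, ∃ C : ℝ, ∀ p : ℝ × ℝ, ‖p‖ ^ k * ‖iteratedFDeriv ℝ n (unc f) p‖ ≤ C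

/-- Schwartz-class predicate for smooth functions of one real variable. -/
def IsSchwartz1 (f : ℝ → ℂ) : Prop :=
  ContDiff ℝ (⊤ : ℕ∞) f ∧ ∀ k n : ℕ, ∃ C : ℝ, ∀ x : ℝ, |x| ^ k * ‖iteratedDeriv n f x‖ ≤ C

/-- Time derivative of a time-dependent two-variable function. -/
def dtR (R : ℝ → ℝ → ℝ → ℂ) (t x y : ℝ) : ℂ := deriv (fun s => R s x y) t

/-- For all `a b α β`, the map `t ↦ x^a ∂_x^b y^α ∂_y^β R(t,·,·)` is continuously
differentiable from `[0,∞)` into `L²(ℝ²)` with derivative `x^a ∂_x^b y^α ∂_y^β ∂_t R(t,·,·)`. -/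
def C1intoL2 (R : ℝ → ℝ → ℝ → ℂ) : Prop :=
  ∀ a b α β : ℕ, ∃ Ψ Ψ' : ℝ → Lp ℂ 2 (volume : Measure (ℝ × ℝ)),
    (∀ t : ℝ, 0 ≤ t → (Ψ t : ℝ × ℝ → ℂ) =ᵐ[volume] unc (wD a b α β (R t))) ∧
    (∀ t : ℝ, 0 ≤ t → (Ψ' t : ℝ × ℝ → ℂ) =ᵐ[volume] unc (wD a b α β (dtR R t))) ∧
    (∀ t : ℝ, 0 ≤ t → HasDerivWithinAt Ψ (Ψ' t) (Set.Ici 0) t) ∧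
    ContinuousOn Ψ' (Set.Ici 0)

/-- Regularity part of the notion of strong solution on `[0,∞) × ℝ²`. -/
def IsRegularSol (R : ℝ → ℝ → ℝ → ℂ) : Prop :=
  ContDiffOn ℝ (⊤ : ℕ∞) (fun p : ℝ × ℝ × ℝ => R p.1 p.2.1 p.2.2) {p : ℝ × ℝ × ℝ | 0 ≤ p.1} ∧
  (∀ t : ℝ, 0 ≤ t → IsSchwartz2 (R t)) ∧ C1intoL2 R

/-- Strong solution of the von Neumann equation in Weyl variables. -/
def IsVNSol (hbar : ℝ) (V : ℝ → ℝ) (R : ℝ → ℝ → ℝ → ℂ) : Prop :=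
  IsRegularSol R ∧
  ∀ t : ℝ, 0 ≤ t → ∀ x y : ℝ,
    dtR R t x y = Complex.I * pd2 1 1 (R t) x y -
      Complex.I * (((V (x + hbar * y / 2) - V (x - hbar * y / 2)) / hbar : ℝ) : ℂ) * R t x y

/-- Strong solution of the semiclassical equation. -/
def IsSCSol (V : ℝ → ℝ) (R : ℝ → ℝ → ℝ → ℂ) : Prop :=
  IsRegularSol R ∧
  ∀ t : ℝ, 0 ≤ t → ∀ x y : ℝ,
    dtR R t x y = Complex.I * pd2 1 1 (R t) x y -
      Complex.I * ((deriv V x * y : ℝ) : ℂ) * R t x y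

/-- The weighted Sobolev functional `𝒩_m` applied to a function of `(x,y)`. -/
def NN (m : ℕ) (f : ℝ → ℝ → ℂ) : ℝ :=
  ∑ q ∈ Finset.filter
      (fun q : ℕ × ℕ × ℕ × ℕ => q.1 + q.2.1 + q.2.2.1 + q.2.2.2 ≤ m)
      (Finset.range (m+1) ×ˢ Finset.range (m+1) ×ˢ Finset.range (m+1) ×ˢ Finset.range (m+1)),
    L2 (wD q.1 q.2.1 q.2.2.1 q.2.2.2 f)

/-- Supremum norm of a real-valued function. -/
def supN (f : ℝ → ℝ) : ℝ := ⨆ x : ℝ, |f x|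

/-- The constant `C_m[V]`. -/
def CmV (m : ℕ) (V : ℝ → ℝ) : ℝ :=
  ((m : ℝ)^2 + 2*m + m * supN (iteratedDeriv 2 V) + m * |deriv V 0|) +
    2^m * (1+m) * m * (⨆ n ∈ Finset.Icc 2 (m+1), supN (iteratedDeriv n V))

/-- Physicists' Hermite polynomial. -/
def Hpoly (k : ℕ) (y : ℝ) : ℝ :=
  (-1)^k * Real.exp (y^2) * iteratedDeriv k (fun z => Real.exp (-z^2)) y

/-- Hermite function `Φ_k`. -/
def Φh (k : ℕ) (y : ℝ) : ℝ :=
  ((2:ℝ)^k * (Nat.factorial k : ℝ) * Real.sqrt Real.pi) ^ (-(1:ℝ)/2) *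
    Real.exp (-y^2/2) * Hpoly k y

/-- The operator `𝒟 u = ∂_x u + V'(x) u`. -/
def Dop (V : ℝ → ℝ) (u : ℝ → ℂ) (x : ℝ) : ℂ := deriv u x + ((deriv V x : ℝ) : ℂ) * u x

/-- The operator `𝒟* u = −∂_x u + V'(x) u`. -/
def Dstar (V : ℝ → ℝ) (u : ℝ → ℂ) (x : ℝ) : ℂ := -deriv u x + ((deriv V x : ℝ) : ℂ) * u x

/-- The quantum correction `ℰ^ħ(x,y)`. -/
def Eh (hbar : ℝ) (V : ℝ → ℝ) (x y : ℝ) : ℝ :=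
  (V (x + hbar * y / 2) - V (x - hbar * y / 2)) / hbar - deriv V x * y

/-- Matrix elements `ℰ^ħ_{k,l}(x)` of the quantum correction. -/
def Ekl (hbar : ℝ) (V : ℝ → ℝ) (k l : ℕ) (x : ℝ) : ℝ :=
  ∫ y : ℝ, Eh hbar V x y * Φh k y * Φh l y

/-- `t ↦ u(t,·)` is continuously differentiable from `[0,∞)` into `L²(ℝ)` with
derivative `∂_t u`. -/
def C1intoL2one (u : ℝ → ℝ → ℂ) : Prop :=
  ∃ Ψ Ψ' : ℝ → Lp ℂ 2 (volume : Measure ℝ),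
    (∀ t : ℝ, 0 ≤ t → (Ψ t : ℝ → ℂ) =ᵐ[volume] u t) ∧
    (∀ t : ℝ, 0 ≤ t → (Ψ' t : ℝ → ℂ) =ᵐ[volume] fun x => deriv (fun s => u s x) t) ∧
    (∀ t : ℝ, 0 ≤ t → HasDerivWithinAt Ψ (Ψ' t) (Set.Ici 0) t) ∧
    ContinuousOn Ψ' (Set.Ici 0)

/-- Regularity part of the notion of strong solution of a Hermite–Galerkin system of size `N`;
the convention `R_k = 0` for `k > N` is included. -/
def IsGalerkinReg (N : ℕ) (R : ℕ → ℝ → ℝ → ℂ) : Prop :=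
  (∀ k, k ≤ N → ContDiffOn ℝ (⊤ : ℕ∞) (fun p : ℝ × ℝ => R k p.1 p.2) {p : ℝ × ℝ | 0 ≤ p.1}) ∧
  (∀ k, k ≤ N → ∀ t : ℝ, 0 ≤ t → IsSchwartz1 (R k t)) ∧
  (∀ k, k ≤ N → C1intoL2one (R k)) ∧
  (∀ k, N < k → ∀ t x : ℝ, R k t x = 0)

/-- Strong solution of the semiclassical Hermite–Galerkin system of size `N`.
(For `k = 0` the coefficient `√(k/2)` vanishes, so the term `R_{k-1}` is harmless.) -/
def IsSCGalerkinSol (V : ℝ → ℝ) (N : ℕ) (R : ℕ → ℝ → ℝ → ℂ) : Prop :=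
  IsGalerkinReg N R ∧
  ∀ k, k ≤ N → ∀ t : ℝ, 0 ≤ t → ∀ x : ℝ,
    deriv (fun s => R k s x) t +
      Complex.I * ((Real.sqrt ((k : ℝ)/2) : ℂ) * Dop V (R (k-1) t) x +
        (Real.sqrt (((k : ℝ)+1)/2) : ℂ) * Dstar V (R (k+1) t) x) = 0

/-- Strong solution of the von Neumann Hermite–Galerkin system of size `N`. -/
def IsVNGalerkinSol (hbar : ℝ) (V : ℝ → ℝ) (N : ℕ) (R : ℕ → ℝ → ℝ → ℂ) : Prop :=
  IsGalerkinReg N R ∧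
  ∀ k, k ≤ N → ∀ t : ℝ, 0 ≤ t → ∀ x : ℝ,
    deriv (fun s => R k s x) t +
      Complex.I * ((Real.sqrt ((k : ℝ)/2) : ℂ) * Dop V (R (k-1) t) x +
        (Real.sqrt (((k : ℝ)+1)/2) : ℂ) * Dstar V (R (k+1) t) x) =
      -Complex.I * ∑ l ∈ Finset.range (N+1), ((Ekl hbar V k l x : ℝ) : ℂ) * R l t x

/-- Smooth potential with all derivatives of order `≥ 2` bounded. -/
def SmoothBounded (V : ℝ → ℝ) : Prop :=
  ContDiff ℝ (⊤ : ℕ∞) V ∧ ∀ n : ℕ, 2 ≤ n → ∃ C : ℝ, ∀ x : ℝ, |iteratedDeriv n V x| ≤ C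

/-- The harmonic-oscillator operator `A G = y² G − G''`. -/
def Aop (g : ℝ → ℂ) : ℝ → ℂ := fun y => (y : ℂ)^2 * g y - iteratedDeriv 2 g y

/-- The polynomial factor of the `k`-th derivative of `exp (-z ^ 2)`. -/
def gaussPoly : ℕ → Polynomial ℝ
  | 0 => 1
  | k + 1 => Polynomial.derivative (gaussPoly k) - 2 * Polynomial.X * gaussPoly k

lemma iteratedDeriv_exp_neg_sq (k : ℕ) :
    iteratedDeriv k (fun z : ℝ => Real.exp (-z ^ 2)) =
      fun y => (gaussPoly k).eval y * Real.exp (-y ^ 2) := by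
  induction k with
  | zero => ext y; simp [gaussPoly]
  | succ k ih =>
    rw [iteratedDeriv_succ, ih]
    ext y
    have h1 : HasDerivAt (fun y : ℝ => Real.exp (-y ^ 2)) (Real.exp (-y ^ 2) * (-(2 * y))) y := by
      have := ((hasDerivAt_pow 2 y).fun_neg).exp
      simpa using this
    rw [(((gaussPoly k).hasDerivAt y).fun_mul h1).deriv]
    simp [gaussPoly]
    ring

lemma derivative_gaussPoly_succ (k : ℕ) :
    Polynomial.derivative (gaussPoly (k + 1)) =
      -(2 * ((k : Polynomial ℝ) + 1)) * gaussPoly k := by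
  induction k with
  | zero => simp [gaussPoly]
  | succ k ih =>
    have h : gaussPoly (k + 1 + 1) = Polynomial.derivative (gaussPoly (k + 1))
      - 2 * Polynomial.X * gaussPoly (k + 1) := rfl
    rw [h, Polynomial.derivative_sub, ih]
    simp only [Polynomial.derivative_mul, ih, Polynomial.derivative_X, Polynomial.derivative_neg,
      Polynomial.derivative_ofNat, Polynomial.derivative_add, Polynomial.derivative_natCast,
      Polynomial.derivative_one]
    have h2 : gaussPoly (k + 1) = Polynomial.derivative (gaussPoly k)
      - 2 * Polynomial.X * gaussPoly k := rfl
    push_cast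
    linear_combination (-2 * ((k : Polynomial ℝ) + 1)) * (-1 : Polynomial ℝ) * h2

/-- The normalisation constant of the `k`-th Hermite function. -/
def hermiteNorm (k : ℕ) : ℝ := ((2:ℝ)^k * (Nat.factorial k : ℝ) * Real.sqrt Real.pi) ^ (-(1:ℝ)/2)

lemma hermiteNorm_eq_mul_succ (k : ℕ) :
    hermiteNorm k = Real.sqrt (2 * ((k : ℝ) + 1)) * hermiteNorm (k + 1) := by
  have h : (2:ℝ)^(k+1) * (Nat.factorial (k+1) : ℝ) * Real.sqrt Real.pi =
      (2 * ((k : ℝ) + 1)) * ((2:ℝ)^k * (Nat.factorial k : ℝ) * Real.sqrt Real.pi) := by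
    rw [Nat.factorial_succ]; push_cast; ring
  have h2 : (2 * ((k : ℝ) + 1)) ^ (-(1:ℝ)/2) = (Real.sqrt (2 * ((k : ℝ) + 1)))⁻¹ := by
    rw [Real.sqrt_eq_rpow, ← Real.rpow_neg (by positivity)]
    norm_num
  rw [hermiteNorm, hermiteNorm, h, Real.mul_rpow (x := 2 * ((k : ℝ) + 1)) (by positivity)
    (by positivity), h2,
    mul_inv_cancel_left₀ (by positivity)]

lemma Φh_eq (k : ℕ) (y : ℝ) :
    Φh k y = hermiteNorm k * (-1) ^ k * (gaussPoly k).eval y * Real.exp (-y ^ 2 / 2) := by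
  have h : Real.exp (-y^2/2) * (Real.exp (y^2) * Real.exp (-y^2)) = Real.exp (-y^2/2) := by
    rw [← Real.exp_add (y ^ 2)]; simp
  rw [Φh, Hpoly, iteratedDeriv_exp_neg_sq, hermiteNorm]
  linear_combination ((2:ℝ)^k * (Nat.factorial k : ℝ) * Real.sqrt Real.pi) ^ (-(1:ℝ)/2) *
    (-1) ^ k * (gaussPoly k).eval y * h

lemma hasDerivAt_Φh (k : ℕ) (y : ℝ) :
    HasDerivAt (Φh k) (y * Φh k y - Real.sqrt (2 * ((k : ℝ) + 1)) * Φh (k + 1) y) y := by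
  have h1 : HasDerivAt (fun y : ℝ => Real.exp (-y ^ 2 / 2)) (Real.exp (-y ^ 2 / 2) * (-y)) y := by
    have := (((hasDerivAt_pow 2 y).fun_neg).div_const 2).exp
    exact this.congr_deriv (by push_cast; ring)
  have h2 := (((gaussPoly k).hasDerivAt y).fun_mul h1).const_mul (hermiteNorm k * (-1) ^ k)
  have h3 : Φh k = fun y => hermiteNorm k * (-1) ^ k *
      ((gaussPoly k).eval y * Real.exp (-y ^ 2 / 2)) := by
    ext y; rw [Φh_eq]; ring
  rw [h3]
  refine h2.congr_deriv ?_
  rw [Φh_eq, hermiteNorm_eq_mul_succ k]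
  simp only [gaussPoly, Polynomial.eval_sub, Polynomial.eval_mul, Polynomial.eval_X,
    Polynomial.eval_ofNat]
  ring

lemma deriv_Φh_succ (k : ℕ) (y : ℝ) :
    deriv (Φh (k + 1)) y = -(y * Φh (k + 1) y) + Real.sqrt (2 * ((k : ℝ) + 1)) * Φh k y := by
  rw [(hasDerivAt_Φh (k + 1) y).deriv]
  have h : gaussPoly (k + 1 + 1) = Polynomial.derivative (gaussPoly (k + 1))
      - 2 * Polynomial.X * gaussPoly (k + 1) := rfl
  have h1 := hermiteNorm_eq_mul_succ (k + 1)
  have h2 := hermiteNorm_eq_mul_succ k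
  have h3 : Real.sqrt (2 * ((k : ℝ) + 1)) * Real.sqrt (2 * ((k : ℝ) + 1)) = 2 * ((k : ℝ) + 1) :=
    Real.mul_self_sqrt (by positivity)
  rw [Φh_eq (k + 1 + 1), Φh_eq (k + 1), Φh_eq k, h, derivative_gaussPoly_succ]
  simp only [Polynomial.eval_sub, Polynomial.eval_mul, Polynomial.eval_X,
    Polynomial.eval_ofNat, Polynomial.eval_neg, Polynomial.eval_add, Polynomial.eval_natCast,
    Polynomial.eval_one]
  rw [h2]
  rw [h1]
  linear_combination (- (√(2 * ((k + 1 : ℕ) + 1)) * hermiteNorm (k + 1 + 1)) *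
    (-1) ^ k * (gaussPoly k).eval y * Real.exp (-y ^ 2 / 2)) * h3

lemma deriv_Φh_zero (y : ℝ) : deriv (Φh 0) y = -(y * Φh 0 y) := by
  rw [(hasDerivAt_Φh 0 y).deriv, Φh_eq 0, Φh_eq 1, hermiteNorm_eq_mul_succ 0]
  simp [gaussPoly]
  ring

lemma differentiable_Φh (k : ℕ) : Differentiable ℝ (Φh k) :=
  fun y => (hasDerivAt_Φh k y).differentiableAt

lemma continuous_Φh (k : ℕ) : Continuous (Φh k) := (differentiable_Φh k).continuous

lemma mul_Φh_succ (k : ℕ) (y : ℝ) :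
    2 * (y * Φh (k + 1) y) = Real.sqrt (2 * ((k : ℝ) + 1)) * Φh k y +
      Real.sqrt (2 * ((k : ℝ) + 2)) * Φh (k + 2) y := by
  have h1 := deriv_Φh_succ k y
  rw [(hasDerivAt_Φh (k + 1) y).deriv] at h1
  push_cast at h1
  rw [show (k : ℝ) + 1 + 1 = k + 2 by ring] at h1
  linarith

lemma mul_Φh_zero (y : ℝ) : 2 * (y * Φh 0 y) = Real.sqrt 2 * Φh 1 y := by
  have h1 := deriv_Φh_zero y
  rw [(hasDerivAt_Φh 0 y).deriv] at h1
  simp at h1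
  linarith

lemma Polynomial.abs_eval_le_exp_abs (P : Polynomial ℝ) :
    ∃ C : ℝ, 0 ≤ C ∧ ∀ y : ℝ, |P.eval y| ≤ C * Real.exp |y| := by
  induction P using Polynomial.induction_on' with
  | add p q hp hq =>
    obtain ⟨C, hC, h⟩ := hp
    obtain ⟨D, hD, h'⟩ := hq
    refine ⟨C + D, by positivity, fun y => ?_⟩
    rw [Polynomial.eval_add, add_mul]
    exact (abs_add_le _ _).trans (add_le_add (h y) (h' y))
  | monomial n a =>
    refine ⟨|a| * n.factorial, by positivity, fun y => ?_⟩
    rw [Polynomial.eval_monomial, abs_mul, abs_pow, mul_assoc]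
    have := Real.pow_div_factorial_le_exp |y| (abs_nonneg y) n
    rw [div_le_iff₀ (by positivity)] at this
    gcongr
    linarith

lemma exp_abs_mul_gaussian_le (R : ℝ) (y : ℝ) :
    Real.exp (R * |y|) * Real.exp (-y ^ 2 / 2) ≤ Real.exp (R ^ 2) * Real.exp (-(1/4) * y ^ 2) := by
  rw [← Real.exp_add, ← Real.exp_add, Real.exp_le_exp]
  nlinarith [sq_nonneg (|y| / 2 - R), sq_abs y]

lemma abs_Φh_le (k : ℕ) :
    ∃ C : ℝ, 0 ≤ C ∧ ∀ y : ℝ, |Φh k y| ≤ C * Real.exp (-(1/4) * y ^ 2) := by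
  obtain ⟨C, hC, h⟩ := Polynomial.abs_eval_le_exp_abs (gaussPoly k)
  refine ⟨|hermiteNorm k| * C * Real.exp (1 ^ 2), by positivity, fun y => ?_⟩
  rw [Φh_eq, abs_mul, abs_mul, abs_mul, abs_pow, abs_neg, abs_one, one_pow, mul_one, Real.abs_exp]
  have h2 := exp_abs_mul_gaussian_le 1 y
  rw [one_mul] at h2
  calc |hermiteNorm k| * |(gaussPoly k).eval y| * Real.exp (-y ^ 2 / 2)
      ≤ |hermiteNorm k| * (C * Real.exp |y|) * Real.exp (-y ^ 2 / 2) := by gcongr; exact h y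
    _ = |hermiteNorm k| * C * (Real.exp |y| * Real.exp (-y ^ 2 / 2)) := by ring
    _ ≤ |hermiteNorm k| * C * (Real.exp (1 ^ 2) * Real.exp (-(1/4) * y ^ 2)) := by gcongr
    _ = _ := by ring

lemma Φh_bounded (k : ℕ) : ∃ C : ℝ, 0 ≤ C ∧ ∀ y : ℝ, |Φh k y| ≤ C := by
  obtain ⟨C, hC, h⟩ := abs_Φh_le k
  refine ⟨C, hC, fun y => (h y).trans ?_⟩
  have : Real.exp (-(1/4) * y ^ 2) ≤ 1 := Real.exp_le_one_iff.mpr (by nlinarith [sq_nonneg y])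
  nlinarith

lemma memLp_gaussian : MemLp (fun y : ℝ => Real.exp (-(1/4) * y ^ 2)) 2 volume := by
  rw [memLp_two_iff_integrable_sq (by fun_prop)]
  have := integrable_exp_neg_mul_sq (b := 1/2) (by norm_num)
  refine this.congr (Filter.Eventually.of_forall fun y => ?_)
  simp only
  rw [← Real.exp_nat_mul]
  congr 1
  push_cast; ring

lemma memLp_Φh (k : ℕ) : MemLp (Φh k) 2 volume := by
  obtain ⟨C, hC, h⟩ := abs_Φh_le k
  refine (memLp_gaussian.const_mul C).mono (continuous_Φh k).aestronglyMeasurable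
    (Filter.Eventually.of_forall fun y => ?_)
  rw [Real.norm_eq_abs, Real.norm_eq_abs]
  exact (h y).trans (le_abs_self _)

lemma memLp_mul_Φh (k : ℕ) : MemLp (fun y => y * Φh k y) 2 volume := by
  cases k with
  | zero =>
    refine ((memLp_Φh 1).const_mul (Real.sqrt 2 / 2)).congr_norm (by
      exact (continuous_id.mul (continuous_Φh 0)).aestronglyMeasurable) ?_
    refine Filter.Eventually.of_forall fun y => ?_
    congr 1
    linarith [mul_Φh_zero y]
  | succ k =>
    refine (((memLp_Φh k).const_mul (Real.sqrt (2 * ((k : ℝ) + 1)) / 2)).add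
      ((memLp_Φh (k + 2)).const_mul (Real.sqrt (2 * ((k : ℝ) + 2)) / 2))).congr_norm (by
      exact (continuous_id.mul (continuous_Φh _)).aestronglyMeasurable) ?_
    refine Filter.Eventually.of_forall fun y => ?_
    simp only [Pi.add_apply]
    congr 1
    linarith [mul_Φh_succ k y]

lemma integrable_Φh_mul (k l : ℕ) : Integrable (fun y => Φh k y * Φh l y) volume :=
  (memLp_Φh k).integrable_mul (memLp_Φh l)

lemma integrable_Φh_mul_mul (k l : ℕ) : Integrable (fun y => Φh k y * (y * Φh l y)) volume :=
  (memLp_Φh k).integrable_mul (memLp_mul_Φh l)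

lemma integral_Φh_mul_deriv (k l : ℕ) :
    ∫ y, Φh k y * deriv (Φh l) y = - ∫ y, deriv (Φh k) y * Φh l y := by
  have hd : ∀ k l : ℕ, Integrable (fun y => Φh k y * deriv (Φh l) y) volume := by
    intro k l
    have := (integrable_Φh_mul_mul k l).sub ((integrable_Φh_mul k (l + 1)).const_mul
      (Real.sqrt (2 * ((l : ℝ) + 1))))
    refine this.congr (Filter.Eventually.of_forall fun y => ?_)
    simp only [Pi.sub_apply]
    rw [(hasDerivAt_Φh l y).deriv]; ring
  refine integral_mul_deriv_eq_deriv_mul_of_integrable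
    (fun y _ => (differentiable_Φh k y).hasDerivAt) (fun y _ => (differentiable_Φh l y).hasDerivAt)
    (hd k l) ?_ (integrable_Φh_mul k l)
  refine (hd l k).congr (Filter.Eventually.of_forall fun y => ?_)
  simp [mul_comm]

lemma integral_Φh_succ_mul (k l : ℕ) :
    Real.sqrt (2 * ((l : ℝ) + 1)) * ∫ y, Φh k y * Φh (l + 1) y =
      ∫ y, (y * Φh k y + deriv (Φh k) y) * Φh l y := by
  have h1 : ∫ y, deriv (Φh k) y * Φh l y = - ∫ y, Φh k y * deriv (Φh l) y := by
    rw [integral_Φh_mul_deriv, neg_neg]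
  have h2 : ∫ y, Φh k y * deriv (Φh l) y = (∫ y, Φh k y * (y * Φh l y)) -
      Real.sqrt (2 * ((l : ℝ) + 1)) * ∫ y, Φh k y * Φh (l + 1) y := by
    rw [← integral_const_mul, ← integral_sub (integrable_Φh_mul_mul k l)
      ((integrable_Φh_mul _ _).const_mul _)]
    refine integral_congr_ae (Filter.Eventually.of_forall fun y => ?_)
    simp only
    rw [(hasDerivAt_Φh l y).deriv]; ring
  have h3 : ∫ y, (y * Φh k y + deriv (Φh k) y) * Φh l y =
      (∫ y, Φh k y * (y * Φh l y)) + ∫ y, deriv (Φh k) y * Φh l y := by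
    rw [← integral_add (integrable_Φh_mul_mul k l)]
    · refine integral_congr_ae (Filter.Eventually.of_forall fun y => ?_)
      simp only; ring
    · have := (integrable_Φh_mul_mul l k).sub ((integrable_Φh_mul (k + 1) l).const_mul
        (Real.sqrt (2 * ((k : ℝ) + 1))))
      refine this.congr (Filter.Eventually.of_forall fun y => ?_)
      simp only [Pi.sub_apply]
      rw [(hasDerivAt_Φh k y).deriv]; ring
  rw [h3, h1, h2]; ring

lemma integral_Φh_zero_succ (l : ℕ) : ∫ y, Φh 0 y * Φh (l + 1) y = 0 := by
  have h := integral_Φh_succ_mul 0 l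
  simp only [deriv_Φh_zero] at h
  simp only [add_neg_cancel, zero_mul, integral_zero] at h
  have : Real.sqrt (2 * ((l : ℝ) + 1)) ≠ 0 := by positivity
  exact (mul_eq_zero.mp h).resolve_left this

lemma integral_Φh_zero_zero : ∫ y, Φh 0 y * Φh 0 y = 1 := by
  have h : ∀ y, Φh 0 y * Φh 0 y = (hermiteNorm 0) ^ 2 * Real.exp (-1 * y ^ 2) := by
    intro y
    rw [Φh_eq]
    have : Real.exp (-1 * y ^ 2) = Real.exp (-y ^ 2 / 2) * Real.exp (-y ^ 2 / 2) := by
      rw [← Real.exp_add]; congr 1; ring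
    rw [this]; simp [gaussPoly]; ring
  simp only [h]
  rw [integral_const_mul, integral_gaussian, hermiteNorm]
  simp only [pow_zero, Nat.factorial_zero, Nat.cast_one, mul_one, one_mul, div_one]
  rw [← Real.rpow_natCast, ← Real.rpow_mul (by positivity)]
  norm_num
  rw [Real.rpow_neg_one, inv_mul_cancel₀ (by positivity)]

lemma integral_Φh_mul (k l : ℕ) : ∫ y, Φh k y * Φh l y = if k = l then 1 else 0 := by
  induction k generalizing l with
  | zero =>
    cases l with
    | zero => simpa using integral_Φh_zero_zero
    | succ l => simpa using integral_Φh_zero_succ l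
  | succ k ih =>
    cases l with
    | zero =>
      simp only [mul_comm (Φh (k + 1) _)]
      simpa using integral_Φh_zero_succ k
    | succ l =>
      have h := integral_Φh_succ_mul (k + 1) l
      simp only [deriv_Φh_succ, add_neg_cancel_left, mul_assoc] at h
      rw [integral_const_mul, ih] at h
      have h0 : Real.sqrt (2 * ((l : ℝ) + 1)) ≠ 0 := by positivity
      by_cases hkl : k = l
      · subst hkl
        simp only [if_true, mul_one] at h ⊢
        exact mul_left_cancel₀ h0 (by simpa using h)
      · simp only [hkl, if_false, mul_zero] at h
        simpa [hkl] using (mul_eq_zero.mp h).resolve_left h0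

lemma pow_succ_mul_Φh (n k : ℕ) :
    ∃ c d : ℝ, ∀ y : ℝ, y ^ (n + 1) * Φh k y =
      c * (y ^ n * Φh (k - 1) y) + d * (y ^ n * Φh (k + 1) y) := by
  cases k with
  | zero =>
    refine ⟨0, Real.sqrt 2 / 2, fun y => ?_⟩
    have := mul_Φh_zero y
    rw [pow_succ]
    simp only [zero_add]
    linear_combination y ^ n / 2 * this
  | succ k =>
    refine ⟨Real.sqrt (2 * ((k:ℝ) + 1)) / 2, Real.sqrt (2 * ((k:ℝ) + 2)) / 2, fun y => ?_⟩
    have := mul_Φh_succ k y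
    rw [pow_succ]
    simp only [Nat.add_sub_cancel]
    linear_combination y ^ n / 2 * this

lemma memLp_pow_mul_Φh (n k : ℕ) : MemLp (fun y : ℝ => y ^ n * Φh k y) 2 volume := by
  induction n generalizing k with
  | zero => simpa using memLp_Φh k
  | succ n ih =>
    obtain ⟨c, d, h⟩ := pow_succ_mul_Φh n k
    simp_rw [h]
    exact ((ih _).const_mul c).add ((ih _).const_mul d)

lemma memLp_ofReal_pow_mul_Φh (n k : ℕ) :
    MemLp (fun y : ℝ => ((y ^ n * Φh k y : ℝ) : ℂ)) 2 volume :=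
  (memLp_pow_mul_Φh n k).ofReal

lemma memLp_ofReal_Φh (k : ℕ) : MemLp (fun y : ℝ => ((Φh k y : ℝ) : ℂ)) 2 volume :=
  (memLp_Φh k).ofReal

lemma MeasureTheory.MemLp.integrable_mul_two {α : Type*} [MeasurableSpace α] {μ : Measure α}
    {f g : α → ℂ} (hf : MemLp f 2 μ) (hg : MemLp g 2 μ) : Integrable (fun a => f a * g a) μ :=
  hf.integrable_mul hg

lemma integral_mul_pow_Φh_eq_zero {h : ℝ → ℂ} (hh : MemLp h 2 volume)
    (h0 : ∀ k, ∫ y, h y * ((Φh k y : ℝ) : ℂ) = 0) (n k : ℕ) :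
    ∫ y, h y * ((y ^ n * Φh k y : ℝ) : ℂ) = 0 := by
  induction n generalizing k with
  | zero => simpa using h0 k
  | succ n ih =>
    obtain ⟨c, d, he⟩ := pow_succ_mul_Φh n k
    have h1 : ∀ y, h y * ((y ^ (n+1) * Φh k y : ℝ) : ℂ) =
        (c:ℂ) * (h y * ((y ^ n * Φh (k-1) y : ℝ) : ℂ)) +
          (d:ℂ) * (h y * ((y ^ n * Φh (k+1) y : ℝ) : ℂ)) := by
      intro y; rw [he]; push_cast; ring
    simp_rw [h1]
    rw [integral_add
      ((hh.integrable_mul_two (memLp_ofReal_pow_mul_Φh n (k-1))).const_mul _)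
      ((hh.integrable_mul_two (memLp_ofReal_pow_mul_Φh n (k+1))).const_mul _),
      integral_const_mul, integral_const_mul, ih, ih]
    simp

lemma memLp_exp_abs_mul_Φh (R : ℝ) :
    MemLp (fun y : ℝ => Real.exp (R * |y|) * Φh 0 y) 2 volume := by
  have hm : AEStronglyMeasurable (fun y : ℝ => Real.exp (R * |y|) * Φh 0 y) volume :=
    (Continuous.mul (by fun_prop) (continuous_Φh 0)).aestronglyMeasurable
  have hΦ : ∀ y, Φh 0 y = hermiteNorm 0 * Real.exp (-y^2/2) := by
    intro y; rw [Φh_eq]; simp [gaussPoly]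
  refine MemLp.of_le (memLp_gaussian.const_mul (|hermiteNorm 0| * Real.exp (R^2))) hm
    (Filter.Eventually.of_forall fun y => ?_)
  rw [hΦ]
  have := exp_abs_mul_gaussian_le R y
  simp only [norm_mul, Real.norm_eq_abs, abs_abs, Real.abs_exp]
  calc _ = |hermiteNorm 0| * (Real.exp (R * |y|) * Real.exp (-y^2/2)) := by ring
    _ ≤ |hermiteNorm 0| * (Real.exp (R^2) * Real.exp (-(1/4) * y^2)) := by gcongr
    _ = _ := by ring

lemma fourier_mul_Φh_zero {h : ℝ → ℂ} (hh : MemLp h 2 volume)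
    (h0 : ∀ k, ∫ y, h y * ((Φh k y : ℝ) : ℂ) = 0) (w : ℝ) :
    FourierTransform.fourier (fun y => h y * ((Φh 0 y : ℝ) : ℂ)) w = 0 := by
  rw [Real.fourier_real_eq_integral_exp_smul]
  set z : ℝ → ℂ := fun v => (↑(-2 * Real.pi * v * w) * Complex.I) with hz
  have key := hasSum_integral_of_dominated_convergence (μ := (volume : Measure ℝ))
    (F := fun (n : ℕ) v => (z v ^ n / (n.factorial : ℂ)) * (h v * ((Φh 0 v : ℝ) : ℂ)))
    (f := fun v => Complex.exp (z v) • (h v * ((Φh 0 v : ℝ) : ℂ)))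
    (fun n v => ‖z v‖ ^ n / (n.factorial : ℝ) * ‖h v * ((Φh 0 v : ℝ) : ℂ)‖)
    (fun n => ?_) (fun n => ?_) ?_ ?_ ?_
  · rw [← key.tsum_eq]
    convert tsum_zero with n
    have : ∀ v, (z v ^ n / (n.factorial : ℂ)) * (h v * ((Φh 0 v : ℝ) : ℂ)) =
        ((-2 * Real.pi * w * Complex.I) ^ n / (n.factorial : ℂ)) *
          (h v * ((v ^ n * Φh 0 v : ℝ) : ℂ)) := by
      intro v; simp only [hz]; push_cast; ring
    simp_rw [this]
    rw [integral_const_mul, integral_mul_pow_Φh_eq_zero hh h0, mul_zero]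
  · refine AEStronglyMeasurable.mul (Continuous.aestronglyMeasurable (by fun_prop)) ?_
    exact (hh.integrable_mul_two (memLp_ofReal_Φh 0)).aestronglyMeasurable
  · exact Filter.Eventually.of_forall fun v => by simp
  · exact Filter.Eventually.of_forall fun v =>
      (Real.summable_pow_div_factorial _).mul_right _
  · have : ∀ v, ∑' n : ℕ, ‖z v‖ ^ n / (n.factorial : ℝ) * ‖h v * ((Φh 0 v : ℝ) : ℂ)‖ =
        ‖h v * ((Real.exp ((2 * Real.pi * |w|) * |v|) * Φh 0 v : ℝ) : ℂ)‖ := by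
      intro v
      rw [tsum_mul_right]
      have : ∑' n : ℕ, ‖z v‖ ^ n / (n.factorial : ℝ) = Real.exp ‖z v‖ := by
        rw [Real.exp_eq_exp_ℝ, NormedSpace.exp_eq_tsum_div]
      rw [this]
      have hzn : ‖z v‖ = 2 * Real.pi * |w| * |v| := by
        simp [hz, abs_of_pos Real.pi_pos]; ring
      rw [hzn]
      simp only [norm_mul, Complex.norm_real, Real.norm_eq_abs, Real.abs_exp]
      ring
    simp_rw [this]
    exact (hh.integrable_mul_two (memLp_exp_abs_mul_Φh _).ofReal).norm
  · refine Filter.Eventually.of_forall fun v => ?_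
    have : HasSum (fun n : ℕ => z v ^ n / (n.factorial : ℂ)) (Complex.exp (z v)) := by
      rw [Complex.exp_eq_exp_ℂ]; exact NormedSpace.expSeries_div_hasSum_exp (z v)
    exact this.mul_right _

open scoped SchwartzMap FourierTransform in
lemma ae_eq_zero_of_fourier_eq_zero {g : ℝ → ℂ} (hg : Integrable g volume)
    (h0 : ∀ w, FourierTransform.fourier g w = 0) : ∀ᵐ x ∂(volume : Measure ℝ), g x = 0 := by
  refine ae_eq_zero_of_integral_contDiff_smul_eq_zero hg.locallyIntegrable ?_
  intro φ hφ hc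
  have hg₁ : HasCompactSupport (Complex.ofRealCLM ∘ φ) := hc.comp_left rfl
  have hg₂ : ContDiff ℝ (⊤ : ℕ∞) (Complex.ofRealCLM ∘ φ) := Complex.ofRealCLM.contDiff.comp hφ
  set ψ : 𝓢(ℝ, ℂ) := hg₁.toSchwartzMap hg₂ with hψ
  have h1 : ∀ x, φ x • g x = (𝓕 (𝓕⁻ ψ) : 𝓢(ℝ,ℂ)) x • g x := by
    intro x
    rw [FourierTransform.fourier_fourierInv_eq]
    simp [hψ]
  simp_rw [h1]
  have h2 := VectorFourier.integral_fourierIntegral_smul_eq_flip (L := innerₗ ℝ)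
    (μ := volume) (ν := volume) Real.continuous_fourierChar continuous_inner
    (𝓕⁻ ψ : 𝓢(ℝ,ℂ)).integrable hg
  have h3 : ∀ x, VectorFourier.fourierIntegral Real.fourierChar volume (innerₗ ℝ).flip g x = 0 := by
    intro x
    have := h0 x
    rw [Real.fourier_eq] at this
    rw [← this]
    simp [VectorFourier.fourierIntegral]
  simp only [h3, smul_zero, integral_zero] at h2
  exact h2

lemma ae_eq_zero_of_integral_mul_Φh {h : ℝ → ℂ} (hh : MemLp h 2 volume)
    (h0 : ∀ k, ∫ y, h y * ((Φh k y : ℝ) : ℂ) = 0) : h =ᵐ[volume] 0 := by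
  have := ae_eq_zero_of_fourier_eq_zero (hh.integrable_mul_two (memLp_ofReal_Φh 0))
    (fourier_mul_Φh_zero hh h0)
  filter_upwards [this] with y hy
  have hΦ : Φh 0 y ≠ 0 := by
    have : hermiteNorm 0 ≠ 0 := by unfold hermiteNorm; positivity
    rw [Φh_eq]; simp [gaussPoly, this]
  have hΦ' : ((Φh 0 y : ℝ) : ℂ) ≠ 0 := by exact_mod_cast hΦ
  simpa [hΦ'] using hy

/-- Hermite functions as elements of `L²(ℝ;ℂ)`. -/
def hermiteL2 (k : ℕ) : Lp ℂ 2 (volume : Measure ℝ) := (memLp_ofReal_Φh k).toLp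

lemma inner_hermiteL2_toLp (k : ℕ) {h : ℝ → ℂ} (hh : MemLp h 2 volume) :
    inner ℂ (hermiteL2 k) (hh.toLp) = ∫ y, h y * ((Φh k y : ℝ) : ℂ) := by
  rw [L2.inner_def]
  refine integral_congr_ae ?_
  filter_upwards [(memLp_ofReal_Φh k).coeFn_toLp, hh.coeFn_toLp] with y h1 h2
  rw [hermiteL2, h1, h2]
  simp

lemma orthonormal_hermiteL2 : Orthonormal ℂ hermiteL2 := by
  rw [orthonormal_iff_ite]
  intro k l
  conv_lhs => rw [hermiteL2.eq_def l]
  rw [inner_hermiteL2_toLp]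
  have : ∀ y, ((Φh l y : ℝ) : ℂ) * ((Φh k y : ℝ) : ℂ) = ((Φh k y * Φh l y : ℝ) : ℂ) := by
    intro y; push_cast; ring
  simp_rw [this]
  rw [integral_complex_ofReal, integral_Φh_mul]
  split_ifs <;> simp

/-- The Hilbert basis of `L²(ℝ;ℂ)` formed by the Hermite functions. -/
def hermiteBasis : HilbertBasis ℕ ℂ (Lp ℂ 2 (volume : Measure ℝ)) :=
  HilbertBasis.mkOfOrthogonalEqBot orthonormal_hermiteL2 <| by
    rw [Submodule.eq_bot_iff]
    intro h hh
    rw [Submodule.mem_orthogonal] at hh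
    have h1 : h = (Lp.memLp h).toLp := (Lp.toLp_coeFn h _).symm
    rw [Lp.eq_zero_iff_ae_eq_zero]
    refine ae_eq_zero_of_integral_mul_Φh (Lp.memLp h) fun k => ?_
    rw [← inner_hermiteL2_toLp k (Lp.memLp h), ← h1]
    exact hh _ (Submodule.subset_span ⟨k, rfl⟩)

lemma coe_hermiteBasis : (hermiteBasis : ℕ → Lp ℂ 2 (volume : Measure ℝ)) = hermiteL2 :=
  HilbertBasis.coe_mkOfOrthogonalEqBot _ _

/-- The `k`-th Hermite coefficient of `g`. -/
def hcoef (k : ℕ) (g : ℝ → ℂ) : ℂ := ∫ y, g y * ((Φh k y : ℝ) : ℂ)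

lemma hasSum_norm_sq_hcoef {g : ℝ → ℂ} (hg : MemLp g 2 volume) :
    HasSum (fun k => ‖hcoef k g‖ ^ 2) (‖hg.toLp‖ ^ 2) := by
  have h1 := hermiteBasis.hasSum_inner_mul_inner hg.toLp hg.toLp
  rw [coe_hermiteBasis] at h1
  have h2 := (Complex.hasSum_re h1)
  rw [inner_self_eq_norm_sq_to_K] at h2
  convert h2 using 1
  · funext k
    rw [inner_hermiteL2_toLp, ← inner_conj_symm, inner_hermiteL2_toLp, Complex.conj_mul']
    norm_cast
  · norm_cast

lemma enorm_sq_hcoef {g : ℝ → ℂ} (hg : MemLp g 2 volume) :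
    ∑' k, ‖hcoef k g‖ₑ ^ 2 = ∫⁻ y, ‖g y‖ₑ ^ 2 := by
  have h1 := hasSum_norm_sq_hcoef hg
  have h2 : ∀ k, ‖hcoef k g‖ₑ ^ 2 = ENNReal.ofReal (‖hcoef k g‖ ^ 2) := by
    intro k
    rw [ENNReal.ofReal_pow (norm_nonneg _), ofReal_norm]
  simp_rw [h2]
  rw [← ENNReal.ofReal_tsum_of_nonneg (fun _ => by positivity) h1.summable, h1.tsum_eq,
    ENNReal.ofReal_pow (norm_nonneg _), ofReal_norm, Lp.enorm_toLp,
    eLpNorm_eq_lintegral_rpow_enorm_toReal (by norm_num) (by norm_num)]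
  rw [← ENNReal.rpow_natCast, ← ENNReal.rpow_mul]
  simp

/-- Schwartz functions on the plane. -/
abbrev SchwartzPlane := SchwartzMap (ℝ × ℝ) ℂ

/-- The Schwartz map attached to a function satisfying `IsSchwartz2`. -/
def IsSchwartz2.toSchwartz {f : ℝ → ℝ → ℂ} (hf : IsSchwartz2 f) : SchwartzPlane where
  toFun := unc f
  smooth' := hf.1
  decay' := hf.2

/-- Multiplication by `x`. -/
def opX : Module.End ℂ SchwartzPlane :=
  (SchwartzMap.smulLeftCLM ℂ (fun q : ℝ × ℝ => ((q.1 : ℝ) : ℂ))).toLinearMap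

/-- Multiplication by `y`. -/
def opY : Module.End ℂ SchwartzPlane :=
  (SchwartzMap.smulLeftCLM ℂ (fun q : ℝ × ℝ => ((q.2 : ℝ) : ℂ))).toLinearMap

/-- The derivative `∂_x`. -/
def opDx : Module.End ℂ SchwartzPlane :=
  (LineDeriv.lineDerivOpCLM ℂ SchwartzPlane ((1, 0) : ℝ × ℝ)).toLinearMap

/-- The derivative `∂_y`. -/
def opDy : Module.End ℂ SchwartzPlane :=
  (LineDeriv.lineDerivOpCLM ℂ SchwartzPlane ((0, 1) : ℝ × ℝ)).toLinearMap

lemma hasTemperateGrowth_ofReal_fst :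
    (fun q : ℝ × ℝ => ((q.1 : ℝ) : ℂ)).HasTemperateGrowth :=
  (Complex.ofRealCLM.comp (ContinuousLinearMap.fst ℝ ℝ ℝ)).hasTemperateGrowth

lemma hasTemperateGrowth_ofReal_snd :
    (fun q : ℝ × ℝ => ((q.2 : ℝ) : ℂ)).HasTemperateGrowth :=
  (Complex.ofRealCLM.comp (ContinuousLinearMap.snd ℝ ℝ ℝ)).hasTemperateGrowth

@[simp] lemma opX_apply (F : SchwartzPlane) (q : ℝ × ℝ) : opX F q = (q.1 : ℂ) * F q := by
  simp [opX, SchwartzMap.smulLeftCLM_apply_apply hasTemperateGrowth_ofReal_fst]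

@[simp] lemma opY_apply (F : SchwartzPlane) (q : ℝ × ℝ) : opY F q = (q.2 : ℂ) * F q := by
  simp [opY, SchwartzMap.smulLeftCLM_apply_apply hasTemperateGrowth_ofReal_snd]

lemma hasDerivAt_fst_slice (F : SchwartzPlane) (x y : ℝ) :
    HasDerivAt (fun x' => F (x', y)) (opDx F (x, y)) x := by
  have h1 : HasFDerivAt F (fderiv ℝ F (x, y)) (x, y) :=
    (F.differentiable (x, y)).hasFDerivAt
  have h2 : HasDerivAt (fun x' : ℝ => (x', y)) ((1 : ℝ), (0 : ℝ)) x :=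
    (hasDerivAt_id x).prodMk (hasDerivAt_const x y)
  exact h1.comp_hasDerivAt x h2

lemma hasDerivAt_snd_slice (F : SchwartzPlane) (x y : ℝ) :
    HasDerivAt (fun y' => F (x, y')) (opDy F (x, y)) y := by
  have h1 : HasFDerivAt F (fderiv ℝ F (x, y)) (x, y) :=
    (F.differentiable (x, y)).hasFDerivAt
  have h2 : HasDerivAt (fun y' : ℝ => (x, y')) ((0 : ℝ), (1 : ℝ)) y :=
    (hasDerivAt_const y x).prodMk (hasDerivAt_id y)
  exact h1.comp_hasDerivAt y h2

lemma opDx_mul_opX : opDx * opX = opX * opDx + 1 := by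
  ext F ⟨x, y⟩
  have h := hasDerivAt_fst_slice (opX F) x y
  have h2 := ((hasDerivAt_id x).ofReal_comp).mul (hasDerivAt_fst_slice F x y)
  have h3 := h.unique (h2.congr_of_eventuallyEq (Filter.Eventually.of_forall fun x' => by simp))
  simp only [Module.End.mul_apply, LinearMap.add_apply, add_apply, h3]
  simp
  ring

lemma opDy_mul_opY : opDy * opY = opY * opDy + 1 := by
  ext F ⟨x, y⟩
  have h := hasDerivAt_snd_slice (opY F) x y
  have h2 := ((hasDerivAt_id y).ofReal_comp).mul (hasDerivAt_snd_slice F x y)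
  have h3 := h.unique (h2.congr_of_eventuallyEq (Filter.Eventually.of_forall fun x' => by simp))
  simp only [Module.End.mul_apply, LinearMap.add_apply, add_apply, h3]
  simp
  ring

lemma commute_opX_opY : Commute opX opY := by
  ext F q
  simp
  ring

lemma commute_opX_opDy : Commute opX opDy := by
  ext F ⟨x, y⟩
  have h := hasDerivAt_snd_slice (opX F) x y
  have h2 := (hasDerivAt_snd_slice F x y).const_mul (x : ℂ)
  have h3 := h.unique (h2.congr_of_eventuallyEq (Filter.Eventually.of_forall fun x' => by simp))
  simp [h3]

lemma commute_opY_opDx : Commute opY opDx := by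
  ext F ⟨x, y⟩
  have h := hasDerivAt_fst_slice (opY F) x y
  have h2 := (hasDerivAt_fst_slice F x y).const_mul (y : ℂ)
  have h3 := h.unique (h2.congr_of_eventuallyEq (Filter.Eventually.of_forall fun x' => by simp))
  simp [h3]

lemma commute_opDx_opDy : Commute opDx opDy := by
  ext F q
  have hs : ContDiffAt ℝ 2 F q := (F.smooth 2).contDiffAt
  have hsym : IsSymmSndFDerivAt ℝ F q := hs.isSymmSndFDerivAt (by simp)
  have hd : DifferentiableAt ℝ (fderiv ℝ F) q :=
    ((F.smooth 2).fderiv_right (m := 1) (by norm_num)).differentiable (by norm_num) q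
  have h1 : ∀ v w : ℝ × ℝ, fderiv ℝ (fun z => fderiv ℝ F z v) q w = fderiv ℝ (fderiv ℝ F) q w v := by
    intro v w
    rw [fderiv_clm_apply hd (by fun_prop)]
    simp
  change fderiv ℝ (fun z => fderiv ℝ F z (0, 1)) q (1, 0) =
    fderiv ℝ (fun z => fderiv ℝ F z (1, 0)) q (0, 1)
  rw [h1, h1]
  exact hsym _ _

lemma opDx_mul_opX_pow (a : ℕ) : opDx * opX ^ a = opX ^ a * opDx + (a : ℂ) • opX ^ (a - 1) := by
  induction a with
  | zero => simp
  | succ a ih =>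
    rw [pow_succ, ← mul_assoc, ih, add_mul, mul_assoc, opDx_mul_opX, mul_add, smul_mul_assoc]
    cases a with
    | zero => simp
    | succ a =>
      simp only [Nat.add_sub_cancel, ← pow_succ]
      push_cast
      simp only [add_smul, one_smul, mul_one, ← mul_assoc, ← pow_succ]
      abel

lemma opDy_mul_opY_pow (a : ℕ) : opDy * opY ^ a = opY ^ a * opDy + (a : ℂ) • opY ^ (a - 1) := by
  induction a with
  | zero => simp
  | succ a ih =>
    rw [pow_succ, ← mul_assoc, ih, add_mul, mul_assoc, opDy_mul_opY, mul_add, smul_mul_assoc]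
    cases a with
    | zero => simp
    | succ a =>
      simp only [Nat.add_sub_cancel, ← pow_succ]
      push_cast
      simp only [add_smul, one_smul, mul_one, ← mul_assoc, ← pow_succ]
      abel

lemma opDy_pow_mul_opY (a : ℕ) : opDy ^ a * opY = opY * opDy ^ a + (a : ℂ) • opDy ^ (a - 1) := by
  induction a with
  | zero => simp
  | succ a ih =>
    rw [pow_succ', mul_assoc, ih, mul_add, ← mul_assoc, opDy_mul_opY, add_mul, mul_smul_comm]
    cases a with
    | zero => simp
    | succ a =>
      simp only [Nat.add_sub_cancel, ← pow_succ']
      push_cast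
      simp only [add_smul, one_smul, one_mul, mul_assoc, ← pow_succ']
      abel

/-- The weighted derivative `x^a ∂_x^b y^α ∂_y^β` on Schwartz functions. -/
def opW (a b α β : ℕ) : Module.End ℂ SchwartzPlane :=
  opX ^ a * opY ^ α * (opDx ^ b * opDy ^ β)

lemma opX_pow_apply (a : ℕ) (F : SchwartzPlane) (q : ℝ × ℝ) :
    (opX ^ a) F q = (q.1 : ℂ) ^ a * F q := by
  induction a with
  | zero => simp
  | succ a ih => rw [pow_succ', Module.End.mul_apply, opX_apply, ih]; ring

lemma opY_pow_apply (a : ℕ) (F : SchwartzPlane) (q : ℝ × ℝ) :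
    (opY ^ a) F q = (q.2 : ℂ) ^ a * F q := by
  induction a with
  | zero => simp
  | succ a ih => rw [pow_succ', Module.End.mul_apply, opY_apply, ih]; ring

lemma iteratedDeriv_fst_slice (b : ℕ) (F : SchwartzPlane) (x y : ℝ) :
    iteratedDeriv b (fun x' => F (x', y)) x = (opDx ^ b) F (x, y) := by
  induction b generalizing F with
  | zero => simp
  | succ b ih =>
    rw [iteratedDeriv_succ', pow_succ, Module.End.mul_apply, ← ih]
    congr 1
    funext x'
    exact (hasDerivAt_fst_slice F x' y).deriv

lemma iteratedDeriv_snd_slice (b : ℕ) (F : SchwartzPlane) (x y : ℝ) :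
    iteratedDeriv b (fun y' => F (x, y')) y = (opDy ^ b) F (x, y) := by
  induction b generalizing F with
  | zero => simp
  | succ b ih =>
    rw [iteratedDeriv_succ', pow_succ, Module.End.mul_apply, ← ih]
    congr 1
    funext y'
    exact (hasDerivAt_snd_slice F x y').deriv

lemma pd2_eq_op (b β : ℕ) (F : SchwartzPlane) (x y : ℝ) :
    pd2 b β (fun x y => F (x, y)) x y = (opDx ^ b * opDy ^ β) F (x, y) := by
  unfold pd2
  simp_rw [iteratedDeriv_snd_slice]
  rw [iteratedDeriv_fst_slice, Module.End.mul_apply]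

lemma opW_apply (a b α β : ℕ) (F : SchwartzPlane) (q : ℝ × ℝ) :
    opW a b α β F q = (q.1 : ℂ) ^ a * (q.2 : ℂ) ^ α * (opDx ^ b * opDy ^ β) F q := by
  rw [opW, Module.End.mul_apply, Module.End.mul_apply, opX_pow_apply, opY_pow_apply, mul_assoc]

lemma wD_eq_opW {f : ℝ → ℝ → ℂ} (hf : IsSchwartz2 f) (a b α β : ℕ) :
    unc (wD a b α β f) = opW a b α β hf.toSchwartz := by
  funext q
  rw [opW_apply, unc, wD, ← Prod.mk.eta (p := q), ← pd2_eq_op]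
  rfl

/-- The commutation defect of `∂_x ∂_y` with the weighted derivative. -/
lemma opW_mul_opDx_mul_opDy (a b α β : ℕ) :
    opW a b α β * (opDx * opDy) = opDx * opDy * opW a b α β
      - (α : ℂ) • opW a (b + 1) (α - 1) β
      - (a : ℂ) • opW (a - 1) b α (β + 1)
      - ((a : ℂ) * α) • opW (a - 1) b (α - 1) β := by
  have c1 : opDx ^ b * opDy ^ β * (opDx * opDy) = opDx * opDy * (opDx ^ b * opDy ^ β) := by
    have h1 : Commute (opDx ^ b * opDy ^ β) (opDx * opDy) := by
      have e := commute_opDx_opDy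
      refine Commute.mul_left (Commute.mul_right ?_ ?_) (Commute.mul_right ?_ ?_)
      · exact (Commute.refl _).pow_left _
      · exact e.pow_left _
      · exact e.symm.pow_left _
      · exact (Commute.refl _).pow_left _
    exact h1
  have c2 : opDy * (opX ^ a * opY ^ α) = opX ^ a * (opY ^ α * opDy + (α : ℂ) • opY ^ (α - 1)) := by
    rw [← opDy_mul_opY_pow, ← mul_assoc, ← (commute_opX_opDy.pow_left a).eq, mul_assoc]
  have c3 : ∀ n, opDx * (opX ^ a * opY ^ n) =
      opX ^ a * opY ^ n * opDx + (a : ℂ) • (opX ^ (a-1) * opY ^ n) := by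
    intro n
    rw [← mul_assoc, opDx_mul_opX_pow, add_mul, mul_assoc, ← (commute_opY_opDx.pow_left n).eq,
      smul_mul_assoc, mul_assoc]
  have c4 : opDx * opDy * (opX ^ a * opY ^ α) =
      opX ^ a * opY ^ α * (opDx * opDy) + (a : ℂ) • (opX ^ (a-1) * opY ^ α * opDy)
      + (α : ℂ) • (opX ^ a * opY ^ (α-1) * opDx)
      + ((a : ℂ) * α) • (opX ^ (a-1) * opY ^ (α - 1)) := by
    rw [mul_assoc, c2, mul_add, mul_add, ← mul_assoc (opX ^ a), ← mul_assoc, c3, mul_smul_comm,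
      mul_smul_comm, c3, add_mul, smul_add, smul_smul, mul_comm (α : ℂ) (a : ℂ), mul_assoc,
      smul_mul_assoc]
    abel
  have c5 : opDy * (opDx ^ b * opDy ^ β) = opDx ^ b * opDy ^ (β + 1) := by
    rw [← mul_assoc, ← (commute_opDx_opDy.pow_left b).eq, mul_assoc, pow_succ']
  have c6 : opDx * (opDx ^ b * opDy ^ β) = opDx ^ (b + 1) * opDy ^ β := by
    rw [← mul_assoc, pow_succ']
  unfold opW
  rw [mul_assoc, c1, ← mul_assoc, ← mul_assoc (opDx * opDy), c4]
  simp only [add_mul, smul_mul_assoc]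
  rw [mul_assoc _ opDy, c5, mul_assoc _ opDx, c6]
  abel

lemma norm_le_sqrt_add_norm_sq {E : Type*} [NormedAddCommGroup E] (ε : ℝ) (v : E) :
    ‖v‖ ≤ Real.sqrt (ε ^ 2 + ‖v‖ ^ 2) :=
  Real.le_sqrt_of_sq_le (by nlinarith [sq_nonneg ε])

lemma sqrt_add_norm_sq_le {E : Type*} [NormedAddCommGroup E] {ε : ℝ} (hε : 0 < ε) (v : E) :
    Real.sqrt (ε ^ 2 + ‖v‖ ^ 2) ≤ ε + ‖v‖ := by
  rw [Real.sqrt_le_left (by positivity)]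
  nlinarith [norm_nonneg v, mul_nonneg hε.le (norm_nonneg v)]

lemma div_sqrt_add_norm_sq_le {E : Type*} [NormedAddCommGroup E] {ε r b : ℝ} (hε : 0 < ε) (v : E)
    (hb : 0 ≤ b) (h : r ≤ ‖v‖ * b) :
    r / Real.sqrt (ε ^ 2 + ‖v‖ ^ 2) ≤ b := by
  have h1 : 0 < Real.sqrt (ε ^ 2 + ‖v‖ ^ 2) := Real.sqrt_pos.2 (by positivity)
  rw [div_le_iff₀ h1]
  calc r ≤ ‖v‖ * b := h
    _ ≤ Real.sqrt (ε ^ 2 + ‖v‖ ^ 2) * b :=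
        mul_le_mul_of_nonneg_right (norm_le_sqrt_add_norm_sq ε v) hb
    _ = _ := mul_comm _ _

section AbstractGrowth

variable {E : Type*} [NormedAddCommGroup E] [InnerProductSpace ℂ E] [NormedSpace ℝ E]

lemma hasDerivWithinAt_sqrt_add_norm_sq {Ψ : ℝ → E} {Ψ' : E} {s : Set ℝ} {t ε : ℝ} (hε : 0 < ε)
    (h : HasDerivWithinAt Ψ Ψ' s t) :
    HasDerivWithinAt (fun t => Real.sqrt (ε ^ 2 + ‖Ψ t‖ ^ 2))
      ((inner ℂ (Ψ t) Ψ').re / Real.sqrt (ε ^ 2 + ‖Ψ t‖ ^ 2)) s t := by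
  have h1 := h.inner ℂ h
  have h2 : HasDerivWithinAt (fun t => ‖Ψ t‖ ^ 2) (2 * (inner ℂ (Ψ t) Ψ').re) s t := by
    have h3 := (Complex.reCLM.hasFDerivAt (x := inner ℂ (Ψ t) (Ψ t))).comp_hasDerivWithinAt t h1
    have e : (fun t => ‖Ψ t‖ ^ 2) = Complex.reCLM ∘ fun t => inner ℂ (Ψ t) (Ψ t) := by
      funext u
      exact (inner_self_eq_norm_sq (𝕜 := ℂ) (Ψ u)).symm
    rw [e]
    refine h3.congr_deriv ?_
    rw [Complex.reCLM_apply, Complex.add_re, ← inner_conj_symm Ψ' (Ψ t), Complex.conj_re]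
    ring
  have hpos : 0 < ε ^ 2 + ‖Ψ t‖ ^ 2 := by positivity
  convert (h2.const_add (ε ^ 2)).sqrt hpos.ne' using 1
  field_simp

lemma norm_le_of_re_inner_deriv_le {Ψ Ψ' : ℝ → E} {g g' : ℝ → ℝ}
    (hΨ : ∀ t, 0 ≤ t → HasDerivWithinAt Ψ (Ψ' t) (Set.Ici 0) t)
    (hg : ∀ t, HasDerivAt g (g' t) t) (hg0 : ∀ t, 0 ≤ t → 0 ≤ g' t)
    (h : ∀ t, 0 ≤ t → (inner ℂ (Ψ t) (Ψ' t)).re ≤ ‖Ψ t‖ * g' t) {t : ℝ} (ht : 0 ≤ t) :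
    ‖Ψ t‖ ≤ ‖Ψ 0‖ + (g t - g 0) := by
  refine le_of_forall_pos_le_add fun ε hε => ?_
  set f : ℝ → ℝ := fun t => Real.sqrt (ε ^ 2 + ‖Ψ t‖ ^ 2) with hf
  have hder : ∀ u, 0 ≤ u → HasDerivWithinAt f _ (Set.Ici 0) u := fun u hu =>
    hasDerivWithinAt_sqrt_add_norm_sq hε (hΨ u hu)
  have key := image_le_of_deriv_right_le_deriv_boundary (f := f) (a := 0) (b := t)
    (B := fun u => f 0 + (g u - g 0)) (B' := g')
    (fun u hu => ((hder u hu.1).continuousWithinAt).mono Set.Icc_subset_Ici_self)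
    (fun u hu => (hder u hu.1).mono (Set.Ici_subset_Ici.2 hu.1)) (by simp)
    (fun u _ => (((hg u).sub_const _).const_add _).continuousAt.continuousWithinAt)
    (fun u _ => (((hg u).sub_const _).const_add _).hasDerivWithinAt)
    (fun u hu => div_sqrt_add_norm_sq_le hε _ (hg0 u hu.1) (h u hu.1))
  have h2 := key (Set.right_mem_Icc.2 ht)
  have h3 := norm_le_sqrt_add_norm_sq ε (Ψ t)
  have h4 := sqrt_add_norm_sq_le hε (Ψ 0)
  simp only [hf] at h2
  linarith

lemma sum_norm_le_of_re_inner_deriv_le {ι : Type*} (s : Finset ι) {Ψ Ψ' : ι → ℝ → E}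
    {b : ι → ℝ → ℝ} {C : ℝ} (hC : 0 ≤ C)
    (hΨ : ∀ i ∈ s, ∀ t, 0 ≤ t → HasDerivWithinAt (Ψ i) (Ψ' i t) (Set.Ici 0) t)
    (hb : ∀ i ∈ s, ∀ t, 0 ≤ t → 0 ≤ b i t)
    (h : ∀ i ∈ s, ∀ t, 0 ≤ t → (inner ℂ (Ψ i t) (Ψ' i t)).re ≤ ‖Ψ i t‖ * b i t)
    (hsum : ∀ t, 0 ≤ t → ∑ i ∈ s, b i t ≤ C * ∑ i ∈ s, ‖Ψ i t‖) {t : ℝ} (ht : 0 ≤ t) :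
    ∑ i ∈ s, ‖Ψ i t‖ ≤ Real.exp (C * t) * ∑ i ∈ s, ‖Ψ i 0‖ := by
  have main : ∀ ε > 0, ∑ i ∈ s, ‖Ψ i t‖ ≤ Real.exp (C * t) * ∑ i ∈ s, (ε + ‖Ψ i 0‖) := by
    intro ε hε
    set f : ℝ → ℝ := fun t => ∑ i ∈ s, Real.sqrt (ε ^ 2 + ‖Ψ i t‖ ^ 2) with hf
    have hder : ∀ u, 0 ≤ u → HasDerivWithinAt f _ (Set.Ici 0) u := fun u hu =>
      HasDerivWithinAt.fun_sum fun i hi => hasDerivWithinAt_sqrt_add_norm_sq hε (hΨ i hi u hu)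
    have hle : ∀ u, ∑ i ∈ s, ‖Ψ i u‖ ≤ f u := fun u =>
      Finset.sum_le_sum fun i _ => norm_le_sqrt_add_norm_sq ε _
    have key := le_gronwallBound_of_liminf_deriv_right_le (f := f) (a := 0) (b := t)
      (δ := f 0) (K := C) (ε := 0)
      (fun u hu => ((hder u hu.1).continuousWithinAt).mono Set.Icc_subset_Ici_self)
      (fun u hu r hr =>
        ((hder u hu.1).mono (Set.Ici_subset_Ici.2 hu.1)).liminf_right_slope_le hr) le_rfl
      (fun u hu => by
        have h1 : ∑ i ∈ s, (inner ℂ (Ψ i u) (Ψ' i u)).re / Real.sqrt (ε ^ 2 + ‖Ψ i u‖ ^ 2)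
            ≤ ∑ i ∈ s, b i u := Finset.sum_le_sum fun i hi =>
          div_sqrt_add_norm_sq_le hε _ (hb i hi u hu.1) (h i hi u hu.1)
        have h2 := mul_le_mul_of_nonneg_left (hle u) hC
        have h3 := hsum u hu.1
        linarith)
    have h2 := key t (Set.right_mem_Icc.2 ht)
    rw [gronwallBound_ε0, sub_zero, mul_comm] at h2
    refine (hle t).trans (h2.trans ?_)
    exact mul_le_mul_of_nonneg_left
      (Finset.sum_le_sum fun i _ => sqrt_add_norm_sq_le hε (Ψ i 0)) (Real.exp_pos _).le
  refine le_of_forall_pos_le_add fun δ hδ => ?_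
  set K := Real.exp (C * t) with hK
  have hK0 : 0 < K := Real.exp_pos _
  have hd : 0 < K * s.card + 1 := by positivity
  refine (main (δ / (K * s.card + 1)) (by positivity)).trans ?_
  rw [Finset.sum_add_distrib, Finset.sum_const, nsmul_eq_mul, mul_add, add_comm]
  gcongr
  rw [← mul_assoc, ← mul_div_assoc, div_le_iff₀ hd]
  nlinarith

end AbstractGrowth

/-- The potential is of class `C^{m+1}` with bounded derivatives of order `2,…,m+1`. -/
structure PotentialBound (m : ℕ) (V : ℝ → ℝ) : Prop where
  contDiff : ContDiff ℝ ((m + 1 : ℕ) : WithTop ℕ∞) V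
  bounded : ∀ n : ℕ, 2 ≤ n → n ≤ m + 1 → ∃ C : ℝ, ∀ x : ℝ, |iteratedDeriv n V x| ≤ C

/-- The maximum of the sup-norms of the derivatives of order `2,…,m+1`. -/
def maxDeriv (m : ℕ) (V : ℝ → ℝ) : ℝ := ⨆ n ∈ Finset.Icc 2 (m + 1), supN (iteratedDeriv n V)

lemma supN_nonneg (f : ℝ → ℝ) : 0 ≤ supN f := Real.iSup_nonneg fun _ => abs_nonneg _

lemma maxDeriv_nonneg (m : ℕ) (V : ℝ → ℝ) : 0 ≤ maxDeriv m V :=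
  Real.iSup_nonneg fun _ => Real.iSup_nonneg fun _ => supN_nonneg _

lemma abs_le_supN {f : ℝ → ℝ} (h : ∃ C : ℝ, ∀ x, |f x| ≤ C) (x : ℝ) : |f x| ≤ supN f := by
  obtain ⟨C, hC⟩ := h
  exact le_ciSup (f := fun x => |f x|) ⟨C, by rintro _ ⟨y, rfl⟩; exact hC y⟩ x

lemma le_biSup_finset {s : Finset ℕ} {v : ℕ → ℝ} (hv : ∀ n, 0 ≤ v n) {n : ℕ} (hn : n ∈ s) :
    v n ≤ ⨆ n ∈ s, v n := by
  have hb : BddAbove (Set.range fun n => ⨆ (_ : n ∈ s), v n) := by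
    refine ⟨∑ n ∈ s, v n, ?_⟩
    rintro _ ⟨k, rfl⟩
    by_cases hk : k ∈ s
    · simp only [hk, ciSup_unique]
      exact Finset.single_le_sum (fun i _ => hv i) hk
    · simp only [hk, Real.iSup_of_isEmpty]
      exact Finset.sum_nonneg fun i _ => hv i
  refine le_trans ?_ (le_ciSup hb n)
  simp [hn]

namespace PotentialBound

variable {m : ℕ} {V : ℝ → ℝ}

lemma abs_iteratedDeriv_le (h : PotentialBound m V) {n : ℕ} (h2 : 2 ≤ n) (hn : n ≤ m + 1) (x : ℝ) :
    |iteratedDeriv n V x| ≤ maxDeriv m V :=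
  (abs_le_supN (h.bounded n h2 hn) x).trans
    (le_biSup_finset (v := fun n => supN (iteratedDeriv n V)) (fun _ => supN_nonneg _)
      (Finset.mem_Icc.2 ⟨h2, hn⟩))

lemma contDiff_deriv (h : PotentialBound m V) : ContDiff ℝ (m : WithTop ℕ∞) (deriv V) := by
  have := h.contDiff
  rw [Nat.cast_add, Nat.cast_one, contDiff_succ_iff_deriv] at this
  exact this.2.2

lemma abs_deriv_le (h : PotentialBound m V) (hm : 1 ≤ m) (x : ℝ) :
    |deriv V x| ≤ |deriv V 0| + supN (iteratedDeriv 2 V) * |x| := by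
  have h1 := Convex.norm_image_sub_le_of_norm_deriv_le (f := deriv V) (s := Set.univ) (x := 0)
    (y := x) (C := supN (iteratedDeriv 2 V))
    (fun x _ => h.contDiff_deriv.differentiable (by exact_mod_cast (by omega)) x)
    (fun x _ => by
      have := abs_le_supN (h.bounded 2 le_rfl (by omega)) x
      rwa [show iteratedDeriv 2 V x = deriv (deriv V) x by
        rw [iteratedDeriv_succ, iteratedDeriv_one]] at this) convex_univ trivial trivial
  simp only [Real.norm_eq_abs, sub_zero] at h1
  have := abs_sub_abs_le_abs_sub (deriv V x) (deriv V 0)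
  linarith

end PotentialBound

lemma iteratedDeriv_ofReal_comp {f : ℝ → ℝ} {n : ℕ} (hf : ContDiff ℝ (n : WithTop ℕ∞) f) (x : ℝ) :
    iteratedDeriv n (fun x => ((f x : ℝ) : ℂ)) x = ((iteratedDeriv n f x : ℝ) : ℂ) := by
  induction n generalizing f with
  | zero => simp
  | succ n ih =>
    rw [Nat.cast_add, Nat.cast_one, contDiff_succ_iff_deriv] at hf
    rw [iteratedDeriv_succ', iteratedDeriv_succ', ← ih hf.2.2]
    congr 1
    funext z
    exact (hf.1 z).hasDerivAt.ofReal_comp.deriv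

lemma contDiff_fst_slice (F : SchwartzPlane) (y : ℝ) {n : WithTop ℕ∞} (hn : n ≤ (⊤ : ℕ∞)) :
    ContDiff ℝ n (fun x => F (x, y)) := by
  have h1 : ContDiff ℝ (⊤ : ℕ∞) F := F.smooth _
  exact (h1.comp (contDiff_id.prodMk contDiff_const)).of_le hn

/-- The right-hand side of the semiclassical equation applied to a Schwartz function. -/
def scRhs (V : ℝ → ℝ) (f : ℝ → ℝ → ℂ) (x y : ℝ) : ℂ :=
  Complex.I * pd2 1 1 f x y - Complex.I * ((deriv V x * y : ℝ) : ℂ) * f x y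

lemma pd2_potential {m : ℕ} {V : ℝ → ℝ} (hV : PotentialBound m V) (A G : SchwartzPlane)
    {b : ℕ} (hb : b ≤ m) (β : ℕ) (x y : ℝ) :
    pd2 b β (fun x y => Complex.I * A (x, y) - Complex.I * ((deriv V x : ℝ) : ℂ) * G (x, y)) x y =
      Complex.I * (opDx ^ b * opDy ^ β) A (x, y) -
      Complex.I * ∑ j ∈ Finset.range (b + 1), (b.choose j : ℂ) *
        ((iteratedDeriv (j + 1) V x : ℝ) : ℂ) * (opDx ^ (b - j) * opDy ^ β) G (x, y) := by
  unfold pd2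
  have h1 : ∀ x', iteratedDeriv β (fun y' => Complex.I * A (x', y') -
      Complex.I * ((deriv V x' : ℝ) : ℂ) * G (x', y')) y =
      Complex.I * ((opDy ^ β) A (x', y)) -
        Complex.I * (((deriv V x' : ℝ) : ℂ) * (opDy ^ β) G (x', y)) := by
    intro x'
    have := iteratedDeriv_snd_slice β
      (Complex.I • A - (Complex.I * ((deriv V x' : ℝ) : ℂ)) • G) x' y
    simp only [sub_apply, smul_apply, smul_eq_mul, map_sub, map_smul] at this
    rw [this]; ring
  simp_rw [h1]
  have hVb : ContDiff ℝ (b : WithTop ℕ∞) (deriv V) :=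
    hV.contDiff_deriv.of_le (by exact_mod_cast hb)
  have hVc : ContDiff ℝ (b : WithTop ℕ∞) (fun x => ((deriv V x : ℝ) : ℂ)) :=
    Complex.ofRealCLM.contDiff.comp hVb
  have hb' : (b : WithTop ℕ∞) ≤ (⊤ : ℕ∞) := by exact_mod_cast le_top
  have sA := contDiff_fst_slice ((opDy ^ β) A) y hb'
  have sG := contDiff_fst_slice ((opDy ^ β) G) y hb'
  rw [iteratedDeriv_fun_sub (contDiff_const.mul sA).contDiffAt
    (contDiff_const.mul (hVc.mul sG)).contDiffAt, iteratedDeriv_const_mul_field,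
    iteratedDeriv_const_mul_field, iteratedDeriv_fst_slice,
    iteratedDeriv_fun_mul hVc.contDiffAt sG.contDiffAt]
  congr 2
  refine Finset.sum_congr rfl fun j hj => ?_
  have hjb : j ≤ b := Nat.lt_succ_iff.1 (Finset.mem_range.1 hj)
  rw [iteratedDeriv_ofReal_comp (hVb.of_le (by exact_mod_cast hjb)), iteratedDeriv_fst_slice,
    ← iteratedDeriv_succ']
  rfl

lemma opDx_opDy_pow_mul_opY (c β : ℕ) :
    opDx ^ c * opDy ^ β * opY = opY * (opDx ^ c * opDy ^ β) + (β : ℂ) • (opDx ^ c * opDy ^ (β - 1)) := by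
  rw [mul_assoc, opDy_pow_mul_opY, mul_add, ← mul_assoc, ← (commute_opY_opDx.pow_right c).eq,
    mul_assoc, mul_smul_comm]

lemma wD_scRhs {m : ℕ} {V : ℝ → ℝ} (hV : PotentialBound m V) {f : ℝ → ℝ → ℂ} (hf : IsSchwartz2 f)
    (a : ℕ) {b : ℕ} (hb : b ≤ m) (α β : ℕ) (x y : ℝ) :
    wD a b α β (scRhs V f) x y =
      Complex.I * (opW a b α β * (opDx * opDy)) hf.toSchwartz (x, y) -
      Complex.I * ∑ j ∈ Finset.range (b + 1), (b.choose j : ℂ) *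
        ((iteratedDeriv (j + 1) V x : ℝ) : ℂ) *
          (opW a (b - j) (α + 1) β hf.toSchwartz (x, y) +
            (β : ℂ) * opW a (b - j) α (β - 1) hf.toSchwartz (x, y)) := by
  set F := hf.toSchwartz with hF
  have h1 : scRhs V f = fun x y => Complex.I * ((opDx * opDy) F) (x, y) -
      Complex.I * ((deriv V x : ℝ) : ℂ) * (opY F) (x, y) := by
    funext x y
    have := pd2_eq_op 1 1 F x y
    simp only [pow_one] at this
    rw [← this, scRhs, opY_apply]
    push_cast
    change _ = Complex.I * pd2 1 1 f x y - _ * ((y:ℂ) * f x y)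
    ring
  unfold wD
  rw [h1, pd2_potential hV _ _ hb]
  simp only [← Module.End.mul_apply, opDx_opDy_pow_mul_opY]
  have h2 : ∀ a b α β, (opW a b α β) F (x, y) =
      (x : ℂ) ^ a * (y : ℂ) ^ α * (opDx ^ b * opDy ^ β) F (x, y) := fun a b α β => opW_apply ..
  have h3 : (opW a b α β * (opDx * opDy)) F (x, y) =
      (x : ℂ) ^ a * (y : ℂ) ^ α * (opDx ^ b * opDy ^ β * (opDx * opDy)) F (x, y) := by
    rw [Module.End.mul_apply (opW a b α β), opW_apply]
    rfl
  simp only [h2, h3, LinearMap.add_apply, LinearMap.smul_apply, Module.End.mul_apply opY, add_apply,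
    smul_apply, opY_apply, smul_eq_mul, pow_succ]
  rw [mul_sub, mul_left_comm _ Complex.I, mul_left_comm _ Complex.I, Finset.mul_sum]
  congr 2
  refine Finset.sum_congr rfl fun j _ => ?_
  ring

/-- Multi-indices `(a, b, α, β)` of weighted derivatives. -/
abbrev WIndex := ℕ × ℕ × ℕ × ℕ

/-- The multi-indices of total order at most `m`. -/
def wIndices (m : ℕ) : Finset WIndex :=
  Finset.filter (fun q : ℕ × ℕ × ℕ × ℕ => q.1 + q.2.1 + q.2.2.1 + q.2.2.2 ≤ m)
    (Finset.range (m+1) ×ˢ Finset.range (m+1) ×ˢ Finset.range (m+1) ×ˢ Finset.range (m+1))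

lemma mem_wIndices {m : ℕ} {q : WIndex} :
    q ∈ wIndices m ↔ q.1 + q.2.1 + q.2.2.1 + q.2.2.2 ≤ m := by
  simp only [wIndices, Finset.mem_filter, Finset.mem_product, Finset.mem_range]
  omega

/-- The weighted derivative attached to a multi-index. -/
abbrev opWq (q : WIndex) : Module.End ℂ SchwartzPlane := opW q.1 q.2.1 q.2.2.1 q.2.2.2

/-- The `L²` norm of a Schwartz function on the plane. -/
def sNorm (F : SchwartzPlane) : ℝ := ‖F.toLp 2 volume‖

lemma sNorm_nonneg (F : SchwartzPlane) : 0 ≤ sNorm F := norm_nonneg _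

lemma sNorm_eq (F : SchwartzPlane) : sNorm F = (eLpNorm F 2 volume).toReal := SchwartzMap.norm_toLp

lemma L2_wD {f : ℝ → ℝ → ℂ} (hf : IsSchwartz2 f) (a b α β : ℕ) :
    L2 (wD a b α β f) = sNorm (opW a b α β hf.toSchwartz) := by
  rw [L2, wD_eq_opW hf, sNorm_eq]

lemma NN_eq {f : ℝ → ℝ → ℂ} (hf : IsSchwartz2 f) (m : ℕ) :
    NN m f = ∑ q ∈ wIndices m, sNorm (opWq q hf.toSchwartz) := by
  unfold NN
  exact Finset.sum_congr rfl fun q _ => L2_wD hf _ _ _ _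

lemma integral_norm_mul_norm_le (u v : SchwartzPlane) :
    ∫ z, ‖u z‖ * ‖v z‖ ≤ sNorm u * sNorm v := by
  have hu := (u.memLp 2 volume).norm
  have hv := (v.memLp 2 volume).norm
  have h := real_inner_le_norm hu.toLp hv.toLp
  rw [Lp.norm_toLp, Lp.norm_toLp, eLpNorm_norm, eLpNorm_norm, ← sNorm_eq, ← sNorm_eq] at h
  refine le_of_eq_of_le ?_ h
  rw [L2.inner_def]
  refine integral_congr_ae ?_
  filter_upwards [hu.coeFn_toLp, hv.coeFn_toLp] with z h1 h2
  rw [h1, h2]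
  simp [mul_comm]

lemma integrable_norm_mul_norm (u v : SchwartzPlane) :
    Integrable (fun z => ‖u z‖ * ‖v z‖) volume :=
  (u.memLp 2 volume).norm.integrable_mul (v.memLp 2 volume).norm

lemma integrable_conj_mul {u v : ℝ × ℝ → ℂ} (hu : MemLp u 2 volume) (hv : MemLp v 2 volume) :
    Integrable (fun z => (starRingEnd ℂ) (u z) * v z) volume :=
  hu.star.integrable_mul hv

lemma integral_re_conj_mul_opDx_opDy (u : SchwartzPlane) :
    ∫ z, ((starRingEnd ℂ) (u z) * (Complex.I * (opDx * opDy) u z)).re = 0 := by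
  set L : ℂ →L[ℝ] ℂ →L[ℝ] ℝ :=
    (isBoundedBilinearMap_inner (𝕜 := ℝ) (E := ℂ)).toContinuousLinearMap with hL
  have hLa : ∀ z w : ℂ, L z w = (w * (starRingEnd ℂ) z).re := fun z w => Complex.inner z w
  have e1 := SchwartzMap.integral_bilinear_lineDerivOp_right_eq_neg_left (μ := volume)
    u (Complex.I • opDy u) L ((1, 0) : ℝ × ℝ)
  have e2 := SchwartzMap.integral_bilinear_lineDerivOp_right_eq_neg_left (μ := volume)
    u (Complex.I • opDx u) L ((0, 1) : ℝ × ℝ)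
  have f1 : ∀ F : SchwartzPlane, LineDeriv.lineDerivOp ((1, 0) : ℝ × ℝ) F = opDx F := fun _ => rfl
  have f2 : ∀ F : SchwartzPlane, LineDeriv.lineDerivOp ((0, 1) : ℝ × ℝ) F = opDy F := fun _ => rfl
  simp only [f1, f2, hLa, map_smul, smul_apply, smul_eq_mul] at e1 e2
  have hc : opDy (opDx u) = opDx (opDy u) := by
    rw [← Module.End.mul_apply, ← commute_opDx_opDy.eq, Module.End.mul_apply]
  rw [hc] at e2
  have h3 : ∀ z, (Complex.I * opDx u z * (starRingEnd ℂ) (opDy u z)).re =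
      -(Complex.I * opDy u z * (starRingEnd ℂ) (opDx u z)).re := by
    intro z; simp; ring
  simp_rw [h3] at e2
  rw [integral_neg] at e2
  have h4 : ∀ z, ((starRingEnd ℂ) (u z) * (Complex.I * (opDx * opDy) u z)).re =
      (Complex.I * opDx (opDy u) z * (starRingEnd ℂ) (u z)).re := by
    intro z; rw [mul_comm]; rfl
  simp_rw [h4]
  linarith

/-- The coefficients of the commutator terms in the growth estimate. -/
def growthCoef (m : ℕ) (V : ℝ → ℝ) : Fin 5 ⊕ Fin m ⊕ Fin m → WIndex → ℝ
  | .inl 0, q => q.2.2.1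
  | .inl 1, q => q.1
  | .inl 2, q => q.1 * q.2.2.1
  | .inl 3, q => q.2.2.2 * |deriv V 0|
  | .inl 4, q => q.2.2.2 * supN (iteratedDeriv 2 V)
  | .inr (.inl j), q => q.2.1.choose (j + 1) * maxDeriv m V
  | .inr (.inr j), q => q.2.1.choose (j + 1) * maxDeriv m V * q.2.2.2

/-- The multi-indices of the commutator terms in the growth estimate. -/
def growthShift (m : ℕ) : Fin 5 ⊕ Fin m ⊕ Fin m → WIndex → WIndex
  | .inl 0, q => (q.1, q.2.1 + 1, q.2.2.1 - 1, q.2.2.2)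
  | .inl 1, q => (q.1 - 1, q.2.1, q.2.2.1, q.2.2.2 + 1)
  | .inl 2, q => (q.1 - 1, q.2.1, q.2.2.1 - 1, q.2.2.2)
  | .inl 3, q => (q.1, q.2.1, q.2.2.1, q.2.2.2 - 1)
  | .inl 4, q => (q.1 + 1, q.2.1, q.2.2.1, q.2.2.2 - 1)
  | .inr (.inl j), q => (q.1, q.2.1 - (j + 1), q.2.2.1 + 1, q.2.2.2)
  | .inr (.inr j), q => (q.1, q.2.1 - (j + 1), q.2.2.1, q.2.2.2 - 1)

/-- Uniform bounds for `growthCoef` on `wIndices m`. -/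
def growthBound (m : ℕ) (V : ℝ → ℝ) : Fin 5 ⊕ Fin m ⊕ Fin m → ℝ
  | .inl 0 => m
  | .inl 1 => m
  | .inl 2 => (m : ℝ) ^ 2
  | .inl 3 => m * |deriv V 0|
  | .inl 4 => m * supN (iteratedDeriv 2 V)
  | .inr (.inl _) => 2 ^ m * maxDeriv m V
  | .inr (.inr _) => 2 ^ m * maxDeriv m V * m

lemma sum_growthBound (m : ℕ) (V : ℝ → ℝ) : ∑ i, growthBound m V i = CmV m V := by
  rw [Fintype.sum_sum_type, Fintype.sum_sum_type, Fin.sum_univ_five]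
  simp only [growthBound, Finset.sum_const, Finset.card_univ, Fintype.card_fin, nsmul_eq_mul]
  rw [CmV, maxDeriv]
  ring

lemma growthCoef_nonneg (m : ℕ) (V : ℝ → ℝ) (i) (q : WIndex) : 0 ≤ growthCoef m V i q := by
  have := maxDeriv_nonneg m V
  have := supN_nonneg (iteratedDeriv 2 V)
  rcases i with i | i | i
  · fin_cases i <;> simp only [growthCoef] <;> positivity
  · simp only [growthCoef]; positivity
  · simp only [growthCoef]; positivity

lemma growthCoef_le (m : ℕ) (V : ℝ → ℝ) (i) {q : WIndex} (hq : q ∈ wIndices m) :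
    growthCoef m V i q ≤ growthBound m V i := by
  rw [mem_wIndices] at hq
  have h0 := maxDeriv_nonneg m V
  have h2 := supN_nonneg (iteratedDeriv 2 V)
  have ha : (q.1 : ℝ) ≤ m := by exact_mod_cast (by omega)
  have hα : (q.2.2.1 : ℝ) ≤ m := by exact_mod_cast (by omega)
  have hβ : (q.2.2.2 : ℝ) ≤ m := by exact_mod_cast (by omega)
  have hc : ∀ j, (q.2.1.choose j : ℝ) ≤ 2 ^ m := by
    intro j
    have h1 : q.2.1.choose j ≤ 2 ^ q.2.1 := Nat.choose_le_two_pow _ _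
    have h3 : 2 ^ q.2.1 ≤ 2 ^ m := Nat.pow_le_pow_right (by norm_num) (by omega)
    exact_mod_cast h1.trans h3
  rcases i with i | i | i
  · fin_cases i <;> simp only [growthCoef, growthBound]
    · exact hα
    · exact ha
    · change (q.1 : ℝ) * q.2.2.1 ≤ (m : ℝ) ^ 2
      rw [sq]; gcongr
    · change (q.2.2.2 : ℝ) * |deriv V 0| ≤ m * |deriv V 0|
      gcongr
    · change (q.2.2.2 : ℝ) * supN (iteratedDeriv 2 V) ≤ m * supN (iteratedDeriv 2 V)
      gcongr
  · simp only [growthCoef, growthBound]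
    gcongr; exact hc _
  · simp only [growthCoef, growthBound]
    gcongr; exact hc _

lemma growthShift_mem (m : ℕ) (V : ℝ → ℝ) (i) {q : WIndex} (hq : q ∈ wIndices m)
    (hi : growthCoef m V i q ≠ 0) : growthShift m i q ∈ wIndices m := by
  rw [mem_wIndices] at hq ⊢
  have hch : ∀ j : Fin m, q.2.1.choose (j + 1) ≠ 0 → (j : ℕ) + 1 ≤ q.2.1 := by
    intro j h; by_contra hlt; exact h (Nat.choose_eq_zero_of_lt (by omega))
  rcases i with i | i | i
  · fin_cases i <;> simp only [growthCoef, growthShift, ne_eq, mul_eq_zero, not_or,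
      Nat.cast_eq_zero] at hi ⊢ <;> omega
  · simp only [growthCoef, growthShift, ne_eq, mul_eq_zero, not_or, Nat.cast_eq_zero] at hi ⊢
    have := hch _ hi.1
    omega
  · simp only [growthCoef, growthShift, ne_eq, mul_eq_zero, not_or, Nat.cast_eq_zero] at hi ⊢
    have := hch _ hi.1.1
    omega

lemma growthShift_injOn (m : ℕ) (V : ℝ → ℝ) (i) :
    Set.InjOn (growthShift m i) {q | growthCoef m V i q ≠ 0} := by
  rintro ⟨a, b, α, β⟩ hq ⟨a', b', α', β'⟩ hq' h
  simp only [Set.mem_ofPred_eq] at hq hq'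
  have hch : ∀ (b : ℕ) (j : Fin m), b.choose (j + 1) ≠ 0 → (j : ℕ) + 1 ≤ b := by
    intro b j h; by_contra hlt; exact h (Nat.choose_eq_zero_of_lt (by omega))
  rcases i with i | i | i
  · fin_cases i <;> simp only [growthCoef, growthShift, ne_eq, mul_eq_zero, not_or,
      Nat.cast_eq_zero, Prod.mk.injEq] at hq hq' h ⊢ <;> omega
  · simp only [growthCoef, growthShift, ne_eq, mul_eq_zero, not_or, Nat.cast_eq_zero,
      Prod.mk.injEq] at hq hq' h ⊢
    have := hch _ _ hq.1
    have := hch _ _ hq'.1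
    omega
  · simp only [growthCoef, growthShift, ne_eq, mul_eq_zero, not_or, Nat.cast_eq_zero,
      Prod.mk.injEq] at hq hq' h ⊢
    have := hch _ _ hq.1.1
    have := hch _ _ hq'.1.1
    omega

lemma sum_mul_comp_le {ι : Type*} [DecidableEq ι] (s : Finset ι) {c : ι → ℝ} {φ : ι → ι}
    {n : ι → ℝ} {K : ℝ} (hn : ∀ i, 0 ≤ n i) (hK : 0 ≤ K) (hcK : ∀ i ∈ s, c i ≤ K)
    (hφ : ∀ i ∈ s, c i ≠ 0 → φ i ∈ s) (hinj : Set.InjOn φ {i | c i ≠ 0}) :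
    ∑ i ∈ s, c i * n (φ i) ≤ K * ∑ i ∈ s, n i := by
  classical
  have h1 : ∑ i ∈ s, c i * n (φ i) = ∑ i ∈ s.filter (fun i => c i ≠ 0), c i * n (φ i) := by
    rw [Finset.sum_filter]
    refine Finset.sum_congr rfl fun i _ => ?_
    by_cases h : c i = 0 <;> simp [h]
  rw [h1]
  calc _ ≤ ∑ i ∈ s.filter (fun i => c i ≠ 0), K * n (φ i) :=
        Finset.sum_le_sum fun i hi =>
          mul_le_mul_of_nonneg_right (hcK i (Finset.mem_filter.1 hi).1) (hn _)
    _ = K * ∑ i ∈ (s.filter (fun i => c i ≠ 0)).image φ, n i := by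
        rw [← Finset.mul_sum, Finset.sum_image]
        exact hinj.mono fun i hi => (Finset.mem_filter.1 hi).2
    _ ≤ K * ∑ i ∈ s, n i := by
        refine mul_le_mul_of_nonneg_left (Finset.sum_le_sum_of_subset_of_nonneg ?_
          fun i _ _ => hn i) hK
        intro j hj
        obtain ⟨i, hi, rfl⟩ := Finset.mem_image.1 hj
        exact hφ i (Finset.mem_filter.1 hi).1 (Finset.mem_filter.1 hi).2

/-- The sum of commutator terms in the growth estimate. -/
def growthSum (m : ℕ) (V : ℝ → ℝ) (n : WIndex → ℝ) (q : WIndex) : ℝ :=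
  ∑ i, growthCoef m V i q * n (growthShift m i q)

lemma growthSum_nonneg (m : ℕ) (V : ℝ → ℝ) {n : WIndex → ℝ} (hn : ∀ q, 0 ≤ n q) (q : WIndex) :
    0 ≤ growthSum m V n q :=
  Finset.sum_nonneg fun i _ => mul_nonneg (growthCoef_nonneg m V i q) (hn _)

lemma sum_growthSum_le (m : ℕ) (V : ℝ → ℝ) {n : WIndex → ℝ} (hn : ∀ q, 0 ≤ n q) :
    ∑ q ∈ wIndices m, growthSum m V n q ≤ CmV m V * ∑ q ∈ wIndices m, n q := by
  unfold growthSum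
  rw [Finset.sum_comm, ← sum_growthBound, Finset.sum_mul]
  refine Finset.sum_le_sum fun i _ => sum_mul_comp_le _ hn ?_
    (fun q hq => growthCoef_le m V i hq) (fun q hq => growthShift_mem m V i hq)
    (growthShift_injOn m V i)
  exact (growthCoef_nonneg m V i (0, 0, 0, 0)).trans (growthCoef_le m V i (by simp [mem_wIndices]))

/-- The commutator terms in the weighted semiclassical equation. -/
def growthTerm (V : ℝ → ℝ) (F : SchwartzPlane) (q : WIndex) (x y : ℝ) : ℂ :=
  (q.2.2.1 : ℂ) * opW q.1 (q.2.1 + 1) (q.2.2.1 - 1) q.2.2.2 F (x, y) +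
  (q.1 : ℂ) * opW (q.1 - 1) q.2.1 q.2.2.1 (q.2.2.2 + 1) F (x, y) +
  ((q.1 : ℂ) * q.2.2.1) * opW (q.1 - 1) q.2.1 (q.2.2.1 - 1) q.2.2.2 F (x, y) +
  ((deriv V x : ℝ) : ℂ) * (q.2.2.2 * opW q.1 q.2.1 q.2.2.1 (q.2.2.2 - 1) F (x, y)) +
  ∑ j ∈ Finset.range q.2.1, (q.2.1.choose (j + 1) : ℂ) * ((iteratedDeriv (j + 2) V x : ℝ) : ℂ) *
    (opW q.1 (q.2.1 - (j + 1)) (q.2.2.1 + 1) q.2.2.2 F (x, y) +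
      q.2.2.2 * opW q.1 (q.2.1 - (j + 1)) q.2.2.1 (q.2.2.2 - 1) F (x, y))

lemma wD_scRhs_eq_growthTerm {m : ℕ} {V : ℝ → ℝ} (hV : PotentialBound m V) {f : ℝ → ℝ → ℂ}
    (hf : IsSchwartz2 f) {q : WIndex} (hq : q.2.1 ≤ m) (x y : ℝ) :
    wD q.1 q.2.1 q.2.2.1 q.2.2.2 (scRhs V f) x y =
      Complex.I * (opDx * opDy) (opWq q hf.toSchwartz) (x, y) -
      Complex.I * (((deriv V x * y : ℝ) : ℂ) * opWq q hf.toSchwartz (x, y)) -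
      Complex.I * growthTerm V hf.toSchwartz q x y := by
  obtain ⟨a, b, α, β⟩ := q
  simp only at hq
  rw [wD_scRhs hV hf a hq, opW_mul_opDx_mul_opDy, Finset.sum_range_succ']
  have h1 : opW a b (α + 1) β hf.toSchwartz (x, y) = (y : ℂ) * opW a b α β hf.toSchwartz (x, y) := by
    rw [opW_apply, opW_apply]; ring
  simp only [growthTerm, Nat.choose_zero_right, Nat.sub_zero, h1, LinearMap.sub_apply,
    LinearMap.smul_apply, sub_apply, smul_apply, smul_eq_mul, Module.End.mul_apply, zero_add,
    iteratedDeriv_one]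
  push_cast
  ring

lemma norm_growthTerm_le {m : ℕ} {V : ℝ → ℝ} (hV : PotentialBound m V) (hm : 1 ≤ m)
    (F : SchwartzPlane) {q : WIndex} (hq : q.2.1 ≤ m) (x y : ℝ) :
    ‖growthTerm V F q x y‖ ≤ growthSum m V (fun r => ‖opWq r F (x, y)‖) q := by
  obtain ⟨a, b, α, β⟩ := q
  simp only at hq
  simp only [growthTerm, growthSum, Fintype.sum_sum_type, Fin.sum_univ_five, growthCoef,
    growthShift]
  refine (norm_add_le _ _).trans ?_
  refine add_le_add ?_ ?_
  · refine (norm_add_le _ _).trans ?_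
    refine (add_le_add norm_add₃_le le_rfl).trans ?_
    have h1 : ‖opW (a + 1) b α (β - 1) F (x, y)‖ = |x| * ‖opW a b α (β - 1) F (x, y)‖ := by
      rw [opW_apply, opW_apply, pow_succ]
      simp only [norm_mul, norm_pow, Complex.norm_real, Real.norm_eq_abs]
      ring
    rw [h1]
    have h2 := hV.abs_deriv_le hm x
    simp only [norm_mul, Complex.norm_real, Real.norm_eq_abs, Complex.norm_natCast]
    have h3 : 0 ≤ (β : ℝ) * ‖opW a b α (β - 1) F (x, y)‖ := by positivity
    nlinarith [mul_le_mul_of_nonneg_right h2 h3]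
  · rw [← Finset.sum_add_distrib, Finset.sum_fin_eq_sum_range]
    refine (norm_sum_le _ _).trans ?_
    refine le_trans ?_ (Finset.sum_le_sum_of_subset_of_nonneg (Finset.range_mono hq) ?_)
    · refine Finset.sum_le_sum fun j hj => ?_
      have hj' : j < b := Finset.mem_range.1 hj
      rw [dif_pos (lt_of_lt_of_le hj' hq)]
      have h4 := hV.abs_iteratedDeriv_le (n := j + 2) (by omega) (by omega) x
      rw [norm_mul, norm_mul, Complex.norm_real, Real.norm_eq_abs, Complex.norm_natCast]
      have h5 : ‖opW a (b - (j + 1)) (α + 1) β F (x, y) +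
          β * opW a (b - (j + 1)) α (β - 1) F (x, y)‖ ≤
          ‖opW a (b - (j + 1)) (α + 1) β F (x, y)‖ +
          β * ‖opW a (b - (j + 1)) α (β - 1) F (x, y)‖ := by
        refine (norm_add_le _ _).trans ?_
        simp
      refine (mul_le_mul (mul_le_mul_of_nonneg_left h4 (Nat.cast_nonneg _)) h5 (norm_nonneg _)
        (mul_nonneg (Nat.cast_nonneg _) (maxDeriv_nonneg m V))).trans (le_of_eq ?_)
      ring
    · intro j hj _
      rw [dif_pos (Finset.mem_range.1 hj)]
      have := maxDeriv_nonneg m V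
      positivity

lemma re_conj_mul_wD_scRhs_le {m : ℕ} {V : ℝ → ℝ} (hV : PotentialBound m V) (hm : 1 ≤ m)
    {f : ℝ → ℝ → ℂ} (hf : IsSchwartz2 f) {q : WIndex} (hq : q.2.1 ≤ m) (z : ℝ × ℝ) :
    ((starRingEnd ℂ) (opWq q hf.toSchwartz z) *
      unc (wD q.1 q.2.1 q.2.2.1 q.2.2.2 (scRhs V f)) z).re ≤
    ((starRingEnd ℂ) (opWq q hf.toSchwartz z) *
      (Complex.I * (opDx * opDy) (opWq q hf.toSchwartz) z)).re +
    ∑ i, growthCoef m V i q *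
      (‖opWq q hf.toSchwartz z‖ * ‖opWq (growthShift m i q) hf.toSchwartz z‖) := by
  obtain ⟨x, y⟩ := z
  change (_ * wD q.1 q.2.1 q.2.2.1 q.2.2.2 (scRhs V f) x y).re ≤ _
  rw [wD_scRhs_eq_growthTerm hV hf hq]
  have h := norm_growthTerm_le hV hm hf.toSchwartz hq x y
  set u := opWq q hf.toSchwartz (x, y)
  set D := growthTerm V hf.toSchwartz q x y
  have h1 : ((starRingEnd ℂ) u * (Complex.I * (((deriv V x * y : ℝ) : ℂ) * u))).re = 0 := by
    have : (starRingEnd ℂ) u * (Complex.I * (((deriv V x * y : ℝ) : ℂ) * u)) =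
        Complex.I * (((deriv V x * y : ℝ) : ℂ) * ((starRingEnd ℂ) u * u)) := by ring
    rw [this, ← Complex.normSq_eq_conj_mul_self, ← Complex.ofReal_mul]
    simp
  have h2 : -((starRingEnd ℂ) u * (Complex.I * D)).re ≤ ‖u‖ * ‖D‖ := by
    refine (neg_le_abs _).trans ((Complex.abs_re_le_norm _).trans ?_)
    simp
  have h3 : ‖u‖ * ‖D‖ ≤ _ := mul_le_mul_of_nonneg_left h (norm_nonneg u)
  rw [growthSum, Finset.mul_sum] at h3
  rw [mul_sub, mul_sub, Complex.sub_re, Complex.sub_re, h1]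
  refine le_trans (by linarith) (add_le_add le_rfl (h3.trans (le_of_eq ?_)))
  exact Finset.sum_congr rfl fun i _ => by ring

lemma CmV_nonneg (m : ℕ) (V : ℝ → ℝ) : 0 ≤ CmV m V := by
  have := maxDeriv_nonneg m V
  have := supN_nonneg (iteratedDeriv 2 V)
  rw [CmV, ← maxDeriv]
  positivity

lemma dtR_eq_scRhs {V : ℝ → ℝ} {S : ℝ → ℝ → ℝ → ℂ} (hS : IsSCSol V S) {t : ℝ} (ht : 0 ≤ t) :
    dtR S t = scRhs V (S t) := by
  funext x y
  exact hS.2 t ht x y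

lemma NN_le_exp {m : ℕ} {V : ℝ → ℝ} (hV : PotentialBound m V) (hm : 1 ≤ m)
    {S : ℝ → ℝ → ℝ → ℂ} (hS : IsSCSol V S) {t : ℝ} (ht : 0 ≤ t) :
    NN m (S t) ≤ Real.exp (CmV m V * t) * NN m (S 0) := by
  have hC := hS.1.2.2
  have hsch := hS.1.2.1
  have hC' : ∀ q : WIndex, _ := fun q => hC q.1 q.2.1 q.2.2.1 q.2.2.2
  choose Ψ Ψ' h1 h2 h3 h4 using hC'
  have hn : ∀ q t, 0 ≤ t → ‖Ψ q t‖ = L2 (wD q.1 q.2.1 q.2.2.1 q.2.2.2 (S t)) := by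
    intro q t ht
    rw [Lp.norm_def, L2, eLpNorm_congr_ae (h1 q t ht)]
  have key := sum_norm_le_of_re_inner_deriv_le (wIndices m) (Ψ := Ψ) (Ψ' := Ψ')
    (b := fun q t => growthSum m V (fun r => ‖Ψ r t‖) q) (CmV_nonneg m V)
    (fun q _ t ht => h3 q t ht)
    (fun q _ t _ => growthSum_nonneg m V (fun _ => norm_nonneg _) q)
    (fun q hq t ht => ?_)
    (fun t _ => sum_growthSum_le m V (fun _ => norm_nonneg _)) ht
  · have e : ∀ t, 0 ≤ t → NN m (S t) = ∑ q ∈ wIndices m, ‖Ψ q t‖ := fun t ht =>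
      Finset.sum_congr rfl fun q _ => (hn q t ht).symm
    rw [e t ht, e 0 le_rfl]
    exact key
  · have hf := hsch t ht
    have hqm : q.2.1 ≤ m := by rw [mem_wIndices] at hq; omega
    set F := hf.toSchwartz with hF
    have hn' : ∀ r, ‖Ψ r t‖ = sNorm (opWq r F) := fun r => by rw [hn r t ht, L2_wD hf]
    have hΨ : (Ψ q t : ℝ × ℝ → ℂ) =ᵐ[volume] opWq q F := by
      rw [← wD_eq_opW hf]; exact h1 q t ht
    have hΨ' : (Ψ' q t : ℝ × ℝ → ℂ) =ᵐ[volume]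
        unc (wD q.1 q.2.1 q.2.2.1 q.2.2.2 (scRhs V (S t))) := by
      rw [← dtR_eq_scRhs hS ht]; exact h2 q t ht
    have hi := L2.integrable_inner (𝕜 := ℂ) (Ψ q t) (Ψ' q t)
    rw [L2.inner_def, ← Complex.reCLM_apply, ← ContinuousLinearMap.integral_comp_comm _ hi]
    have hintegr : ∀ i, Integrable (fun z => growthCoef m V i q *
        (‖opWq q F z‖ * ‖opWq (growthShift m i q) F z‖)) volume := fun i =>
      (integrable_norm_mul_norm _ _).const_mul _
    have hint2 : Integrable (fun z => ((starRingEnd ℂ) (opWq q F z) *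
      (Complex.I * (opDx * opDy) (opWq q F) z)).re) volume :=
      (integrable_conj_mul ((opWq q F).memLp 2 volume)
        ((Complex.I • (opDx * opDy) (opWq q F)).memLp 2 volume)).re
    calc ∫ z, Complex.reCLM (inner ℂ (Ψ q t z) (Ψ' q t z))
        ≤ ∫ z, (((starRingEnd ℂ) (opWq q F z) * (Complex.I * (opDx * opDy) (opWq q F) z)).re +
          ∑ i, growthCoef m V i q * (‖opWq q F z‖ * ‖opWq (growthShift m i q) F z‖)) := by
          refine integral_mono_ae (Complex.reCLM.integrable_comp hi)
            (hint2.add (integrable_finsetSum _ fun i _ => hintegr i)) ?_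
          filter_upwards [hΨ, hΨ'] with z hz hz'
          rw [hz, hz', Complex.reCLM_apply, RCLike.inner_apply, mul_comm]
          exact re_conj_mul_wD_scRhs_le hV hm hf hqm z
      _ = ∑ i, growthCoef m V i q * ∫ z, (‖opWq q F z‖ * ‖opWq (growthShift m i q) F z‖) := by
          rw [integral_add hint2 (integrable_finsetSum _ fun i _ => hintegr i),
            integral_re_conj_mul_opDx_opDy, zero_add, integral_finsetSum _ fun i _ => hintegr i]
          exact Finset.sum_congr rfl fun i _ => integral_const_mul _ _
      _ ≤ ∑ i, growthCoef m V i q * (‖Ψ q t‖ * ‖Ψ (growthShift m i q) t‖) := by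
          refine Finset.sum_le_sum fun i _ =>
            mul_le_mul_of_nonneg_left ?_ (growthCoef_nonneg m V i q)
          rw [hn', hn']
          exact integral_norm_mul_norm_le _ _
      _ = ‖Ψ q t‖ * growthSum m V (fun r => ‖Ψ r t‖) q := by
          rw [growthSum, Finset.mul_sum]
          exact Finset.sum_congr rfl fun i _ => by ring

lemma antilipschitzWith_prodMk_left (x : ℝ) : AntilipschitzWith 1 (fun y : ℝ => (x, y)) :=
  AntilipschitzWith.of_le_mul_dist fun y y' => by simp [Prod.dist_eq]

lemma hasTemperateGrowth_prodMk_left (x : ℝ) :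
    (fun y : ℝ => (x, y)).HasTemperateGrowth := by
  have h : (fun y : ℝ => (x, y)) =
      fun y => ((x, 0) : ℝ × ℝ) + ContinuousLinearMap.inr ℝ ℝ ℝ y := by
    funext y; simp
  rw [h]
  exact (Function.HasTemperateGrowth.const _).add
    (ContinuousLinearMap.inr ℝ ℝ ℝ).hasTemperateGrowth

/-- The slice `y ↦ F (x, y)` of a Schwartz function. -/
def ySlice (F : SchwartzPlane) (x : ℝ) : SchwartzMap ℝ ℂ :=
  SchwartzMap.compCLMOfAntilipschitz ℂ (hasTemperateGrowth_prodMk_left x)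
    (antilipschitzWith_prodMk_left x) F

lemma memLp_ySlice (F : SchwartzPlane) (x : ℝ) : MemLp (fun y => F (x, y)) 2 volume :=
  (ySlice F x).memLp 2 volume

lemma integrable_ySlice_mul_Φh (F : SchwartzPlane) (k : ℕ) (x : ℝ) :
    Integrable (fun y => F (x, y) * ((Φh k y : ℝ) : ℂ)) volume :=
  (memLp_ySlice F x).integrable_mul (memLp_ofReal_Φh k)

/-- The `k`-th Hermite coefficient in `y` of a Schwartz function of `(x, y)`. -/
def cf (k : ℕ) (F : SchwartzPlane) (x : ℝ) : ℂ := hcoef k fun y => F (x, y)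

lemma exists_norm_le_one_add_abs_snd (F : SchwartzPlane) :
    ∃ C : ℝ, ∀ x y, ‖F (x, y)‖ ≤ C * (1 + ‖y‖) ^ (-(2 : ℝ)) := by
  refine ⟨2 ^ 2 * ((Finset.Iic (2, 0)).sup fun m => SchwartzMap.seminorm ℝ m.1 m.2) F,
    fun x y => ?_⟩
  have h := SchwartzMap.one_add_le_sup_seminorm_apply (𝕜 := ℝ) (m := (2, 0)) (k := 2) (n := 0)
    le_rfl le_rfl F (x, y)
  rw [norm_iteratedFDeriv_zero] at h
  have h1 : (0 : ℝ) < (1 + ‖y‖) ^ 2 := by positivity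
  have h2 : (1 + ‖y‖) ^ (-(2 : ℝ)) = ((1 + ‖y‖) ^ 2)⁻¹ := by
    rw [Real.rpow_neg (by positivity)]; norm_cast
  rw [h2, ← div_eq_mul_inv, le_div_iff₀ h1, mul_comm]
  refine le_trans ?_ h
  have h3 : ‖y‖ ≤ ‖(x, y)‖ := le_max_right _ _
  gcongr

lemma hasDerivAt_cf (k : ℕ) (F : SchwartzPlane) (x : ℝ) :
    HasDerivAt (cf k F) (cf k (opDx F) x) x := by
  obtain ⟨C, hC⟩ := exists_norm_le_one_add_abs_snd (opDx F)
  obtain ⟨D, hD0, hD⟩ := Φh_bounded k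
  have hb : Integrable (fun y : ℝ => C * (1 + ‖y‖) ^ (-(2 : ℝ)) * D) volume :=
    ((integrable_one_add_norm (by simp)).const_mul C).mul_const D
  refine (hasDerivAt_integral_of_dominated_loc_of_deriv_le (s := Set.univ) Filter.univ_mem
    (F := fun x y => F (x, y) * ((Φh k y : ℝ) : ℂ))
    (F' := fun x y => opDx F (x, y) * ((Φh k y : ℝ) : ℂ))
    (Filter.Eventually.of_forall fun x => (integrable_ySlice_mul_Φh F k x).aestronglyMeasurable)
    (integrable_ySlice_mul_Φh F k x)
    (integrable_ySlice_mul_Φh (opDx F) k x).aestronglyMeasurable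
    (Filter.Eventually.of_forall fun y x _ => ?_) hb
    (Filter.Eventually.of_forall fun y x _ => (hasDerivAt_fst_slice F x y).mul_const _)).2
  rw [norm_mul, Complex.norm_real]
  exact mul_le_mul (hC x y) (hD y) (norm_nonneg _) ((norm_nonneg _).trans (hC x y))

lemma differentiable_cf (k : ℕ) (F : SchwartzPlane) : Differentiable ℝ (cf k F) :=
  fun x => (hasDerivAt_cf k F x).differentiableAt

lemma deriv_cf (k : ℕ) (F : SchwartzPlane) : deriv (cf k F) = cf k (opDx F) :=
  funext fun x => (hasDerivAt_cf k F x).deriv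

lemma continuous_cf (k : ℕ) (F : SchwartzPlane) : Continuous (cf k F) :=
  (differentiable_cf k F).continuous

lemma cf_add (k : ℕ) (F G : SchwartzPlane) (x : ℝ) : cf k (F + G) x = cf k F x + cf k G x := by
  simp only [cf, hcoef, add_apply, add_mul]
  exact integral_add (integrable_ySlice_mul_Φh F k x) (integrable_ySlice_mul_Φh G k x)

lemma cf_smul (k : ℕ) (c : ℂ) (F : SchwartzPlane) (x : ℝ) : cf k (c • F) x = c * cf k F x := by
  simp only [cf, hcoef, smul_apply, smul_eq_mul, mul_assoc]
  exact integral_const_mul _ _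

lemma cf_sub (k : ℕ) (F G : SchwartzPlane) (x : ℝ) : cf k (F - G) x = cf k F x - cf k G x := by
  rw [sub_eq_add_neg, cf_add, ← neg_one_smul ℂ G, cf_smul]; ring

lemma cf_opX (k : ℕ) (F : SchwartzPlane) (x : ℝ) : cf k (opX F) x = x * cf k F x := by
  simp only [cf, hcoef, opX_apply, mul_assoc]
  exact integral_const_mul _ _

lemma sqrt_div_two_mul_two {a : ℝ} : Real.sqrt (2 * a) = 2 * Real.sqrt (a / 2) := by
  rw [show 2 * a = 2 ^ 2 * (a / 2) by ring, Real.sqrt_mul (by norm_num), Real.sqrt_sq (by norm_num)]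

lemma mul_Φh (k : ℕ) (y : ℝ) : y * Φh k y =
    Real.sqrt ((k : ℝ) / 2) * Φh (k - 1) y + Real.sqrt (((k : ℝ) + 1) / 2) * Φh (k + 1) y := by
  cases k with
  | zero =>
    have h := mul_Φh_zero y
    have h2 : Real.sqrt 2 = 2 * Real.sqrt (1 / 2) := by
      rw [← sqrt_div_two_mul_two]; norm_num
    rw [h2] at h
    simp only [Nat.cast_zero, zero_div, Real.sqrt_zero, zero_mul, zero_add]
    linarith
  | succ k =>
    have h := mul_Φh_succ k y
    rw [sqrt_div_two_mul_two, sqrt_div_two_mul_two] at h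
    simp only [Nat.add_sub_cancel]
    push_cast
    rw [show (k : ℝ) + 1 + 1 = k + 2 by ring]
    linarith

lemma deriv_Φh (k : ℕ) (y : ℝ) : deriv (Φh k) y =
    Real.sqrt ((k : ℝ) / 2) * Φh (k - 1) y - Real.sqrt (((k : ℝ) + 1) / 2) * Φh (k + 1) y := by
  have h1 := (hasDerivAt_Φh k y).deriv
  have h2 := mul_Φh k y
  rw [sqrt_div_two_mul_two] at h1
  rw [h1]
  linarith

lemma cf_eq_of_Φh {F : SchwartzPlane} {k : ℕ} {x : ℝ} {φ : ℝ → ℝ} {c d : ℝ}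
    (h : ∀ y, φ y = c * Φh (k - 1) y + d * Φh (k + 1) y) :
    ∫ y, F (x, y) * ((φ y : ℝ) : ℂ) = c * cf (k - 1) F x + d * cf (k + 1) F x := by
  simp only [cf, hcoef]
  rw [← integral_const_mul, ← integral_const_mul,
    ← integral_add ((integrable_ySlice_mul_Φh F _ x).const_mul _)
      ((integrable_ySlice_mul_Φh F _ x).const_mul _)]
  refine integral_congr_ae (Filter.Eventually.of_forall fun y => ?_)
  simp only [h]
  push_cast
  ring

lemma cf_opY (k : ℕ) (F : SchwartzPlane) (x : ℝ) : cf k (opY F) x =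
    (Real.sqrt ((k : ℝ) / 2) : ℂ) * cf (k - 1) F x +
      (Real.sqrt (((k : ℝ) + 1) / 2) : ℂ) * cf (k + 1) F x := by
  rw [← cf_eq_of_Φh (mul_Φh k)]
  simp only [cf, hcoef, opY_apply]
  refine integral_congr_ae (Filter.Eventually.of_forall fun y => ?_)
  push_cast
  ring

lemma cf_opDy (k : ℕ) (F : SchwartzPlane) (x : ℝ) : cf k (opDy F) x =
    -(Real.sqrt ((k : ℝ) / 2) : ℂ) * cf (k - 1) F x +
      (Real.sqrt (((k : ℝ) + 1) / 2) : ℂ) * cf (k + 1) F x := by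
  have h := cf_eq_of_Φh (F := F) (x := x) (k := k) (φ := deriv (Φh k))
    (c := Real.sqrt ((k : ℝ) / 2)) (d := -Real.sqrt (((k : ℝ) + 1) / 2))
    (fun y => by rw [deriv_Φh]; ring)
  have hintegr : Integrable (fun y => F (x, y) * ((deriv (Φh k) y : ℝ) : ℂ)) volume := by
    have : (fun y => F (x, y) * ((deriv (Φh k) y : ℝ) : ℂ)) = fun y =>
        (Real.sqrt ((k : ℝ) / 2) : ℂ) * (F (x, y) * ((Φh (k - 1) y : ℝ) : ℂ)) -
        (Real.sqrt (((k : ℝ) + 1) / 2) : ℂ) * (F (x, y) * ((Φh (k + 1) y : ℝ) : ℂ)) := by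
      funext y
      rw [deriv_Φh]; push_cast; ring
    rw [this]
    exact ((integrable_ySlice_mul_Φh F _ x).const_mul _).sub
      ((integrable_ySlice_mul_Φh F _ x).const_mul _)
  have h2 := integral_mul_deriv_eq_deriv_mul_of_integrable
    (u := fun y => F (x, y)) (v := fun y => ((Φh k y : ℝ) : ℂ))
    (fun y _ => hasDerivAt_snd_slice F x y)
    (fun y _ => ((differentiable_Φh k y).hasDerivAt).ofReal_comp)
    hintegr (integrable_ySlice_mul_Φh (opDy F) k x) (integrable_ySlice_mul_Φh F k x)
  rw [h] at h2
  rw [cf, hcoef, ← neg_eq_iff_eq_neg.2 h2]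
  push_cast
  ring

/-- The creation-type operator `y - ∂_y`. -/
def opB : Module.End ℂ SchwartzPlane := opY - opDy

lemma cf_succ_opB (k : ℕ) (F : SchwartzPlane) (x : ℝ) :
    cf (k + 1) (opB F) x = (Real.sqrt (2 * ((k : ℝ) + 1)) : ℂ) * cf k F x := by
  rw [opB, LinearMap.sub_apply, cf_sub, cf_opY, cf_opDy, sqrt_div_two_mul_two]
  push_cast
  ring

lemma tsum_lintegral_enorm_cf (F : SchwartzPlane) :
    ∑' k, ∫⁻ x, ‖cf k F x‖ₑ ^ 2 = ∫⁻ z, ‖F z‖ₑ ^ 2 := by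
  rw [← lintegral_tsum fun k => ((continuous_cf k F).measurable.enorm.pow_const 2).aemeasurable]
  have h : ∀ x, ∑' k, ‖cf k F x‖ₑ ^ 2 = ∫⁻ y, ‖F (x, y)‖ₑ ^ 2 :=
    fun x => enorm_sq_hcoef (memLp_ySlice F x)
  simp_rw [h]
  exact (lintegral_prod _ (F.continuous.measurable.enorm.pow_const 2).aemeasurable).symm

lemma eLpNorm_two_sq {α : Type*} [MeasurableSpace α] {μ : Measure α} (f : α → ℂ) :
    eLpNorm f 2 μ ^ 2 = ∫⁻ x, ‖f x‖ₑ ^ 2 ∂μ := by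
  rw [eLpNorm_eq_lintegral_rpow_enorm_toReal (by norm_num) (by norm_num),
    ← ENNReal.rpow_natCast, ← ENNReal.rpow_mul]
  simp

lemma tsum_eLpNorm_cf_sq (F : SchwartzPlane) :
    ∑' k, eLpNorm (cf k F) 2 volume ^ 2 = eLpNorm F 2 volume ^ 2 := by
  simp_rw [eLpNorm_two_sq, tsum_lintegral_enorm_cf]

lemma eLpNorm_cf_le (k : ℕ) (F : SchwartzPlane) :
    eLpNorm (cf k F) 2 volume ^ 2 ≤ eLpNorm F 2 volume ^ 2 := by
  rw [← tsum_eLpNorm_cf_sq]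
  exact ENNReal.le_tsum (f := fun k => eLpNorm (cf k F) 2 volume ^ 2) k

lemma memLp_cf (k : ℕ) (F : SchwartzPlane) : MemLp (cf k F) 2 volume := by
  refine ⟨(continuous_cf k F).aestronglyMeasurable, ?_⟩
  have h := eLpNorm_cf_le k F
  have h2 := (F.memLp 2 volume).2
  refine lt_of_le_of_lt ?_ h2
  exact (ENNReal.pow_right_strictMono two_ne_zero).le_iff_le.1 h

lemma sum_L2one_cf_sq_le (F : SchwartzPlane) (n : ℕ) :
    ∑ k ∈ Finset.range n, L2one (cf k F) ^ 2 ≤ sNorm F ^ 2 := by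
  have h : ∑ k ∈ Finset.range n, eLpNorm (cf k F) 2 volume ^ 2 ≤ eLpNorm F 2 volume ^ 2 := by
    rw [← tsum_eLpNorm_cf_sq]
    exact ENNReal.sum_le_tsum _
  have h2 := ENNReal.toReal_mono (ENNReal.pow_ne_top (F.memLp 2 volume).2.ne) h
  rw [ENNReal.toReal_sum fun k _ => ENNReal.pow_ne_top (memLp_cf k F).2.ne] at h2
  simp only [ENNReal.toReal_pow, ← sNorm_eq] at h2
  exact h2

lemma L2one_const_mul (c : ℂ) (u : ℝ → ℂ) : L2one (fun x => c * u x) = ‖c‖ * L2one u := by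
  have := eLpNorm_const_smul c u 2 (volume : Measure ℝ)
  simp only [L2one]
  rw [show (fun x => c * u x) = c • u from rfl, this, ENNReal.toReal_mul, toReal_enorm]

lemma L2one_cf_succ_opB (k : ℕ) (F : SchwartzPlane) :
    L2one (cf (k + 1) (opB F)) ^ 2 = 2 * ((k : ℝ) + 1) * L2one (cf k F) ^ 2 := by
  rw [funext fun x => cf_succ_opB k F x, L2one_const_mul, mul_pow, Complex.norm_real,
    Real.norm_eq_abs, sq_abs, Real.sq_sqrt (by positivity)]

lemma sum_pow_mul_L2one_cf_le (m : ℕ) (F : SchwartzPlane) (n : ℕ) :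
    ∑ k ∈ Finset.range n, ((k : ℝ) + 1) ^ m * L2one (cf k F) ^ 2 ≤ sNorm ((opB ^ m) F) ^ 2 := by
  induction m generalizing F n with
  | zero => simpa using sum_L2one_cf_sq_le F n
  | succ m ih =>
    have h := ih (opB F) (n + 1)
    rw [← Module.End.mul_apply, ← pow_succ, Finset.sum_range_succ'] at h
    refine le_trans ?_ ((le_add_of_nonneg_right (by positivity)).trans h)
    refine Finset.sum_le_sum fun k _ => ?_
    rw [L2one_cf_succ_opB]
    have h1 : ((k : ℝ) + 1) ^ m ≤ (((k + 1 : ℕ) : ℝ) + 1) ^ m := by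
      push_cast; gcongr; linarith
    have h2 : 0 ≤ ((k : ℝ) + 1) * L2one (cf k F) ^ 2 := by positivity
    rw [pow_succ]
    nlinarith [mul_le_mul_of_nonneg_right h1 h2, mul_nonneg (by positivity : 0 ≤ ((k : ℝ) + 1) ^ m) h2]

lemma sNorm_smul (c : ℂ) (F : SchwartzPlane) : sNorm (c • F) = ‖c‖ * sNorm F := by
  have h := map_smul (SchwartzMap.toLpCLM ℂ ℂ 2 (volume : Measure (ℝ × ℝ))) c F
  rw [sNorm, ← SchwartzMap.toLpCLM_apply (𝕜 := ℂ), h, norm_smul]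
  rfl

lemma sNorm_sub_le (F G : SchwartzPlane) : sNorm (F - G) ≤ sNorm F + sNorm G := by
  have h := map_sub (SchwartzMap.toLpCLM ℂ ℂ 2 (volume : Measure (ℝ × ℝ))) F G
  rw [sNorm, ← SchwartzMap.toLpCLM_apply (𝕜 := ℂ), h]
  exact norm_sub_le _ _

lemma opB_mul_opW (a b α β : ℕ) : opB * opW a b α β =
    opW a b (α + 1) β - opW a b α (β + 1) - (α : ℂ) • opW a b (α - 1) β := by
  have h1 : opY * opW a b α β = opW a b (α + 1) β := by
    have h3 : opY * (opX ^ a * opY ^ α) = opX ^ a * opY ^ (α + 1) := by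
      rw [← mul_assoc, ← (commute_opX_opY.pow_left a).eq, mul_assoc, ← pow_succ']
    rw [opW, ← mul_assoc, h3]
    rfl
  have h2 : opDy * opW a b α β = opW a b α (β + 1) + (α : ℂ) • opW a b (α - 1) β := by
    have h3 : opDy * (opX ^ a * opY ^ α) =
        opX ^ a * opY ^ α * opDy + (α : ℂ) • (opX ^ a * opY ^ (α - 1)) := by
      rw [← mul_assoc, ← (commute_opX_opDy.pow_left a).eq, mul_assoc, opDy_mul_opY_pow, mul_add,
        mul_smul_comm, mul_assoc]
    have h4 : opDy * (opDx ^ b * opDy ^ β) = opDx ^ b * opDy ^ (β + 1) := by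
      rw [← mul_assoc, ← (commute_opDx_opDy.pow_left b).eq, mul_assoc, ← pow_succ']
    rw [opW, ← mul_assoc, h3, add_mul, smul_mul_assoc, mul_assoc (opX ^ a * opY ^ α), h4]
    rfl
  rw [opB, sub_mul, h1, h2]
  abel

lemma wIndices_mono {m n : ℕ} (h : m ≤ n) : wIndices m ⊆ wIndices n := by
  intro q hq
  rw [mem_wIndices] at hq ⊢
  omega

/-- The weighted Sobolev functional on Schwartz functions. -/
def wNorm (m : ℕ) (F : SchwartzPlane) : ℝ := ∑ q ∈ wIndices m, sNorm (opWq q F)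

lemma wNorm_nonneg (m : ℕ) (F : SchwartzPlane) : 0 ≤ wNorm m F :=
  Finset.sum_nonneg fun _ _ => sNorm_nonneg _

lemma wNorm_mono {m n : ℕ} (h : m ≤ n) (F : SchwartzPlane) : wNorm m F ≤ wNorm n F :=
  Finset.sum_le_sum_of_subset_of_nonneg (wIndices_mono h) fun _ _ _ => sNorm_nonneg _

lemma sNorm_opB_pow_opW_le (m : ℕ) : ∀ a b α β : ℕ, ∃ K : ℝ, 0 ≤ K ∧ ∀ F : SchwartzPlane,
    sNorm ((opB ^ m * opW a b α β) F) ≤ K * wNorm (m + (a + b + α + β)) F := by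
  induction m with
  | zero =>
    intro a b α β
    refine ⟨1, zero_le_one, fun F => ?_⟩
    have hq : ((a, b, α, β) : WIndex) ∈ wIndices (0 + (a + b + α + β)) := by
      rw [mem_wIndices]; dsimp only; omega
    have h := Finset.single_le_sum (f := fun q => sNorm (opWq q F)) (fun _ _ => sNorm_nonneg _) hq
    rw [pow_zero, one_mul, one_mul]
    exact h
  | succ m ih =>
    intro a b α β
    obtain ⟨K₁, h₁, H₁⟩ := ih a b (α + 1) β
    obtain ⟨K₂, h₂, H₂⟩ := ih a b α (β + 1)
    obtain ⟨K₃, h₃, H₃⟩ := ih a b (α - 1) β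
    refine ⟨K₁ + K₂ + α * K₃, by positivity, fun F => ?_⟩
    rw [pow_succ, mul_assoc, opB_mul_opW, mul_sub, mul_sub, mul_smul_comm, LinearMap.sub_apply,
      LinearMap.sub_apply, LinearMap.smul_apply]
    refine (sNorm_sub_le _ _).trans ?_
    have e1 := (H₁ F).trans (mul_le_mul_of_nonneg_left (wNorm_mono (n := m + 1 + (a + b + α + β))
      (by omega) F) h₁)
    have e2 := (H₂ F).trans (mul_le_mul_of_nonneg_left (wNorm_mono (n := m + 1 + (a + b + α + β))
      (by omega) F) h₂)
    have e3 := (H₃ F).trans (mul_le_mul_of_nonneg_left (wNorm_mono (n := m + 1 + (a + b + α + β))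
      (by omega) F) h₃)
    have e4 := sNorm_sub_le ((opB ^ m * opW a b (α + 1) β) F) ((opB ^ m * opW a b α (β + 1)) F)
    rw [sNorm_smul, Complex.norm_natCast]
    have e5 := mul_le_mul_of_nonneg_left e3 (Nat.cast_nonneg (α := ℝ) α)
    linarith

lemma exists_sum_pow_mul_L2one_cf_le (m a b : ℕ) : ∃ K : ℝ, 0 ≤ K ∧ ∀ (F : SchwartzPlane) (n : ℕ),
    ∑ k ∈ Finset.range n, ((k : ℝ) + 1) ^ m * L2one (cf k (opW a b 0 0 F)) ^ 2 ≤
      K * wNorm (m + (a + b)) F ^ 2 := by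
  obtain ⟨K, hK, h⟩ := sNorm_opB_pow_opW_le m a b 0 0
  refine ⟨K ^ 2, by positivity, fun F n => (sum_pow_mul_L2one_cf_le m _ n).trans ?_⟩
  rw [← mul_pow]
  exact pow_le_pow_left₀ (sNorm_nonneg _) (h F) 2

/-- The space `L²(ℝ²;ℂ)`. -/
abbrev L2Plane := Lp ℂ 2 (volume : Measure (ℝ × ℝ))

/-- The space `L²(ℝ;ℂ)`. -/
abbrev L2Line := Lp ℂ 2 (volume : Measure ℝ)

lemma memLp_two_of_lintegral_lt_top {g : ℝ → ℂ} (hg : AEStronglyMeasurable g volume)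
    (h : ∫⁻ y, ‖g y‖ₑ ^ 2 < ⊤) : MemLp g 2 volume := by
  refine ⟨hg, ?_⟩
  rw [← eLpNorm_two_sq] at h
  exact (ENNReal.pow_lt_top_iff.1 h).resolve_right two_ne_zero

lemma enorm_hcoef_sq_le (k : ℕ) {g : ℝ → ℂ} (hg : AEStronglyMeasurable g volume) :
    ‖hcoef k g‖ₑ ^ 2 ≤ ∫⁻ y, ‖g y‖ₑ ^ 2 := by
  by_cases h : ∫⁻ y, ‖g y‖ₑ ^ 2 = ⊤
  · rw [h]; exact le_top
  · rw [← enorm_sq_hcoef (memLp_two_of_lintegral_lt_top hg (lt_top_iff_ne_top.2 h))]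
    exact ENNReal.le_tsum (f := fun k => ‖hcoef k g‖ₑ ^ 2) k

lemma ae_memLp_slice {f : ℝ × ℝ → ℂ} (hf : MemLp f 2 volume) :
    ∀ᵐ x : ℝ, MemLp (fun y => f (x, y)) 2 volume := by
  have h1 : ∀ᵐ x : ℝ, AEStronglyMeasurable (fun y => f (x, y)) volume :=
    hf.1.prodMk_left
  have h2 : ∫⁻ x, ∫⁻ y, ‖f (x, y)‖ₑ ^ 2 < ⊤ := by
    rw [← lintegral_prod (fun z => ‖f z‖ₑ ^ 2) (hf.1.enorm.pow_const 2)]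
    change ∫⁻ z, ‖f z‖ₑ ^ 2 < ⊤
    rw [← eLpNorm_two_sq]
    exact ENNReal.pow_lt_top hf.2
  filter_upwards [h1, ae_lt_top' (hf.1.enorm.pow_const 2).lintegral_prod_right' h2.ne]
    with x hx hx'
  exact memLp_two_of_lintegral_lt_top hx hx'

lemma aestronglyMeasurable_hcoef_slice (k : ℕ) {f : ℝ × ℝ → ℂ}
    (hf : AEStronglyMeasurable f volume) :
    AEStronglyMeasurable (fun x => hcoef k fun y => f (x, y)) volume := by
  have h : AEStronglyMeasurable (fun z : ℝ × ℝ => f z * ((Φh k z.2 : ℝ) : ℂ))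
      ((volume : Measure ℝ).prod volume) :=
    hf.mul (Complex.continuous_ofReal.comp
      ((continuous_Φh k).comp continuous_snd)).aestronglyMeasurable
  exact h.integral_prod_right'

lemma eLpNorm_hcoef_slice_le (k : ℕ) {f : ℝ × ℝ → ℂ} (hf : MemLp f 2 volume) :
    eLpNorm (fun x => hcoef k fun y => f (x, y)) 2 volume ≤ eLpNorm f 2 volume := by
  refine (ENNReal.pow_right_strictMono two_ne_zero).le_iff_le.1 ?_
  simp only [eLpNorm_two_sq]
  calc ∫⁻ x, ‖hcoef k fun y => f (x, y)‖ₑ ^ 2 ≤ ∫⁻ x, ∫⁻ y, ‖f (x, y)‖ₑ ^ 2 := by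
        refine lintegral_mono_ae ?_
        filter_upwards [ae_memLp_slice hf] with x hx
        exact enorm_hcoef_sq_le k hx.1
    _ = _ := (lintegral_prod (fun z => ‖f z‖ₑ ^ 2) (hf.1.enorm.pow_const 2)).symm

lemma memLp_hcoef_slice (k : ℕ) {f : ℝ × ℝ → ℂ} (hf : MemLp f 2 volume) :
    MemLp (fun x => hcoef k fun y => f (x, y)) 2 volume :=
  ⟨aestronglyMeasurable_hcoef_slice k hf.1, (eLpNorm_hcoef_slice_le k hf).trans_lt hf.2⟩

lemma hcoef_slice_congr (k : ℕ) {f g : ℝ × ℝ → ℂ} (h : f =ᵐ[volume] g) :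
    (fun x => hcoef k fun y => f (x, y)) =ᵐ[volume] fun x => hcoef k fun y => g (x, y) := by
  have h1 : ∀ᵐ x : ℝ, ∀ᵐ y : ℝ, f (x, y) = g (x, y) := Measure.ae_ae_of_ae_prod h
  filter_upwards [h1] with x hx
  refine integral_congr_ae ?_
  filter_upwards [hx] with y hy
  rw [hy]

/-- The `k`-th Hermite coefficient in `y` as a bounded operator `L²(ℝ²) → L²(ℝ)`. -/
def coefCLM (k : ℕ) : L2Plane →L[ℂ] L2Line :=
  LinearMap.mkContinuous
    { toFun := fun Ψ => (memLp_hcoef_slice k (Lp.memLp Ψ)).toLp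
      map_add' := by
        intro Ψ Ψ'
        rw [← MemLp.toLp_add, MemLp.toLp_eq_toLp_iff]
        refine (hcoef_slice_congr k (Lp.coeFn_add Ψ Ψ')).trans ?_
        filter_upwards [ae_memLp_slice (Lp.memLp Ψ), ae_memLp_slice (Lp.memLp Ψ')] with x h1 h2
        simp only [hcoef, Pi.add_apply, add_mul]
        exact integral_add (h1.integrable_mul (memLp_ofReal_Φh k))
          (h2.integrable_mul (memLp_ofReal_Φh k))
      map_smul' := by
        intro c Ψ
        rw [RingHom.id_apply, ← MemLp.toLp_const_smul, MemLp.toLp_eq_toLp_iff]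
        refine (hcoef_slice_congr k (Lp.coeFn_smul c Ψ)).trans ?_
        refine Filter.Eventually.of_forall fun x => ?_
        simp only [hcoef, Pi.smul_apply, smul_eq_mul, mul_assoc]
        exact integral_const_mul _ _ } 1 <| by
    intro Ψ
    change ‖(memLp_hcoef_slice k (Lp.memLp Ψ)).toLp‖ ≤ _
    rw [one_mul, Lp.norm_toLp, Lp.norm_def]
    exact ENNReal.toReal_mono (Lp.memLp Ψ).2.ne (eLpNorm_hcoef_slice_le k (Lp.memLp Ψ))

lemma coeFn_coefCLM (k : ℕ) {Ψ : L2Plane} {f : ℝ × ℝ → ℂ} (h : (Ψ : ℝ × ℝ → ℂ) =ᵐ[volume] f) :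
    (coefCLM k Ψ : ℝ → ℂ) =ᵐ[volume] fun x => hcoef k fun y => f (x, y) :=
  (memLp_hcoef_slice k (Lp.memLp Ψ)).coeFn_toLp.trans (hcoef_slice_congr k h)

lemma hcoef_scRhs (V : ℝ → ℝ) {f : ℝ → ℝ → ℂ} (hf : IsSchwartz2 f) (k : ℕ) (x : ℝ) :
    (hcoef k fun y => scRhs V f x y) =
      -Complex.I * ((Real.sqrt ((k : ℝ) / 2) : ℂ) * Dop V (cf (k - 1) hf.toSchwartz) x +
        (Real.sqrt (((k : ℝ) + 1) / 2) : ℂ) * Dstar V (cf (k + 1) hf.toSchwartz) x) := by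
  set F := hf.toSchwartz with hF
  have h1 : ∀ y, scRhs V f x y =
      (Complex.I • opDy (opDx F) - (Complex.I * ((deriv V x : ℝ) : ℂ)) • opY F) (x, y) := by
    intro y
    have h := pd2_eq_op 1 1 F x y
    rw [pow_one, pow_one, commute_opDx_opDy.eq] at h
    have h2 : pd2 1 1 f x y = opDy (opDx F) (x, y) := h
    rw [scRhs, h2]
    simp only [sub_apply, smul_apply, smul_eq_mul, opY_apply]
    have h3 : F (x, y) = f x y := rfl
    rw [h3]
    push_cast
    ring
  have h2 : (hcoef k fun y => scRhs V f x y) =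
      cf k (Complex.I • opDy (opDx F) - (Complex.I * ((deriv V x : ℝ) : ℂ)) • opY F) x := by
    rw [cf]; congr 1; funext y; exact h1 y
  rw [h2, cf_sub, cf_smul, cf_smul, cf_opDy, cf_opY, Dop, Dstar, deriv_cf, deriv_cf]
  ring

/-- Regularity and decay needed to integrate by parts against first-order operators with a
linearly growing coefficient. -/
structure WeightedH1 (u : ℝ → ℂ) : Prop where
  diff : Differentiable ℝ u
  memLp : MemLp u 2 volume
  memLp_deriv : MemLp (deriv u) 2 volume
  memLp_mul : MemLp (fun x : ℝ => (x : ℂ) * u x) 2 volume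

lemma weightedH1_cf (k : ℕ) (F : SchwartzPlane) : WeightedH1 (cf k F) where
  diff := differentiable_cf k F
  memLp := memLp_cf k F
  memLp_deriv := by rw [deriv_cf]; exact memLp_cf k _
  memLp_mul := by
    simp_rw [← cf_opX]
    exact memLp_cf k _

/-- A function satisfying `IsSchwartz1` as a bundled Schwartz map. -/
def IsSchwartz1.toSchwartz {f : ℝ → ℂ} (hf : IsSchwartz1 f) : SchwartzMap ℝ ℂ where
  toFun := f
  smooth' := hf.1
  decay' k n := by
    obtain ⟨C, hC⟩ := hf.2 k n
    refine ⟨C, fun x => ?_⟩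
    rw [norm_iteratedFDeriv_eq_norm_iteratedDeriv]
    exact hC x

namespace WeightedH1

lemma of_schwartz (f : SchwartzMap ℝ ℂ) : WeightedH1 f where
  diff := f.differentiable
  memLp := f.memLp 2 volume
  memLp_deriv := (SchwartzMap.derivCLM ℂ ℂ f).memLp 2 volume
  memLp_mul := by
    have h : (fun x : ℝ => (x : ℂ) * f x) =
        SchwartzMap.smulLeftCLM ℂ (fun x : ℝ => (x : ℂ)) f := by
      funext x
      rw [SchwartzMap.smulLeftCLM_apply_apply (by fun_prop), smul_eq_mul]
    rw [h]
    exact SchwartzMap.memLp _ 2 volume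

lemma of_isSchwartz1 {f : ℝ → ℂ} (hf : IsSchwartz1 f) : WeightedH1 f := of_schwartz hf.toSchwartz

lemma const_mul {u : ℝ → ℂ} (hu : WeightedH1 u) (c : ℂ) : WeightedH1 fun x => c * u x where
  diff := hu.diff.const_mul c
  memLp := hu.memLp.const_mul c
  memLp_deriv := by
    have h : deriv (fun x => c * u x) = fun x => c * deriv u x :=
      funext fun x => deriv_const_mul c (hu.diff x)
    rw [h]
    exact hu.memLp_deriv.const_mul c
  memLp_mul := by
    simp_rw [mul_left_comm _ c]
    exact hu.memLp_mul.const_mul c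

lemma sub {u v : ℝ → ℂ} (hu : WeightedH1 u) (hv : WeightedH1 v) : WeightedH1 fun x => u x - v x where
  diff := hu.diff.sub hv.diff
  memLp := hu.memLp.sub hv.memLp
  memLp_deriv := by
    have h : deriv (fun x => u x - v x) = fun x => deriv u x - deriv v x :=
      funext fun x => deriv_fun_sub (hu.diff x) (hv.diff x)
    rw [h]
    exact hu.memLp_deriv.sub hv.memLp_deriv
  memLp_mul := by
    simp_rw [mul_sub]
    exact hu.memLp_mul.sub hv.memLp_mul

variable {m : ℕ} {V : ℝ → ℝ} {u v : ℝ → ℂ}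

lemma norm_deriv_mul_le (hV : PotentialBound m V) (hm : 1 ≤ m) (u : ℝ → ℂ) (x : ℝ) :
    ‖((deriv V x : ℝ) : ℂ) * u x‖ ≤
      |deriv V 0| * ‖u x‖ + supN (iteratedDeriv 2 V) * ‖(x : ℂ) * u x‖ := by
  rw [norm_mul, norm_mul, Complex.norm_real, Complex.norm_real, Real.norm_eq_abs, Real.norm_eq_abs,
    ← mul_assoc, ← add_mul]
  exact mul_le_mul_of_nonneg_right (hV.abs_deriv_le hm x) (norm_nonneg _)

lemma memLp_potential_mul (hu : WeightedH1 u) (hV : PotentialBound m V) (hm : 1 ≤ m) :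
    MemLp (fun x => ((deriv V x : ℝ) : ℂ) * u x) 2 volume := by
  have h : MemLp (fun x => |deriv V 0| * ‖u x‖ + supN (iteratedDeriv 2 V) * ‖(x : ℂ) * u x‖)
      2 volume := (hu.memLp.norm.const_mul _).add (hu.memLp_mul.norm.const_mul _)
  refine h.mono ?_ (Filter.Eventually.of_forall fun x => ?_)
  · exact ((Complex.continuous_ofReal.comp hV.contDiff_deriv.continuous).mul
      hu.diff.continuous).aestronglyMeasurable
  · exact (norm_deriv_mul_le hV hm u x).trans (le_abs_self _)

lemma memLp_Dop (hu : WeightedH1 u) (hV : PotentialBound m V) (hm : 1 ≤ m) :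
    MemLp (Dop V u) 2 volume := hu.memLp_deriv.add (hu.memLp_potential_mul hV hm)

lemma memLp_Dstar (hu : WeightedH1 u) (hV : PotentialBound m V) (hm : 1 ≤ m) :
    MemLp (Dstar V u) 2 volume := hu.memLp_deriv.neg.add (hu.memLp_potential_mul hV hm)

lemma integrable_conj_mul {f g : ℝ → ℂ} (hf : MemLp f 2 volume) (hg : MemLp g 2 volume) :
    Integrable (fun x => starRingEnd ℂ (f x) * g x) volume :=
  (hf.star).integrable_mul hg

lemma integral_conj_mul_deriv (hu : WeightedH1 u) (hv : WeightedH1 v) :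
    ∫ x, starRingEnd ℂ (u x) * deriv v x = -∫ x, starRingEnd ℂ (deriv u x) * v x := by
  refine integral_mul_deriv_eq_deriv_mul_of_integrable (u := fun x => starRingEnd ℂ (u x))
    (u' := fun x => starRingEnd ℂ (deriv u x)) (fun x _ => ?_) (fun x _ => (hv.diff x).hasDerivAt)
    (integrable_conj_mul hu.memLp hv.memLp_deriv) (integrable_conj_mul hu.memLp_deriv hv.memLp)
    (integrable_conj_mul hu.memLp hv.memLp)
  exact (hu.diff x).hasDerivAt.star

/-- `𝒟*` is the formal adjoint of `𝒟`. -/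
lemma integral_conj_mul_Dstar (hu : WeightedH1 u) (hv : WeightedH1 v) (hV : PotentialBound m V)
    (hm : 1 ≤ m) :
    ∫ x, starRingEnd ℂ (u x) * Dstar V v x = ∫ x, starRingEnd ℂ (Dop V u x) * v x := by
  have h1 : ∀ x, starRingEnd ℂ (u x) * Dstar V v x = -(starRingEnd ℂ (u x) * deriv v x) +
      starRingEnd ℂ (u x) * (((deriv V x : ℝ) : ℂ) * v x) := fun x => by rw [Dstar]; ring
  have h2 : ∀ x, starRingEnd ℂ (Dop V u x) * v x = starRingEnd ℂ (deriv u x) * v x +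
      starRingEnd ℂ (u x) * (((deriv V x : ℝ) : ℂ) * v x) := fun x => by
    rw [Dop, map_add, map_mul, Complex.conj_ofReal]; ring
  simp_rw [h1, h2]
  rw [integral_add (f := fun x => -(starRingEnd ℂ (u x) * deriv v x)) (integrable_conj_mul hu.memLp hv.memLp_deriv).neg
      (integrable_conj_mul hu.memLp (hv.memLp_potential_mul hV hm)),
    integral_add (integrable_conj_mul hu.memLp_deriv hv.memLp)
      (integrable_conj_mul hu.memLp (hv.memLp_potential_mul hV hm)), integral_neg,
    integral_conj_mul_deriv hu hv, neg_neg]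

lemma Dop_const_mul_sub (hu : WeightedH1 u) (hv : WeightedH1 v) (V : ℝ → ℝ) (c : ℂ) (x : ℝ) :
    Dop V (fun x => c * u x - v x) x = c * Dop V u x - Dop V v x := by
  rw [Dop, Dop, Dop, deriv_fun_sub ((hu.diff x).const_mul c) (hv.diff x), deriv_const_mul c (hu.diff x)]
  ring

lemma Dstar_const_mul_sub (hu : WeightedH1 u) (hv : WeightedH1 v) (V : ℝ → ℝ) (c : ℂ) (x : ℝ) :
    Dstar V (fun x => c * u x - v x) x = c * Dstar V u x - Dstar V v x := by
  rw [Dstar, Dstar, Dstar, deriv_fun_sub ((hu.diff x).const_mul c) (hv.diff x),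
    deriv_const_mul c (hu.diff x)]
  ring

end WeightedH1

/-- The ladder operator `(u_k) ↦ -i(√(k/2) 𝒟 u_{k-1} + √((k+1)/2) 𝒟* u_{k+1})`. -/
def ladder (V : ℝ → ℝ) (u : ℕ → ℝ → ℂ) (k : ℕ) (x : ℝ) : ℂ :=
  -Complex.I * ((Real.sqrt ((k : ℝ) / 2) : ℂ) * Dop V (u (k - 1)) x +
    (Real.sqrt (((k : ℝ) + 1) / 2) : ℂ) * Dstar V (u (k + 1)) x)

/-- The commutator of the ladder operator with the multiplication by a real sequence `χ`. -/
def ladderComm (V : ℝ → ℝ) (χ : ℕ → ℝ) (u : ℕ → ℝ → ℂ) (k : ℕ) (x : ℝ) : ℂ :=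
  -Complex.I * ((Real.sqrt ((k : ℝ) / 2) * (χ k - χ (k - 1)) : ℝ) * Dop V (u (k - 1)) x +
    (Real.sqrt (((k : ℝ) + 1) / 2) * (χ k - χ (k + 1)) : ℝ) * Dstar V (u (k + 1)) x)

section

variable {m : ℕ} {V : ℝ → ℝ} {u v : ℕ → ℝ → ℂ}

lemma mul_ladder_sub_ladder (hu : ∀ k, WeightedH1 (u k)) (hv : ∀ k, WeightedH1 (v k)) (χ : ℕ → ℝ)
    (k : ℕ) (x : ℝ) : (χ k : ℂ) * ladder V u k x - ladder V v k x =
      ladder V (fun k x => (χ k : ℂ) * u k x - v k x) k x + ladderComm V χ u k x := by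
  simp only [ladder, ladderComm]
  rw [WeightedH1.Dop_const_mul_sub (hu _) (hv _), WeightedH1.Dstar_const_mul_sub (hu _) (hv _)]
  push_cast
  ring

lemma memLp_ladder (hu : ∀ k, WeightedH1 (u k)) (hV : PotentialBound m V) (hm : 1 ≤ m) (k : ℕ) :
    MemLp (ladder V u k) 2 volume :=
  ((((hu _).memLp_Dop hV hm).const_mul _).add (((hu _).memLp_Dstar hV hm).const_mul _)).const_mul _

lemma memLp_ladderComm (hu : ∀ k, WeightedH1 (u k)) (hV : PotentialBound m V) (hm : 1 ≤ m)
    (χ : ℕ → ℝ) (k : ℕ) : MemLp (ladderComm V χ u k) 2 volume :=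
  ((((hu _).memLp_Dop hV hm).const_mul _).add (((hu _).memLp_Dstar hV hm).const_mul _)).const_mul _

lemma re_integral_conj_mul_ladder (hu : ∀ k, WeightedH1 (u k)) (hV : PotentialBound m V)
    (hm : 1 ≤ m) (k : ℕ) :
    (∫ x, starRingEnd ℂ (u k x) * ladder V u k x).re =
      Real.sqrt ((k : ℝ) / 2) * (∫ x, starRingEnd ℂ (u k x) * Dop V (u (k - 1)) x).im -
      Real.sqrt (((k : ℝ) + 1) / 2) * (∫ x, starRingEnd ℂ (u (k + 1) x) * Dop V (u k) x).im := by
  have h1 : ∀ x, starRingEnd ℂ (u k x) * ladder V u k x =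
      -Complex.I * ((Real.sqrt ((k : ℝ) / 2) : ℂ) * (starRingEnd ℂ (u k x) * Dop V (u (k - 1)) x) +
        (Real.sqrt (((k : ℝ) + 1) / 2) : ℂ) * (starRingEnd ℂ (u k x) * Dstar V (u (k + 1)) x)) :=
    fun x => by rw [ladder]; ring
  have h2 : ∫ x, starRingEnd ℂ (Dop V (u k) x) * u (k + 1) x =
      starRingEnd ℂ (∫ x, starRingEnd ℂ (u (k + 1) x) * Dop V (u k) x) := by
    rw [← integral_conj]
    refine integral_congr_ae (Filter.Eventually.of_forall fun x => ?_)
    simp only [map_mul, Complex.conj_conj]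
    ring
  simp_rw [h1]
  rw [integral_const_mul, integral_add
    ((WeightedH1.integrable_conj_mul (hu k).memLp ((hu _).memLp_Dop hV hm)).const_mul _)
    ((WeightedH1.integrable_conj_mul (hu k).memLp ((hu _).memLp_Dstar hV hm)).const_mul _),
    integral_const_mul, integral_const_mul,
    WeightedH1.integral_conj_mul_Dstar (hu k) (hu (k + 1)) hV hm, h2]
  generalize (∫ x, starRingEnd ℂ (u (k + 1) x) * Dop V (u k) x) = z
  generalize (∫ x, starRingEnd ℂ (u k x) * Dop V (u (k - 1)) x) = w
  simp [Complex.mul_re, Complex.mul_im]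
  ring

/-- The ladder operator, truncated to indices `k ≤ N`, is skew-adjoint. -/
lemma sum_re_integral_conj_mul_ladder (hu : ∀ k, WeightedH1 (u k)) (hV : PotentialBound m V)
    (hm : 1 ≤ m) {N : ℕ} (hN : ∀ x, u (N + 1) x = 0) :
    ∑ k ∈ Finset.range (N + 1), (∫ x, starRingEnd ℂ (u k x) * ladder V u k x).re = 0 := by
  have h : ∀ k, (∫ x, starRingEnd ℂ (u k x) * ladder V u k x).re =
      (fun k : ℕ => Real.sqrt ((k : ℝ) / 2) *
        (∫ x, starRingEnd ℂ (u k x) * Dop V (u (k - 1)) x).im) k -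
      (fun k : ℕ => Real.sqrt ((k : ℝ) / 2) *
        (∫ x, starRingEnd ℂ (u k x) * Dop V (u (k - 1)) x).im) (k + 1) := by
    intro k
    rw [re_integral_conj_mul_ladder hu hV hm k]
    simp
  rw [Finset.sum_congr rfl fun k _ => h k, Finset.sum_range_sub']
  simp [hN]

end

lemma L2one_nonneg (u : ℝ → ℂ) : 0 ≤ L2one u := ENNReal.toReal_nonneg

lemma L2one_add_le {u v : ℝ → ℂ} (hu : MemLp u 2 volume) (hv : MemLp v 2 volume) :
    L2one (fun x => u x + v x) ≤ L2one u + L2one v := by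
  rw [L2one, L2one, L2one, ← ENNReal.toReal_add hu.2.ne hv.2.ne]
  exact ENNReal.toReal_mono (ENNReal.add_lt_top.2 ⟨hu.2, hv.2⟩).ne
    (eLpNorm_add_le hu.1 hv.1 (by norm_num))

lemma L2one_mono {u : ℝ → ℂ} {w : ℝ → ℝ} (hw : MemLp w 2 volume) (h : ∀ x, ‖u x‖ ≤ w x) :
    L2one u ≤ (eLpNorm w 2 volume).toReal :=
  ENNReal.toReal_mono hw.2.ne (eLpNorm_mono_real h)

/-- Upper bound for the norms of `𝒟 u` and `𝒟* u`. -/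
def dBound (V : ℝ → ℝ) (u : ℝ → ℂ) : ℝ :=
  L2one (deriv u) + (|deriv V 0| * L2one u + supN (iteratedDeriv 2 V) * L2one (fun x => (x : ℂ) * u x))

lemma dBound_nonneg (V : ℝ → ℝ) (u : ℝ → ℂ) : 0 ≤ dBound V u := by
  have := supN_nonneg (iteratedDeriv 2 V)
  have h1 := L2one_nonneg u
  have h2 := L2one_nonneg (deriv u)
  have h3 := L2one_nonneg (fun x => (x : ℂ) * u x)
  unfold dBound
  positivity

section

variable {m : ℕ} {V : ℝ → ℝ} {u : ℝ → ℂ}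

lemma L2one_potential_mul_le (hu : WeightedH1 u) (hV : PotentialBound m V) (hm : 1 ≤ m) :
    L2one (fun x => ((deriv V x : ℝ) : ℂ) * u x) ≤
      |deriv V 0| * L2one u + supN (iteratedDeriv 2 V) * L2one (fun x => (x : ℂ) * u x) := by
  have h1 : MemLp (fun x => |deriv V 0| * ‖u x‖) 2 volume := hu.memLp.norm.const_mul _
  have h2 : MemLp (fun x : ℝ => supN (iteratedDeriv 2 V) * ‖(x : ℂ) * u x‖) 2 volume :=
    hu.memLp_mul.norm.const_mul _
  refine (L2one_mono (h1.add h2) (WeightedH1.norm_deriv_mul_le hV hm u)).trans ?_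
  refine (ENNReal.toReal_mono (ENNReal.add_lt_top.2 ⟨h1.2, h2.2⟩).ne
    (eLpNorm_add_le h1.1 h2.1 (by norm_num))).trans_eq ?_
  rw [ENNReal.toReal_add h1.2.ne h2.2.ne]
  have h3 : ∀ (c : ℝ) (w : ℝ → ℂ), 0 ≤ c →
      (eLpNorm (fun x => c * ‖w x‖) 2 volume).toReal = c * L2one w := by
    intro c w hc
    have := eLpNorm_const_smul c (fun x => ‖w x‖) 2 (volume : Measure ℝ)
    rw [show (fun x => c * ‖w x‖) = c • fun x => ‖w x‖ from rfl, this, ENNReal.toReal_mul,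
      toReal_enorm, Real.norm_of_nonneg hc, eLpNorm_norm, L2one]
  rw [h3 _ _ (abs_nonneg _), h3 _ _ (supN_nonneg _)]

lemma L2one_Dop_le (hu : WeightedH1 u) (hV : PotentialBound m V) (hm : 1 ≤ m) :
    L2one (Dop V u) ≤ dBound V u :=
  (L2one_add_le hu.memLp_deriv (hu.memLp_potential_mul hV hm)).trans
    (add_le_add le_rfl (L2one_potential_mul_le hu hV hm))

lemma L2one_Dstar_le (hu : WeightedH1 u) (hV : PotentialBound m V) (hm : 1 ≤ m) :
    L2one (Dstar V u) ≤ dBound V u := by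
  refine (L2one_add_le hu.memLp_deriv.neg (hu.memLp_potential_mul hV hm)).trans
    (add_le_add ?_ (L2one_potential_mul_le hu hV hm))
  rw [L2one, eLpNorm_neg, L2one]

lemma L2one_ladderComm_le {u : ℕ → ℝ → ℂ} (hu : ∀ k, WeightedH1 (u k)) (hV : PotentialBound m V)
    (hm : 1 ≤ m) (χ : ℕ → ℝ) (k : ℕ) : L2one (ladderComm V χ u k) ≤
      Real.sqrt ((k : ℝ) / 2) * |χ k - χ (k - 1)| * dBound V (u (k - 1)) +
      Real.sqrt (((k : ℝ) + 1) / 2) * |χ k - χ (k + 1)| * dBound V (u (k + 1)) := by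
  have h := L2one_const_mul (-Complex.I) fun x =>
    ((Real.sqrt ((k : ℝ) / 2) * (χ k - χ (k - 1)) : ℝ) : ℂ) * Dop V (u (k - 1)) x +
    ((Real.sqrt (((k : ℝ) + 1) / 2) * (χ k - χ (k + 1)) : ℝ) : ℂ) * Dstar V (u (k + 1)) x
  rw [norm_neg, Complex.norm_I, one_mul] at h
  refine h.trans_le ((L2one_add_le (((hu _).memLp_Dop hV hm).const_mul _)
    (((hu _).memLp_Dstar hV hm).const_mul _)).trans ?_)
  rw [L2one_const_mul, L2one_const_mul, Complex.norm_real, Complex.norm_real, norm_mul, norm_mul,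
    Real.norm_of_nonneg (Real.sqrt_nonneg _), Real.norm_of_nonneg (Real.sqrt_nonneg _),
    Real.norm_eq_abs, Real.norm_eq_abs]
  exact add_le_add
    (mul_le_mul_of_nonneg_left (L2one_Dop_le (hu _) hV hm) (by positivity))
    (mul_le_mul_of_nonneg_left (L2one_Dstar_le (hu _) hV hm) (by positivity))

end

lemma succ_pow_sub_pow_le (q : ℕ) {a : ℝ} (ha : 0 ≤ a) :
    (a + 1) ^ (q + 1) - a ^ (q + 1) ≤ ((q : ℝ) + 1) * (a + 1) ^ q := by
  induction q with
  | zero => simp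
  | succ q ih =>
    have h1 : (a + 1) ^ (q + 1 + 1) - a ^ (q + 1 + 1) =
        (a + 1) ^ (q + 1) + a * ((a + 1) ^ (q + 1) - a ^ (q + 1)) := by ring
    have h2 : a * ((a + 1) ^ (q + 1) - a ^ (q + 1)) ≤ (a + 1) * (((q : ℝ) + 1) * (a + 1) ^ q) :=
      mul_le_mul (by linarith) ih (sub_nonneg.2 (pow_le_pow_left₀ ha (by linarith) _)) (by linarith)
    rw [h1]
    push_cast
    calc (a + 1) ^ (q + 1) + a * ((a + 1) ^ (q + 1) - a ^ (q + 1))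
        ≤ (a + 1) ^ (q + 1) + (a + 1) * (((q : ℝ) + 1) * (a + 1) ^ q) := by linarith
      _ = _ := by ring

/-- Cutoff of the Hermite modes, decreasing from `1` at `k = 0` to `0` at `k = N + 1`. -/
def cutoff (p N k : ℕ) : ℝ := 1 - ((k : ℝ) / ((N : ℝ) + 1)) ^ p

lemma cutoff_succ_self (p N : ℕ) : cutoff p N (N + 1) = 0 := by
  have : ((N : ℝ) + 1) ≠ 0 := by positivity
  rw [cutoff]; push_cast; rw [div_self this, one_pow, sub_self]

lemma abs_cutoff_sub_succ_le (q N k : ℕ) :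
    |cutoff (q + 1) N k - cutoff (q + 1) N (k + 1)| ≤
      ((q : ℝ) + 1) * ((k : ℝ) + 1) ^ q / ((N : ℝ) + 1) ^ (q + 1) := by
  have hk : (0 : ℝ) ≤ k := Nat.cast_nonneg k
  have h : cutoff (q + 1) N k - cutoff (q + 1) N (k + 1) =
      (((k : ℝ) + 1) ^ (q + 1) - (k : ℝ) ^ (q + 1)) / ((N : ℝ) + 1) ^ (q + 1) := by
    simp only [cutoff, div_pow]; push_cast; ring
  rw [h, abs_of_nonneg (div_nonneg (sub_nonneg.2 (pow_le_pow_left₀ hk (by linarith) _))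
    (by positivity))]
  exact div_le_div_of_nonneg_right (succ_pow_sub_pow_le q hk) (by positivity)

lemma sq_sqrt_half_mul_le {c d a b : ℝ} (hc : 0 ≤ c) (hd : 0 ≤ d) :
    (Real.sqrt (c / 2) * a + Real.sqrt (d / 2) * b) ^ 2 ≤ c * a ^ 2 + d * b ^ 2 := by
  have h1 := Real.sq_sqrt (div_nonneg hc zero_le_two)
  have h2 := Real.sq_sqrt (div_nonneg hd zero_le_two)
  nlinarith [sq_nonneg (Real.sqrt (c / 2) * a - Real.sqrt (d / 2) * b)]

lemma succ_mul_sq_cutoff_le (q N k : ℕ) (d : ℝ) :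
    ((k : ℝ) + 1) * (|cutoff (q + 1) N k - cutoff (q + 1) N (k + 1)| * d) ^ 2 ≤
      (((q : ℝ) + 1) / ((N : ℝ) + 1) ^ (q + 1)) ^ 2 * (((k : ℝ) + 1) ^ (2 * q + 1) * d ^ 2) := by
  have h := pow_le_pow_left₀ (abs_nonneg _) (abs_cutoff_sub_succ_le q N k) 2
  calc ((k : ℝ) + 1) * (|cutoff (q + 1) N k - cutoff (q + 1) N (k + 1)| * d) ^ 2
      = ((k : ℝ) + 1) * d ^ 2 * |cutoff (q + 1) N k - cutoff (q + 1) N (k + 1)| ^ 2 := by ring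
    _ ≤ ((k : ℝ) + 1) * d ^ 2 *
        (((q : ℝ) + 1) * ((k : ℝ) + 1) ^ q / ((N : ℝ) + 1) ^ (q + 1)) ^ 2 :=
        mul_le_mul_of_nonneg_left h (by positivity)
    _ = _ := by ring

lemma sum_sq_commutator_le (q N : ℕ) (d s : ℕ → ℝ) (hs0 : ∀ k, 0 ≤ s k)
    (hs : ∀ k, s k ≤
      Real.sqrt ((k : ℝ) / 2) * |cutoff (q + 1) N k - cutoff (q + 1) N (k - 1)| * d (k - 1) +
      Real.sqrt (((k : ℝ) + 1) / 2) * |cutoff (q + 1) N k - cutoff (q + 1) N (k + 1)| * d (k + 1)) :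
    ∑ k ∈ Finset.range (N + 1), s k ^ 2 ≤
      2 * (((q : ℝ) + 1) / ((N : ℝ) + 1) ^ (q + 1)) ^ 2 *
        ∑ k ∈ Finset.range (N + 2), ((k : ℝ) + 1) ^ (2 * q + 1) * d k ^ 2 := by
  set A := (((q : ℝ) + 1) / ((N : ℝ) + 1) ^ (q + 1)) ^ 2 with hA
  have hA0 : 0 ≤ A := sq_nonneg _
  set g : ℕ → ℝ := fun k => ((k : ℝ) + 1) ^ (2 * q + 1) * d k ^ 2 with hg
  have hg0 : ∀ k, 0 ≤ g k := fun k => by positivity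
  set f : ℕ → ℝ := fun k => if k = 0 then 0 else g (k - 1) with hf
  have hstep : ∀ k, s k ^ 2 ≤ A * f k + A * g (k + 1) := by
    intro k
    have h1 := pow_le_pow_left₀ (hs0 k) (hs k) 2
    simp only [mul_assoc] at h1
    refine h1.trans ((sq_sqrt_half_mul_le (Nat.cast_nonneg k) (by positivity)).trans ?_)
    refine add_le_add ?_ ?_
    · cases k with
      | zero => simp [hf]
      | succ k =>
        have h2 := succ_mul_sq_cutoff_le q N k (d k)
        simp only [hf, Nat.add_sub_cancel, Nat.add_eq_zero_iff, one_ne_zero, and_false, if_false]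
        rw [abs_sub_comm]
        push_cast
        exact h2
    · refine (succ_mul_sq_cutoff_le q N k (d (k + 1))).trans ?_
      refine mul_le_mul_of_nonneg_left ?_ hA0
      simp only [hg]
      push_cast
      exact mul_le_mul_of_nonneg_right (pow_le_pow_left₀ (by positivity) (by linarith) _)
        (sq_nonneg _)
  have h1 : ∑ k ∈ Finset.range (N + 1), f k ≤ ∑ k ∈ Finset.range (N + 2), g k := by
    rw [Finset.sum_range_succ']
    simp only [hf, Nat.add_sub_cancel, Nat.add_eq_zero_iff, one_ne_zero, and_false, if_false,
      if_true, add_zero]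
    exact Finset.sum_le_sum_of_subset_of_nonneg
      (Finset.range_mono (by omega)) fun k _ _ => hg0 k
  have h2 : ∑ k ∈ Finset.range (N + 1), g (k + 1) ≤ ∑ k ∈ Finset.range (N + 2), g k := by
    rw [Finset.sum_range_succ' g (N + 1)]
    linarith [hg0 0]
  calc ∑ k ∈ Finset.range (N + 1), s k ^ 2
      ≤ ∑ k ∈ Finset.range (N + 1), (A * f k + A * g (k + 1)) :=
        Finset.sum_le_sum fun k _ => hstep k
    _ = A * ∑ k ∈ Finset.range (N + 1), f k + A * ∑ k ∈ Finset.range (N + 1), g (k + 1) := by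
        rw [Finset.sum_add_distrib, Finset.mul_sum, Finset.mul_sum]
    _ ≤ A * ∑ k ∈ Finset.range (N + 2), g k + A * ∑ k ∈ Finset.range (N + 2), g k :=
        add_le_add (mul_le_mul_of_nonneg_left h1 hA0) (mul_le_mul_of_nonneg_left h2 hA0)
    _ = _ := by ring

lemma one_le_CmV {m : ℕ} (hm : 1 ≤ m) (V : ℝ → ℝ) :
    1 ≤ CmV m V ∧ |deriv V 0| ≤ CmV m V ∧ supN (iteratedDeriv 2 V) ≤ CmV m V := by
  have hm' : (1 : ℝ) ≤ m := by exact_mod_cast hm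
  have h0 := supN_nonneg (iteratedDeriv 2 V)
  have h1 := abs_nonneg (deriv V 0)
  have h2 := maxDeriv_nonneg m V
  have h3 : 0 ≤ 2 ^ m * (1 + (m : ℝ)) * m * maxDeriv m V := by positivity
  have h4 : CmV m V = ((m : ℝ) ^ 2 + 2 * m + m * supN (iteratedDeriv 2 V) + m * |deriv V 0|) +
    2 ^ m * (1 + (m : ℝ)) * m * maxDeriv m V := rfl
  have h5 := mul_le_mul_of_nonneg_right hm' h0
  have h6 := mul_le_mul_of_nonneg_right hm' h1
  rw [h4]
  refine ⟨?_, ?_, ?_⟩ <;> nlinarith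

lemma opW_one_zero (F : SchwartzPlane) : opW 1 0 0 0 F = opX F := by simp [opW]

lemma opW_zero_one (F : SchwartzPlane) : opW 0 1 0 0 F = opDx F := by simp [opW]

lemma opW_zero_zero (F : SchwartzPlane) : opW 0 0 0 0 F = F := by simp [opW]

/-- Weighted summability of the Hermite coefficients of `𝒟`-type derivatives. -/
lemma exists_sum_pow_mul_dBound_cf_le (q : ℕ) : ∃ K : ℝ, 0 ≤ K ∧
    ∀ (V : ℝ → ℝ) (F : SchwartzPlane) (n : ℕ),
      ∑ k ∈ Finset.range n, ((k : ℝ) + 1) ^ (2 * q + 1) * dBound V (cf k F) ^ 2 ≤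
        K * (CmV (2 * (q + 1)) V * wNorm (2 * (q + 1)) F) ^ 2 := by
  obtain ⟨K₁, hK₁, h₁⟩ := exists_sum_pow_mul_L2one_cf_le (2 * q + 1) 0 1
  obtain ⟨K₂, hK₂, h₂⟩ := exists_sum_pow_mul_L2one_cf_le (2 * q + 1) 0 0
  obtain ⟨K₃, hK₃, h₃⟩ := exists_sum_pow_mul_L2one_cf_le (2 * q + 1) 1 0
  refine ⟨3 * (K₁ + K₂ + K₃), by positivity, fun V F n => ?_⟩
  obtain ⟨hC1, hC2, hC3⟩ := one_le_CmV (m := 2 * (q + 1)) (by omega) V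
  set C := CmV (2 * (q + 1)) V
  set W := wNorm (2 * (q + 1)) F with hW
  have hC0 : 0 ≤ C := zero_le_one.trans hC1
  have hmono : ∀ {l : ℕ} {K : ℝ}, 0 ≤ K → l ≤ 2 * (q + 1) → K * wNorm l F ^ 2 ≤ K * W ^ 2 :=
    fun hK hl => mul_le_mul_of_nonneg_left
      (pow_le_pow_left₀ (wNorm_nonneg _ _) (wNorm_mono hl F) 2) hK
  have e₁ := (h₁ F n).trans (hmono hK₁ (by omega))
  have e₂ := (h₂ F n).trans (hmono hK₂ (by omega))
  have e₃ := (h₃ F n).trans (hmono hK₃ (by omega))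
  simp only [opW_one_zero, opW_zero_one, opW_zero_zero] at e₁ e₂ e₃
  have hd : ∀ k, dBound V (cf k F) ^ 2 ≤ 3 * C ^ 2 * (L2one (cf k (opDx F)) ^ 2 +
      L2one (cf k F) ^ 2 + L2one (cf k (opX F)) ^ 2) := by
    intro k
    have hx : (fun x : ℝ => (x : ℂ) * cf k F x) = cf k (opX F) := funext fun x => (cf_opX k F x).symm
    have hle : dBound V (cf k F) ≤
        C * (L2one (cf k (opDx F)) + L2one (cf k F) + L2one (cf k (opX F))) := by
      rw [dBound, deriv_cf, hx]
      have n1 := mul_le_mul_of_nonneg_right hC1 (L2one_nonneg (cf k (opDx F)))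
      have n2 := mul_le_mul_of_nonneg_right hC2 (L2one_nonneg (cf k F))
      have n3 := mul_le_mul_of_nonneg_right hC3 (L2one_nonneg (cf k (opX F)))
      linarith
    refine (pow_le_pow_left₀ (dBound_nonneg _ _) hle 2).trans ?_
    generalize L2one (cf k (opDx F)) = a
    generalize L2one (cf k F) = b
    generalize L2one (cf k (opX F)) = c
    have : (a + b + c) ^ 2 ≤ 3 * (a ^ 2 + b ^ 2 + c ^ 2) := by
      nlinarith [sq_nonneg (a - b), sq_nonneg (b - c), sq_nonneg (a - c)]
    calc (C * (a + b + c)) ^ 2 = C ^ 2 * (a + b + c) ^ 2 := by ring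
      _ ≤ C ^ 2 * (3 * (a ^ 2 + b ^ 2 + c ^ 2)) := mul_le_mul_of_nonneg_left this (sq_nonneg _)
      _ = _ := by ring
  calc ∑ k ∈ Finset.range n, ((k : ℝ) + 1) ^ (2 * q + 1) * dBound V (cf k F) ^ 2
      ≤ ∑ k ∈ Finset.range n, ((k : ℝ) + 1) ^ (2 * q + 1) * (3 * C ^ 2 *
        (L2one (cf k (opDx F)) ^ 2 + L2one (cf k F) ^ 2 + L2one (cf k (opX F)) ^ 2)) :=
        Finset.sum_le_sum fun k _ => mul_le_mul_of_nonneg_left (hd k) (by positivity)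
    _ = 3 * C ^ 2 * (∑ k ∈ Finset.range n, ((k : ℝ) + 1) ^ (2 * q + 1) * L2one (cf k (opDx F)) ^ 2 +
        ∑ k ∈ Finset.range n, ((k : ℝ) + 1) ^ (2 * q + 1) * L2one (cf k F) ^ 2 +
        ∑ k ∈ Finset.range n, ((k : ℝ) + 1) ^ (2 * q + 1) * L2one (cf k (opX F)) ^ 2) := by
        rw [← Finset.sum_add_distrib, ← Finset.sum_add_distrib, Finset.mul_sum]
        exact Finset.sum_congr rfl fun k _ => by ring
    _ ≤ 3 * C ^ 2 * (K₁ * W ^ 2 + K₂ * W ^ 2 + K₃ * W ^ 2) :=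
        mul_le_mul_of_nonneg_left (by linarith) (by positivity)
    _ = _ := by ring

/-- Size of the commutator of the ladder operator with the cutoff, on Hermite coefficients. -/
lemma exists_sum_sq_ladderComm_le (q : ℕ) : ∃ K : ℝ, 0 ≤ K ∧
    ∀ {V : ℝ → ℝ}, PotentialBound (2 * (q + 1)) V → ∀ (F : SchwartzPlane) (N : ℕ),
      ∑ k ∈ Finset.range (N + 1),
          L2one (ladderComm V (cutoff (q + 1) N) (fun k => cf k F) k) ^ 2 ≤
        (K / ((N : ℝ) + 1) ^ (q + 1) * (CmV (2 * (q + 1)) V * wNorm (2 * (q + 1)) F)) ^ 2 := by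
  obtain ⟨K, hK, h⟩ := exists_sum_pow_mul_dBound_cf_le q
  refine ⟨((q : ℝ) + 1) * Real.sqrt (2 * K), by positivity, fun {V} hV F N => ?_⟩
  have h1 := sum_sq_commutator_le q N (fun k => dBound V (cf k F))
    (fun k => L2one (ladderComm V (cutoff (q + 1) N) (fun k => cf k F) k))
    (fun k => L2one_nonneg _)
    (fun k => L2one_ladderComm_le (u := fun k => cf k F) (fun k => weightedH1_cf k F) hV
      (by omega) _ k)
  refine h1.trans ((mul_le_mul_of_nonneg_left (h V F (N + 2)) (by positivity)).trans_eq ?_)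
  have h2 := Real.sq_sqrt (show (0 : ℝ) ≤ 2 * K by positivity)
  generalize CmV (2 * (q + 1)) V * wNorm (2 * (q + 1)) F = Y
  generalize ((N : ℝ) + 1) ^ (q + 1) = X
  calc 2 * (((q : ℝ) + 1) / X) ^ 2 * (K * Y ^ 2) = (((q : ℝ) + 1) / X) ^ 2 * (2 * K) * Y ^ 2 := by ring
    _ = (((q : ℝ) + 1) / X) ^ 2 * Real.sqrt (2 * K) ^ 2 * Y ^ 2 := by rw [h2]
    _ = _ := by ring

lemma wD_zero (f : ℝ → ℝ → ℂ) : wD 0 0 0 0 f = f := by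
  funext x y; simp [wD, pd2]

lemma L2one_congr {u : L2Line} {v : ℝ → ℂ} (h : (u : ℝ → ℂ) =ᵐ[volume] v) : ‖u‖ = L2one v := by
  rw [Lp.norm_def, eLpNorm_congr_ae h, L2one]

lemma inner_eq_integral_of_ae {u w : L2Line} {v z : ℝ → ℂ} (h : (u : ℝ → ℂ) =ᵐ[volume] v)
    (h' : (w : ℝ → ℂ) =ᵐ[volume] z) : inner ℂ u w = ∫ x, starRingEnd ℂ (v x) * z x := by
  rw [L2.inner_def]
  refine integral_congr_ae ?_
  filter_upwards [h, h'] with x hx hx'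
  rw [hx, hx', RCLike.inner_apply, mul_comm]

/-- Vectors of `N + 1` Hermite coefficients. -/
abbrev CoefVec (N : ℕ) := PiLp 2 fun _ : Fin (N + 1) => L2Line

lemma CoefVec.norm_sq_eq {N : ℕ} {E : CoefVec N} {e : ℕ → ℝ → ℂ}
    (h : ∀ k : Fin (N + 1), (E k : ℝ → ℂ) =ᵐ[volume] e k) :
    ‖E‖ ^ 2 = ∑ k ∈ Finset.range (N + 1), L2one (e k) ^ 2 := by
  rw [PiLp.norm_sq_eq_of_L2, Finset.sum_range fun k => L2one (e k) ^ 2]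
  exact Finset.sum_congr rfl fun k _ => by rw [L2one_congr (h k)]

/-- Only the commutator contributes to the energy balance. -/
lemma re_inner_ladder_add_le {m N : ℕ} {V : ℝ → ℝ} (hV : PotentialBound m V) (hm : 1 ≤ m)
    {u e : ℕ → ℝ → ℂ} {χ : ℕ → ℝ} (hu : ∀ k, WeightedH1 (u k)) (he : ∀ k, WeightedH1 (e k))
    (hN : ∀ x, e (N + 1) x = 0) {E E' : CoefVec N} (hE : ∀ k, (E k : ℝ → ℂ) =ᵐ[volume] e k)
    (hE' : ∀ k, (E' k : ℝ → ℂ) =ᵐ[volume] fun x => ladder V e k x + ladderComm V χ u k x)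
    {B : ℝ} (hB0 : 0 ≤ B)
    (hB : ∑ k ∈ Finset.range (N + 1), L2one (ladderComm V χ u k) ^ 2 ≤ B ^ 2) :
    (inner ℂ E E').re ≤ ‖E‖ * B := by
  let A : CoefVec N := WithLp.toLp 2 fun k => (memLp_ladder he hV hm k).toLp
  let Q : CoefVec N := WithLp.toLp 2 fun k => (memLp_ladderComm hu hV hm χ k).toLp
  have hA : ∀ k, (A k : ℝ → ℂ) =ᵐ[volume] ladder V e k := fun k =>
    (memLp_ladder he hV hm k).coeFn_toLp
  have hQ : ∀ k, (Q k : ℝ → ℂ) =ᵐ[volume] ladderComm V χ u k := fun k =>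
    (memLp_ladderComm hu hV hm χ k).coeFn_toLp
  have hsum : E' = A + Q := by
    ext1 k
    refine Lp.ext ((hE' k).trans ?_)
    rw [PiLp.add_apply]
    filter_upwards [Lp.coeFn_add (A k) (Q k), hA k, hQ k] with x h1 h2 h3
    rw [h1, Pi.add_apply, h2, h3]
  have hAE : (inner ℂ E A).re = 0 := by
    rw [PiLp.inner_apply, Complex.re_sum,
      ← sum_re_integral_conj_mul_ladder he hV hm hN, Finset.sum_range]
    exact Finset.sum_congr rfl fun k _ => by rw [inner_eq_integral_of_ae (hE k) (hA k)]
  have hQn : ‖Q‖ ≤ B := by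
    refine (sq_le_sq₀ (norm_nonneg _) hB0).1 ?_
    rwa [CoefVec.norm_sq_eq hQ]
  rw [hsum, inner_add_right, Complex.add_re, hAE, zero_add]
  calc (inner ℂ E Q).re ≤ ‖inner ℂ E Q‖ := Complex.re_le_norm _
    _ ≤ ‖E‖ * ‖Q‖ := norm_inner_le_norm _ _
    _ ≤ ‖E‖ * B := mul_le_mul_of_nonneg_left hQn (norm_nonneg _)

lemma IsSCGalerkinSol.weightedH1 {V : ℝ → ℝ} {N : ℕ} {R : ℕ → ℝ → ℝ → ℂ}
    (hR : IsSCGalerkinSol V N R) {t : ℝ} (ht : 0 ≤ t) (k : ℕ) : WeightedH1 (R k t) := by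
  rcases le_or_gt k N with hk | hk
  · exact WeightedH1.of_isSchwartz1 (hR.1.2.1 k hk t ht)
  · have h : R k t = (0 : SchwartzMap ℝ ℂ) := funext fun x => hR.1.2.2.2 k hk t x
    rw [h]
    exact WeightedH1.of_schwartz 0

lemma IsSCGalerkinSol.deriv_eq {V : ℝ → ℝ} {N : ℕ} {R : ℕ → ℝ → ℝ → ℂ}
    (hR : IsSCGalerkinSol V N R) {t : ℝ} (ht : 0 ≤ t) {k : ℕ} (hk : k ≤ N) (x : ℝ) :
    deriv (fun s => R k s x) t = ladder V (fun k => R k t) k x := by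
  rw [eq_neg_of_add_eq_zero_left (hR.2 k hk t ht x), ladder, neg_mul]

/-- The truncated Hermite coefficients of the exact solution stay close to the Galerkin solution. -/
lemma exists_galerkin_energy_le (q : ℕ) : ∃ K : ℝ, 0 ≤ K ∧
    ∀ {V : ℝ → ℝ}, PotentialBound (2 * (q + 1)) V → ∀ {S : ℝ → ℝ → ℝ → ℂ}, IsSCSol V S →
    ∀ {N : ℕ} {R : ℕ → ℝ → ℝ → ℂ}, IsSCGalerkinSol V N R →
      (∀ k, k ≤ N → ∀ x : ℝ, R k 0 x = hcoef k (S 0 x)) → ∀ {t : ℝ}, 0 ≤ t →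
        ∑ k ∈ Finset.range (N + 1),
            L2one (fun x => (cutoff (q + 1) N k : ℂ) * hcoef k (S t x) - R k t x) ^ 2 ≤
          (K / ((N : ℝ) + 1) ^ (q + 1) *
            (Real.exp (CmV (2 * (q + 1)) V * t) * NN (2 * (q + 1)) (S 0))) ^ 2 := by
  obtain ⟨K₁, hK₁, h₁⟩ := exists_sum_sq_ladderComm_le q
  obtain ⟨K₂, hK₂, h₂⟩ := exists_sum_pow_mul_L2one_cf_le (2 * q + 2) 0 0
  refine ⟨K₁ + Real.sqrt K₂, by positivity, ?_⟩
  intro V hV S hS N R hR h0 t ht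
  have hm : 1 ≤ 2 * (q + 1) := by omega
  set C := CmV (2 * (q + 1)) V with hC
  set W := NN (2 * (q + 1)) (S 0) with hW
  set χ := cutoff (q + 1) N with hχ
  have hC1 : 1 ≤ C := (one_le_CmV hm V).1
  have hS0 : IsSchwartz2 (S 0) := hS.1.2.1 0 le_rfl
  have hWeq : ∀ {s} (hs : 0 ≤ s), NN (2 * (q + 1)) (S s) =
      wNorm (2 * (q + 1)) (hS.1.2.1 s hs).toSchwartz := fun hs => NN_eq _ _
  have hW0 : 0 ≤ W := by rw [hW, hWeq le_rfl]; exact wNorm_nonneg _ _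
  obtain ⟨Ψ, Ψ', hΨ, hΨ', hΨd, -⟩ := hS.1.2.2 0 0 0 0
  have hRk : ∀ k : Fin (N + 1), C1intoL2one (R k) := fun k => hR.1.2.2.1 k (by omega)
  choose Φ Φ' hΦ hΦ' hΦd hΦc using hRk
  simp only [wD_zero] at hΨ hΨ'
  set e : ℝ → ℕ → ℝ → ℂ := fun s k x => (χ k : ℂ) * hcoef k (S s x) - R k s x with he
  let E : ℝ → CoefVec N := fun s => WithLp.toLp 2 fun k =>
    (χ k : ℂ) • coefCLM k (Ψ s) - Φ k s
  let E' : ℝ → CoefVec N := fun s => WithLp.toLp 2 fun k =>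
    (χ k : ℂ) • coefCLM k (Ψ' s) - Φ' k s
  have hE : ∀ s, 0 ≤ s → ∀ k, (E s k : ℝ → ℂ) =ᵐ[volume] e s k := by
    intro s hs k
    filter_upwards [Lp.coeFn_sub ((χ k : ℂ) • coefCLM k (Ψ s)) (Φ k s),
      Lp.coeFn_smul (χ k : ℂ) (coefCLM k (Ψ s)), coeFn_coefCLM k (hΨ s hs), hΦ k s hs]
      with x e1 e2 e3 e4
    change ((χ k : ℂ) • coefCLM k (Ψ s) - Φ k s : L2Line) x = _
    rw [e1, Pi.sub_apply, e2, Pi.smul_apply, e3, e4, smul_eq_mul]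
    rfl
  have hE' : ∀ s (hs : 0 ≤ s), ∀ k, (E' s k : ℝ → ℂ) =ᵐ[volume] fun x =>
      ladder V (e s) k x + ladderComm V χ (fun k => cf k (hS.1.2.1 s hs).toSchwartz) k x := by
    intro s hs k
    have hk : (k : ℕ) ≤ N := by omega
    filter_upwards [Lp.coeFn_sub ((χ k : ℂ) • coefCLM k (Ψ' s)) (Φ' k s),
      Lp.coeFn_smul (χ k : ℂ) (coefCLM k (Ψ' s)), coeFn_coefCLM k (hΨ' s hs), hΦ' k s hs]
      with x e1 e2 e3 e4
    change ((χ k : ℂ) • coefCLM k (Ψ' s) - Φ' k s : L2Line) x = _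
    rw [e1, Pi.sub_apply, e2, Pi.smul_apply, e3, e4, smul_eq_mul, hR.deriv_eq hs hk,
      dtR_eq_scRhs hS hs]
    have h5 := hcoef_scRhs V (hS.1.2.1 s hs) k x
    simp only [unc]
    rw [h5]
    exact mul_ladder_sub_ladder (u := fun k => cf k (hS.1.2.1 s hs).toSchwartz)
      (fun k => weightedH1_cf k _) (fun k => hR.weightedH1 hs k) χ k x
  have hEd : ∀ s, 0 ≤ s → HasDerivWithinAt E (E' s) (Set.Ici 0) s := by
    intro s hs
    have h1 : HasDerivWithinAt (fun s (k : Fin (N + 1)) => (χ k : ℂ) • coefCLM k (Ψ s) - Φ k s)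
        (fun k => (χ k : ℂ) • coefCLM k (Ψ' s) - Φ' k s) (Set.Ici 0) s := by
      refine hasDerivWithinAt_pi.2 fun k => ?_
      refine HasDerivWithinAt.sub ?_ (hΦd k s hs)
      exact ((((χ k : ℂ) • coefCLM k).restrictScalars ℝ).hasFDerivAt.comp_hasDerivWithinAt s
        (hΨd s hs))
    exact ((PiLp.continuousLinearEquiv 2 ℝ fun _ : Fin (N + 1) => L2Line).symm :
      (Fin (N + 1) → L2Line) →L[ℝ] CoefVec N).hasFDerivAt.comp_hasDerivWithinAt s h1
  have hNpos : (0 : ℝ) < ((N : ℝ) + 1) ^ (q + 1) := by positivity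
  have hg : ∀ s, HasDerivAt (fun s => K₁ / ((N : ℝ) + 1) ^ (q + 1) * (Real.exp (C * s) * W))
      (K₁ / ((N : ℝ) + 1) ^ (q + 1) * (C * (Real.exp (C * s) * W))) s := by
    intro s
    have h1 : HasDerivAt (fun s => Real.exp (C * s)) (Real.exp (C * s) * (C * 1)) s :=
      ((hasDerivAt_id s).const_mul C).exp
    exact ((h1.mul_const W).const_mul _).congr_deriv (by ring)
  have hbound := norm_le_of_re_inner_deriv_le hEd hg (fun s hs => by positivity) (fun s hs => by
    refine re_inner_ladder_add_le hV hm (u := fun k => cf k (hS.1.2.1 s hs).toSchwartz)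
      (e := e s) (χ := χ) (fun k => weightedH1_cf k _) (fun k => ?_) (fun x => ?_) (hE s hs)
      (hE' s hs) (by positivity) ((h₁ hV _ N).trans ?_)
    · exact ((weightedH1_cf k (hS.1.2.1 s hs).toSchwartz).const_mul _).sub (hR.weightedH1 hs k)
    · simp only [he, hχ]
      rw [cutoff_succ_self, hR.1.2.2.2 (N + 1) (by omega)]
      simp
    · refine pow_le_pow_left₀ (mul_nonneg (by positivity)
        (mul_nonneg (by linarith) (wNorm_nonneg _ _))) ?_ 2
      rw [← hWeq hs]
      exact mul_le_mul_of_nonneg_left (mul_le_mul_of_nonneg_left (NN_le_exp hV hm hS hs)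
        (by linarith)) (by positivity)) ht
  have hinit : ‖E 0‖ ≤ Real.sqrt K₂ / ((N : ℝ) + 1) ^ (q + 1) * W := by
    refine (sq_le_sq₀ (norm_nonneg _) (by positivity)).1 ?_
    rw [CoefVec.norm_sq_eq (hE 0 le_rfl)]
    have h3 := h₂ hS0.toSchwartz (N + 1)
    simp only [opW_zero_zero] at h3
    have h4 : wNorm (2 * q + 2 + (0 + 0)) hS0.toSchwartz = W := (hWeq le_rfl).symm
    rw [h4] at h3
    have h5 : ∀ k ∈ Finset.range (N + 1), L2one (e 0 k) ^ 2 ≤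
        (1 / ((N : ℝ) + 1) ^ (q + 1)) ^ 2 *
          (((k : ℝ) + 1) ^ (2 * q + 2) * L2one (cf k hS0.toSchwartz) ^ 2) := by
      intro k hk
      have h6 : e 0 k = fun x => (-(((k : ℝ) / ((N : ℝ) + 1)) ^ (q + 1) : ℝ) : ℂ) *
          cf k hS0.toSchwartz x := by
        funext x
        have h7 : cf k hS0.toSchwartz x = hcoef k (S 0 x) := rfl
        simp only [he]
        rw [h0 k (by simpa [Nat.lt_succ_iff] using hk), h7, hχ, cutoff]
        push_cast
        ring
      have hk0 : (0 : ℝ) ≤ k := Nat.cast_nonneg k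
      rw [h6, L2one_const_mul, norm_neg, Complex.norm_real, Real.norm_of_nonneg (by positivity)]
      have h8 : (k : ℝ) ^ (2 * q + 2) ≤ ((k : ℝ) + 1) ^ (2 * q + 2) :=
        pow_le_pow_left₀ hk0 (by linarith) _
      calc (((k : ℝ) / ((N : ℝ) + 1)) ^ (q + 1) * L2one (cf k hS0.toSchwartz)) ^ 2
          = (1 / ((N : ℝ) + 1) ^ (q + 1)) ^ 2 *
            ((k : ℝ) ^ (2 * q + 2) * L2one (cf k hS0.toSchwartz) ^ 2) := by
            rw [div_pow]; ring
        _ ≤ _ := mul_le_mul_of_nonneg_left (mul_le_mul_of_nonneg_right h8 (sq_nonneg _))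
            (sq_nonneg _)
    refine (Finset.sum_le_sum h5).trans ?_
    rw [← Finset.mul_sum]
    refine (mul_le_mul_of_nonneg_left h3 (sq_nonneg _)).trans_eq ?_
    generalize ((N : ℝ) + 1) ^ (q + 1) = X
    rw [mul_pow (Real.sqrt K₂ / X), div_pow (Real.sqrt K₂), Real.sq_sqrt hK₂]
    ring
  rw [← CoefVec.norm_sq_eq (hE t ht)]
  refine pow_le_pow_left₀ (norm_nonneg _) ?_ 2
  have hexp : 1 ≤ Real.exp (C * t) := Real.one_le_exp (by positivity)
  have hWe : W ≤ Real.exp (C * t) * W := le_mul_of_one_le_left hW0 hexp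
  have h9 : 0 ≤ K₁ / ((N : ℝ) + 1) ^ (q + 1) * (Real.exp (C * 0) * W) := by positivity
  calc ‖E t‖ ≤ Real.sqrt K₂ / ((N : ℝ) + 1) ^ (q + 1) * W +
        K₁ / ((N : ℝ) + 1) ^ (q + 1) * (Real.exp (C * t) * W) := by linarith
    _ ≤ Real.sqrt K₂ / ((N : ℝ) + 1) ^ (q + 1) * (Real.exp (C * t) * W) +
        K₁ / ((N : ℝ) + 1) ^ (q + 1) * (Real.exp (C * t) * W) := by
        gcongr
    _ = _ := by ring

/-- Parseval's identity in the variable `y` for an error function of Galerkin type. -/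
lemma eLpNorm_sub_sum_sq (F : SchwartzPlane) {N : ℕ} {r : ℕ → ℝ → ℂ}
    (hr : ∀ k, WeightedH1 (r k)) (h0 : ∀ k, N < k → ∀ x, r k x = 0) :
    eLpNorm (fun z : ℝ × ℝ => F z - ∑ k ∈ Finset.range (N + 1), r k z.1 * ((Φh k z.2 : ℝ) : ℂ))
        2 volume ^ 2 =
      ∑' k, eLpNorm (fun x => cf k F x - r k x) 2 volume ^ 2 := by
  set G : ℝ × ℝ → ℂ :=
    fun z => F z - ∑ k ∈ Finset.range (N + 1), r k z.1 * ((Φh k z.2 : ℝ) : ℂ) with hG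
  have hΦ : ∀ k, Continuous fun y => ((Φh k y : ℝ) : ℂ) := fun k =>
    Complex.continuous_ofReal.comp (continuous_Φh k)
  have hGc : Continuous G := F.continuous.sub (continuous_finsetSum _ fun k _ =>
    ((hr k).diff.continuous.comp continuous_fst).mul ((hΦ k).comp continuous_snd))
  have hcoef_sum : ∀ k x, hcoef k (fun y => G (x, y)) = cf k F x - r k x := by
    intro k x
    have h1 : ∀ y, G (x, y) * ((Φh k y : ℝ) : ℂ) = F (x, y) * ((Φh k y : ℝ) : ℂ) -
        ∑ j ∈ Finset.range (N + 1), r j x * ((Φh j y * Φh k y : ℝ) : ℂ) := by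
      intro y
      simp only [hG, sub_mul, Finset.sum_mul]
      congr 1
      exact Finset.sum_congr rfl fun j _ => by push_cast; ring
    have hintegr : ∀ j ∈ Finset.range (N + 1),
        Integrable (fun y => r j x * ((Φh j y * Φh k y : ℝ) : ℂ)) volume := fun j _ =>
      ((integrable_Φh_mul j k).ofReal).const_mul _
    rw [hcoef]
    simp_rw [h1]
    rw [integral_sub (integrable_ySlice_mul_Φh F k x) (integrable_finsetSum _ hintegr),
      integral_finsetSum _ hintegr]
    congr 1
    simp_rw [integral_const_mul, integral_complex_ofReal, integral_Φh_mul]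
    rcases le_or_gt k N with hk | hk
    · rw [Finset.sum_eq_single_of_mem k (Finset.mem_range.2 (by omega))
        fun j _ hj => by simp [hj]]
      simp
    · rw [h0 k hk, Finset.sum_eq_zero fun j hj => ?_]
      have : j ≠ k := by have := Finset.mem_range.1 hj; omega
      simp [this]
  have hslice : ∀ x, MemLp (fun y => G (x, y)) 2 volume := fun x =>
    (memLp_ySlice F x).sub (memLp_finsetSum _ fun k _ => (memLp_ofReal_Φh k).const_mul (r k x))
  simp_rw [eLpNorm_two_sq]
  have hmeas : ∀ k, AEMeasurable (fun x => ‖cf k F x - r k x‖ₑ ^ 2) volume := fun k =>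
    (((continuous_cf k F).sub (hr k).diff.continuous).measurable.enorm.pow_const 2).aemeasurable
  rw [← lintegral_tsum hmeas]
  have h2 : ∀ x, ∑' k, ‖cf k F x - r k x‖ₑ ^ 2 = ∫⁻ y, ‖G (x, y)‖ₑ ^ 2 := fun x => by
    rw [← enorm_sq_hcoef (hslice x)]
    simp_rw [hcoef_sum]
  simp_rw [h2]
  exact lintegral_prod _ (hGc.measurable.enorm.pow_const 2).aemeasurable

/-- An `ℓ²` bound on the coefficients of the error bounds the error. -/
lemma toReal_eLpNorm_sub_sum_le (F : SchwartzPlane) {N : ℕ} {r : ℕ → ℝ → ℂ}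
    (hr : ∀ k, WeightedH1 (r k)) (h0 : ∀ k, N < k → ∀ x, r k x = 0) {B : ℝ} (hB : 0 ≤ B)
    (h : ∀ n, ∑ k ∈ Finset.range n, L2one (fun x => cf k F x - r k x) ^ 2 ≤ B ^ 2) :
    (eLpNorm (fun z : ℝ × ℝ => F z - ∑ k ∈ Finset.range (N + 1), r k z.1 * ((Φh k z.2 : ℝ) : ℂ))
        2 volume).toReal ≤ B := by
  refine ENNReal.toReal_le_of_le_ofReal hB
    ((ENNReal.pow_right_strictMono two_ne_zero).le_iff_le.1 ?_)
  rw [eLpNorm_sub_sum_sq F hr h0, ← ENNReal.ofReal_pow hB]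
  refine ENNReal.tsum_le_of_sum_range_le fun n => ?_
  have h1 : ∀ k, eLpNorm (fun x => cf k F x - r k x) 2 volume ^ 2 =
      ENNReal.ofReal (L2one (fun x => cf k F x - r k x) ^ 2) := fun k => by
    have hfin : eLpNorm (fun x => cf k F x - r k x) 2 volume ≠ ⊤ :=
      ((memLp_cf k F).sub (hr k).memLp).2.ne
    rw [ENNReal.ofReal_pow (L2one_nonneg _), L2one, ENNReal.ofReal_toReal hfin]
  simp_rw [h1]
  rw [← ENNReal.ofReal_sum_of_nonneg fun k _ => sq_nonneg _]
  exact ENNReal.ofReal_le_ofReal (h n)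

/-- The sum of an error controlled on modes `k ≤ N` and of the spectral tail. -/
lemma sum_sq_error_le {q N : ℕ} {e r s : ℕ → ℝ} (hr0 : ∀ k, 0 ≤ r k) (hs0 : ∀ k, 0 ≤ s k)
    (hlow : ∀ k, k ≤ N → r k ≤ e k + ((k : ℝ) / ((N : ℝ) + 1)) ^ (q + 1) * s k)
    (hhigh : ∀ k, N < k → r k ≤ s k) (n : ℕ) :
    ∑ k ∈ Finset.range n, r k ^ 2 ≤ 2 * ∑ k ∈ Finset.range (N + 1), e k ^ 2 +
      2 * (1 / ((N : ℝ) + 1) ^ (q + 1)) ^ 2 *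
        ∑ k ∈ Finset.range n, ((k : ℝ) + 1) ^ (2 * q + 2) * s k ^ 2 := by
  have hterm : ∀ k, r k ^ 2 ≤ 2 * (if k < N + 1 then e k ^ 2 else 0) +
      2 * (1 / ((N : ℝ) + 1) ^ (q + 1)) ^ 2 * (((k : ℝ) + 1) ^ (2 * q + 2) * s k ^ 2) := by
    intro k
    have hk0 : (0 : ℝ) ≤ k := Nat.cast_nonneg k
    have h1 : (((k : ℝ) / ((N : ℝ) + 1)) ^ (q + 1) * s k) ^ 2 ≤
        (1 / ((N : ℝ) + 1) ^ (q + 1)) ^ 2 * (((k : ℝ) + 1) ^ (2 * q + 2) * s k ^ 2) := by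
      have h8 : (k : ℝ) ^ (2 * q + 2) ≤ ((k : ℝ) + 1) ^ (2 * q + 2) :=
        pow_le_pow_left₀ hk0 (by linarith) _
      calc (((k : ℝ) / ((N : ℝ) + 1)) ^ (q + 1) * s k) ^ 2
          = (1 / ((N : ℝ) + 1) ^ (q + 1)) ^ 2 * ((k : ℝ) ^ (2 * q + 2) * s k ^ 2) := by
            rw [div_pow]; ring
        _ ≤ _ := mul_le_mul_of_nonneg_left (mul_le_mul_of_nonneg_right h8 (sq_nonneg _))
            (sq_nonneg _)
    by_cases hk : k < N + 1
    · rw [if_pos hk]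
      have h2 := pow_le_pow_left₀ (hr0 k) (hlow k (by omega)) 2
      nlinarith [sq_nonneg (e k - ((k : ℝ) / ((N : ℝ) + 1)) ^ (q + 1) * s k)]
    · rw [if_neg hk]
      have hN : ((N : ℝ) + 1) ≤ k := by exact_mod_cast not_lt.1 hk
      have h3 : 1 ≤ ((k : ℝ) / ((N : ℝ) + 1)) ^ (q + 1) :=
        one_le_pow₀ ((one_le_div (by positivity)).2 hN)
      have h4 : r k ≤ ((k : ℝ) / ((N : ℝ) + 1)) ^ (q + 1) * s k :=
        (hhigh k (by omega)).trans (le_mul_of_one_le_left (hs0 k) h3)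
      have h2 := pow_le_pow_left₀ (hr0 k) h4 2
      nlinarith [sq_nonneg (r k)]
  refine (Finset.sum_le_sum fun k _ => hterm k).trans ?_
  rw [Finset.sum_add_distrib, ← Finset.mul_sum, ← Finset.mul_sum, ← Finset.sum_filter]
  have : ∑ k ∈ Finset.range n with k < N + 1, e k ^ 2 ≤ ∑ k ∈ Finset.range (N + 1), e k ^ 2 :=
    Finset.sum_le_sum_of_subset_of_nonneg
      (fun k hk => Finset.mem_range.2 (Finset.mem_filter.1 hk).2) fun _ _ _ => sq_nonneg _
  linarith

lemma exists_L2_galerkin_error_le (q : ℕ) : ∃ K : ℝ, 0 ≤ K ∧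
    ∀ {V : ℝ → ℝ}, PotentialBound (2 * (q + 1)) V → ∀ {S : ℝ → ℝ → ℝ → ℂ}, IsSCSol V S →
    ∀ {N : ℕ} {R : ℕ → ℝ → ℝ → ℂ}, IsSCGalerkinSol V N R →
      (∀ k, k ≤ N → ∀ x : ℝ, R k 0 x = hcoef k (S 0 x)) → ∀ {t : ℝ}, 0 ≤ t →
        L2 (fun x y => S t x y - ∑ k ∈ Finset.range (N + 1), R k t x * ((Φh k y : ℝ) : ℂ)) ≤
          K / ((N : ℝ) + 1) ^ (q + 1) *
            (Real.exp (CmV (2 * (q + 1)) V * t) * NN (2 * (q + 1)) (S 0)) := by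
  obtain ⟨K₁, hK₁, h₁⟩ := exists_galerkin_energy_le q
  obtain ⟨K₂, hK₂, h₂⟩ := exists_sum_pow_mul_L2one_cf_le (2 * q + 2) 0 0
  refine ⟨Real.sqrt (2 * K₁ ^ 2 + 2 * K₂), by positivity, ?_⟩
  intro V hV S hS N R hR h0 t ht
  have hE := h₁ hV hS hR h0 ht
  have hSt := hS.1.2.1 t ht
  set F := hSt.toSchwartz with hF
  have hNN : 0 ≤ NN (2 * (q + 1)) (S 0) := by
    rw [NN_eq (hS.1.2.1 0 le_rfl)]; exact wNorm_nonneg _ _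
  set Y := Real.exp (CmV (2 * (q + 1)) V * t) * NN (2 * (q + 1)) (S 0) with hY
  have hY0 : 0 ≤ Y := mul_nonneg (Real.exp_pos _).le hNN
  have hWY : wNorm (2 * q + 2 + (0 + 0)) F ≤ Y :=
    (NN_eq hSt (2 * (q + 1))).symm.trans_le (NN_le_exp hV (by omega) hS ht)
  have hR' : ∀ k, WeightedH1 (R k t) := hR.weightedH1 ht
  refine toReal_eLpNorm_sub_sum_le F (r := fun k => R k t) hR'
    (fun k hk x => hR.1.2.2.2 k hk t x) (by positivity) fun n => ?_
  have hsum := sum_sq_error_le (q := q) (N := N)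
    (e := fun k => L2one fun x => (cutoff (q + 1) N k : ℂ) * cf k F x - R k t x)
    (r := fun k => L2one fun x => cf k F x - R k t x) (s := fun k => L2one (cf k F))
    (fun _ => L2one_nonneg _) (fun _ => L2one_nonneg _) (fun k hk => ?_) (fun k hk => ?_) n
  · refine hsum.trans ?_
    have h3 := h₂ F n
    simp only [opW_zero_zero] at h3
    have h4 := h3.trans
      (mul_le_mul_of_nonneg_left (pow_le_pow_left₀ (wNorm_nonneg _ _) hWY 2) hK₂)
    have h5 := mul_le_mul_of_nonneg_left h4
      (show 0 ≤ 2 * (1 / ((N : ℝ) + 1) ^ (q + 1)) ^ 2 by positivity)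
    have h6 := Real.sq_sqrt (show 0 ≤ 2 * K₁ ^ 2 + 2 * K₂ by positivity)
    refine (add_le_add (mul_le_mul_of_nonneg_left hE zero_le_two) h5).trans_eq ?_
    generalize ((N : ℝ) + 1) ^ (q + 1) = X
    rw [mul_pow (Real.sqrt _ / X), div_pow (Real.sqrt _), h6]
    ring
  · have h3 : (fun x => cf k F x - R k t x) = fun x =>
        ((cutoff (q + 1) N k : ℂ) * cf k F x - R k t x) +
          ((((k : ℝ) / ((N : ℝ) + 1)) ^ (q + 1) : ℝ) : ℂ) * cf k F x := by
      funext x; rw [cutoff]; push_cast; ring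
    have h4 := L2one_add_le (((memLp_cf k F).const_mul (cutoff (q + 1) N k : ℂ)).sub (hR' k).memLp)
      ((memLp_cf k F).const_mul ((((k : ℝ) / ((N : ℝ) + 1)) ^ (q + 1) : ℝ) : ℂ))
    rw [h3]
    refine h4.trans_eq ?_
    rw [L2one_const_mul, Complex.norm_real, Real.norm_of_nonneg (by positivity)]
    rfl
  · have h3 : (fun x => cf k F x - R k t x) = cf k F := by
      funext x; rw [hR.1.2.2.2 k hk t x, sub_zero]
    rw [h3]

/-- Spectral error estimate for the Hermite–Galerkin approximation of the
semiclassical equation (Theorem 2.2). -/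
theorem semiclassical_hermite_galerkin_error (p : ℕ) (hp : 1 ≤ p) :
    ∃ Kp Cp : ℝ, 0 < Kp ∧ 0 < Cp ∧
      ∀ V : ℝ → ℝ, ContDiff ℝ (2*p+2) V →
        (∀ n : ℕ, 2 ≤ n → n ≤ 2*p+2 → ∃ C : ℝ, ∀ x : ℝ, |iteratedDeriv n V x| ≤ C) →
        ∀ S : ℝ → ℝ → ℝ → ℂ, IsSCSol V S →
        ∀ N : ℕ, ∀ R : ℕ → ℝ → ℝ → ℂ, IsSCGalerkinSol V N R →
          (∀ k, k ≤ N → ∀ x : ℝ, R k 0 x = ∫ y : ℝ, S 0 x y * ((Φh k y : ℝ) : ℂ)) →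
          ∀ t : ℝ, 0 ≤ t →
            L2 (fun x y => S t x y - ∑ k ∈ Finset.range (N+1), R k t x * ((Φh k y : ℝ) : ℂ)) ≤
              Kp * Real.exp (CmV (2*p) V * t) / (2*(N:ℝ)+3)^p * NN (2*p) (S 0) +
              Real.sqrt (Cp * max 1 (max |deriv V 0| (supN (iteratedDeriv 2 V)))) /
                ((2*(N:ℝ)+3) ^ ((p : ℝ) - 1/2)) *
                ((Real.exp (CmV (2*p+1) V * t) - 1) / CmV (2*p+1) V) * NN (2*p+1) (S 0) := by
  obtain ⟨q, rfl⟩ := Nat.exists_eq_add_of_le' hp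
  obtain ⟨K, hK, h⟩ := exists_L2_galerkin_error_le q
  refine ⟨K * 3 ^ (q + 1) + 1, 1, by positivity, one_pos, ?_⟩
  intro V hV hVb S hS N R hR h0 t ht
  have hpot : PotentialBound (2 * (q + 1)) V :=
    ⟨hV.of_le (by norm_cast; omega), fun n h2 hn => hVb n h2 (by omega)⟩
  have hNN : ∀ m, 0 ≤ NN m (S 0) := fun m =>
    Finset.sum_nonneg fun _ _ => ENNReal.toReal_nonneg
  have hC := CmV_nonneg (2 * (q + 1) + 1) V
  have hexp : 1 ≤ Real.exp (CmV (2 * (q + 1) + 1) V * t) := Real.one_le_exp (mul_nonneg hC ht)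
  have hY : 0 ≤ Real.exp (CmV (2 * (q + 1)) V * t) * NN (2 * (q + 1)) (S 0) :=
    mul_nonneg (Real.exp_pos _).le (hNN _)
  have hscale : K / ((N : ℝ) + 1) ^ (q + 1) ≤
      (K * 3 ^ (q + 1) + 1) / (2 * (N : ℝ) + 3) ^ (q + 1) := by
    have h3 : (2 * (N : ℝ) + 3) ^ (q + 1) ≤ 3 ^ (q + 1) * ((N : ℝ) + 1) ^ (q + 1) := by
      rw [← mul_pow]
      exact pow_le_pow_left₀ (by positivity) (by linarith [Nat.cast_nonneg (α := ℝ) N]) _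
    rw [div_le_div_iff₀ (by positivity) (by positivity)]
    nlinarith [mul_le_mul_of_nonneg_left h3 hK, pow_pos (Nat.cast_add_one_pos (α := ℝ) N) (q + 1)]
  refine (h hpot hS hR h0 ht).trans
    (((mul_le_mul_of_nonneg_right hscale hY).trans_eq (by ring)).trans
      (le_add_of_nonneg_right ?_))
  exact mul_nonneg (mul_nonneg (by positivity) (div_nonneg (sub_nonneg.2 hexp) hC)) (hNN _)

end
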